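/- arXiv:math/0509269 — 5 statements merged into one kernel-verified Lean document; each statement's English description precedes it below -/
import Mathlib

section
/- Let A be a unital complex Banach algebra, n ≥ 1, and let x ∈ Lgₙ(A), i.e. x ∈ Aⁿ admits y₁,…,yₙ ∈ A with y₁x₁ + ⋯ + yₙxₙ = 1. Then the orbit map γₓ : GLₙ(A) → Aⁿ, γₓ(u) = u·x, is an open mapping: for every open subset U of GLₙ(A), the set {u·x : u ∈ U} is open in Aⁿ. (This is the openness part of the fibration theorem, stated in the unital case where the affine space Lₙ is identified with Aⁿ.) -/
theorem isOpen_units_matrix_aux (A : Type*) [NormedRing A] [CompleteSpace A] (n : ℕ) :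
    IsOpen {u : Matrix (Fin n) (Fin n) A | IsUnit u} := by
  let : NormedRing (Matrix (Fin n) (Fin n) A) := Matrix.linftyOpNormedRing
  have : @CompleteSpace (Matrix (Fin n) (Fin n) A)
      (PseudoMetricSpace.toUniformSpace) :=
    inferInstanceAs (CompleteSpace (Fin n → Fin n → A))
  have : HasSummableGeomSeries (Matrix (Fin n) (Fin n) A) :=
    @instHasSummableGeomSeriesOfCompleteSpace _ _ this
  exact Units.isOpen

/-- Let `A` be a unital complex Banach algebra, `n ≥ 1`, and `x ∈ Lgₙ(A)`,
i.e. `x ∈ Aⁿ` admits `y₁, …, yₙ ∈ A` with `Σ yₖxₖ = 1`.  Then the orbit map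
`γₓ : GLₙ(A) → Aⁿ`, `γₓ(u) = u·x`, is an open mapping. -/
theorem stmt_2
    (A : Type*) [NormedRing A] [NormedAlgebra ℂ A] [CompleteSpace A]
    (n : ℕ) (hn : 1 ≤ n) (x : Fin n → A)
    (hx : ∃ y : Fin n → A, ∑ k, y k * x k = 1) :
    ∀ U : Set {u : Matrix (Fin n) (Fin n) A // IsUnit u}, IsOpen U →
      IsOpen {z : Fin n → A | ∃ u ∈ U, (u : Matrix (Fin n) (Fin n) A).mulVec x = z} := by
  obtain ⟨y, hy⟩ := hx
  intro U hU
  obtain ⟨V, hV, rfl⟩ := isOpen_induced_iff.mp hU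
  rw [isOpen_iff_mem_nhds]
  rintro z0 ⟨u0, hu0, rfl⟩
  set z0 := (u0 : Matrix (Fin n) (Fin n) A).mulVec x with hz0
  let f : (Fin n → A) → Matrix (Fin n) (Fin n) A :=
    fun z => Matrix.of fun i j => u0.1 i j + (z i - z0 i) * y j
  have hf : Continuous f := by
    refine continuous_matrix fun i j => ?_
    simp only [f, Matrix.of_apply]
    fun_prop
  have hf0 : f z0 = u0.1 := by
    ext i j
    simp [f]
  have hW : IsOpen (V ∩ {u : Matrix (Fin n) (Fin n) A | IsUnit u}) :=
    hV.inter (isOpen_units_matrix_aux A n)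
  have hmem : z0 ∈ f ⁻¹' (V ∩ {u : Matrix (Fin n) (Fin n) A | IsUnit u}) := by
    rw [Set.mem_preimage, hf0]
    exact ⟨hu0, u0.2⟩
  filter_upwards [(hW.preimage hf).mem_nhds hmem] with z hz
  refine ⟨⟨f z, hz.2⟩, hz.1, ?_⟩
  ext i
  have h1 : z0 i = ∑ j, u0.1 i j * x j := rfl
  calc (f z).mulVec x i = ∑ j, (u0.1 i j + (z i - z0 i) * y j) * x j := rfl
    _ = ∑ j, u0.1 i j * x j + (z i - z0 i) * ∑ j, y j * x j := by
      simp only [add_mul, Finset.sum_add_distrib, Finset.mul_sum, mul_assoc]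
    _ = z i := by
      rw [hy, ← h1]
      simp
end

section
/- Let A be a unital complex Banach algebra and n ≥ 1. Then the space of last columns Lcₙ(A) = {u·eₙ : u ∈ GLₙ(A)} is an open subset of Aⁿ. (Hence Lcₙ(A) is homeomorphic to an open subset of a Banach space.) -/
theorem units_open_aux (A : Type*) [NormedRing A] [CompleteSpace A] (n : ℕ) :
    IsOpen {u : Matrix (Fin (n + 1)) (Fin (n + 1)) A | IsUnit u} := by
  let I : NormedRing (Matrix (Fin (n + 1)) (Fin (n + 1)) A) := Matrix.linftyOpNormedRing
  have h : @CompleteSpace (Matrix (Fin (n + 1)) (Fin (n + 1)) A)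
      I.toMetricSpace.toPseudoMetricSpace.toUniformSpace :=
    (inferInstance : CompleteSpace (Fin (n + 1) → Fin (n + 1) → A))
  have h2 : HasSummableGeomSeries (Matrix (Fin (n + 1)) (Fin (n + 1)) A) :=
    @instHasSummableGeomSeriesOfCompleteSpace _ I h
  exact @Units.isOpen _ I h2

/-- Let `A` be a unital complex Banach algebra and `n ≥ 1` (here the size is
`n + 1 ≥ 1`).  Then the space of last columns `Lcₙ(A) = {u·eₙ : u ∈ GLₙ(A)}` is an open subset
of `Aⁿ`. -/
theorem stmt_3
    (A : Type*) [NormedRing A] [NormedAlgebra ℂ A] [CompleteSpace A] (n : ℕ)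
    (e : Fin (n + 1) → A) (he : e = Pi.single (Fin.last n) (1 : A)) :
    IsOpen {z : Fin (n + 1) → A |
      ∃ u : Matrix (Fin (n + 1)) (Fin (n + 1)) A, IsUnit u ∧ u.mulVec e = z} := by
  subst he
  rw [isOpen_iff_mem_nhds]
  rintro z ⟨u, hu, rfl⟩
  have hc : Continuous fun z : Fin (n + 1) → A => u.updateCol (Fin.last n) z :=
    continuous_const.matrix_updateCol _ continuous_id
  have ho := (units_open_aux A n).preimage hc
  refine Filter.mem_of_superset (ho.mem_nhds ?_) ?_
  · have : u.updateCol (Fin.last n) (u.mulVec (Pi.single (Fin.last n) 1)) = u := by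
      ext i j
      rw [Matrix.updateCol_apply]
      split_ifs with h
      · simp [h]
      · rfl
    change IsUnit (u.updateCol (Fin.last n) (u.mulVec (Pi.single (Fin.last n) 1)))
    rwa [this]
  · intro z hz
    refine ⟨_, hz, ?_⟩
    ext i
    simp
end

section
/- Let A be a unital complex Banach algebra and n ≥ 1. Then the path component of eₙ in Lgₙ(A) equals the path component of eₙ in Lcₙ(A); in particular, every x ∈ Lgₙ(A) that can be joined to eₙ by a path inside Lgₙ(A) is of the form x = u·eₙ for some u ∈ GLₙ(A). Moreover, every element of this common path component is of the form u·eₙ with u lying in the path component of the identity matrix in GLₙ(A). -/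
theorem aux_isOpen_units (A : Type*) [NormedRing A] [CompleteSpace A] (n : ℕ) :
    IsOpen {v : Matrix (Fin (n + 1)) (Fin (n + 1)) A | IsUnit v} := by
  let : NormedRing (Matrix (Fin (n + 1)) (Fin (n + 1)) A) := Matrix.linftyOpNormedRing
  have : CompleteSpace (Matrix (Fin (n + 1)) (Fin (n + 1)) A) :=
    inferInstanceAs (CompleteSpace (Fin (n + 1) → Fin (n + 1) → A))
  have : HasSummableGeomSeries (Matrix (Fin (n + 1)) (Fin (n + 1)) A) :=
    @instHasSummableGeomSeriesOfCompleteSpace _ _ (by assumption)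
  exact Units.isOpen

theorem aux_eventually (A : Type*) [NormedRing A] [NormedAlgebra ℂ A] [CompleteSpace A] (n : ℕ) :
    ∀ᶠ u in nhds (1 : Matrix (Fin (n + 1)) (Fin (n + 1)) A),
      JoinedIn {v : Matrix (Fin (n + 1)) (Fin (n + 1)) A | IsUnit v} 1 u := by
  let : NormedSpace ℝ A := NormedSpace.restrictScalars ℝ ℂ A
  have : LocallyPathConnectedSpace (Matrix (Fin (n + 1)) (Fin (n + 1)) A) :=
    inferInstanceAs (LocallyPathConnectedSpace (Fin (n + 1) → Fin (n + 1) → A))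
  exact ((aux_isOpen_units A n).pathComponentIn 1).mem_nhds
    (mem_pathComponentIn_self isUnit_one)

theorem aux_map {X Y : Type*} [TopologicalSpace X] [TopologicalSpace Y] {S : Set X} {T : Set Y}
    {a b : X} (h : JoinedIn S a b) (f : X → Y) (hf : Continuous f) (hS : ∀ x ∈ S, f x ∈ T) :
    JoinedIn T (f a) (f b) := by
  obtain ⟨γ, hγ⟩ := h
  exact ⟨γ.map hf, fun t => hS _ (hγ t)⟩

/-- Let `A` be a unital complex Banach algebra and `n ≥ 1` (size `n + 1 ≥ 1`).
The path component of `eₙ` in `Lgₙ(A)` equals the path component of `eₙ` in `Lcₙ(A)`;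
moreover every element of this common path component is of the form `u·eₙ` with `u` in the
path component of the identity matrix in `GLₙ(A)`. -/
theorem stmt_4
    (A : Type*) [NormedRing A] [NormedAlgebra ℂ A] [CompleteSpace A] (n : ℕ)
    (e : Fin (n + 1) → A) (he : e = Pi.single (Fin.last n) (1 : A))
    (Lg : Set (Fin (n + 1) → A))
    (hLg : Lg = {x | ∃ y : Fin (n + 1) → A, ∑ k, y k * x k = 1})
    (Lc : Set (Fin (n + 1) → A))
    (hLc : Lc = {x | ∃ u : Matrix (Fin (n + 1)) (Fin (n + 1)) A, IsUnit u ∧ u.mulVec e = x}) :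
    (∀ x, JoinedIn Lg e x ↔ JoinedIn Lc e x) ∧
    (∀ x, JoinedIn Lg e x →
      ∃ u : Matrix (Fin (n + 1)) (Fin (n + 1)) A, IsUnit u ∧
        JoinedIn {v : Matrix (Fin (n + 1)) (Fin (n + 1)) A | IsUnit v} 1 u ∧
        u.mulVec e = x) := by
  have key : ∀ x, JoinedIn Lg e x →
      ∃ u : Matrix (Fin (n + 1)) (Fin (n + 1)) A, IsUnit u ∧
        JoinedIn {v : Matrix (Fin (n + 1)) (Fin (n + 1)) A | IsUnit v} 1 u ∧
        u.mulVec e = x := by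
    rintro x ⟨γ, hγ⟩
    let P : unitInterval → unitInterval → Prop := fun s t =>
      ∃ u : Matrix (Fin (n + 1)) (Fin (n + 1)) A, IsUnit u ∧
        JoinedIn {v : Matrix (Fin (n + 1)) (Fin (n + 1)) A | IsUnit v} 1 u ∧
        u.mulVec (γ s) = γ t
    have hP : P 0 1 := by
      refine @PreconnectedSpace.induction₂ _ _ _ P ⟨?symm⟩ ?near ⟨?trans⟩ 0 1
      case near =>
        intro s
        have hs := hγ s
        rw [hLg] at hs
        obtain ⟨y, hy⟩ := hs
        let F : unitInterval → Matrix (Fin (n + 1)) (Fin (n + 1)) A := fun t =>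
          1 + Matrix.vecMulVec (γ t - γ s) y
        have hF : Continuous F := by
          refine continuous_const.add ?_
          exact Continuous.matrix_vecMulVec (γ.continuous.sub continuous_const) continuous_const
        have hF1 : F s = 1 := by simp [F]
        have h1 := hF.tendsto s
        rw [hF1] at h1
        filter_upwards [h1.eventually (aux_eventually A n)] with t ht
        refine ⟨F t, ht.target_mem, ht, ?_⟩
        ext i
        change (1 + Matrix.vecMulVec (γ t - γ s) y).mulVec (γ s) i = γ t i
        rw [Matrix.add_mulVec, Matrix.one_mulVec, Pi.add_apply]
        simp only [Matrix.mulVec, dotProduct, Matrix.vecMulVec_apply, mul_assoc,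
          ← Finset.mul_sum, hy]
        simp
      case trans =>
        rintro a b c ⟨u, hu, hju, huv⟩ ⟨v, hv, hjv, hvv⟩
        refine ⟨v * u, hv.mul hu, ?_, ?_⟩
        · refine hjv.trans ?_
          have := aux_map (T := {v : Matrix (Fin (n + 1)) (Fin (n + 1)) A | IsUnit v}) hju
            (fun w => v * w) (continuous_const.mul continuous_id)
            (fun w hw => hv.mul hw)
          simpa using this
        · rw [← Matrix.mulVec_mulVec, huv, hvv]
      case symm =>
        rintro a b ⟨_, ⟨u, rfl⟩, hju, huv⟩
        refine ⟨(u⁻¹ : _ˣ), Units.isUnit _, ?_, ?_⟩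
        · have := aux_map (T := {v : Matrix (Fin (n + 1)) (Fin (n + 1)) A | IsUnit v}) hju
            (fun w => ((u⁻¹ : _ˣ) : Matrix (Fin (n + 1)) (Fin (n + 1)) A) * w)
            (continuous_const.mul continuous_id)
            (fun w hw => (Units.isUnit _).mul hw)
          simp only [mul_one, Units.inv_mul] at this
          exact this.symm
        · rw [← huv, Matrix.mulVec_mulVec, Units.inv_mul, Matrix.one_mulVec]
    simpa [P] using hP
  refine ⟨fun x => ⟨fun h => ?_, fun h => h.mono ?_⟩, key⟩
  · obtain ⟨u, -, hj, rfl⟩ := key x h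
    have := aux_map (T := Lc) hj (fun w => w.mulVec e)
      (Continuous.matrix_mulVec continuous_id continuous_const)
      (fun w hw => by rw [hLc]; exact ⟨w, hw, rfl⟩)
    simpa using this
  · rw [hLc, hLg]
    rintro _ ⟨_, ⟨u, rfl⟩, rfl⟩
    refine ⟨(u⁻¹ : _ˣ).val (Fin.last n), ?_⟩
    have : ((u⁻¹ : _ˣ).val.mulVec (u.val.mulVec e)) (Fin.last n) = 1 := by
      rw [Matrix.mulVec_mulVec, Units.inv_mul, Matrix.one_mulVec, he]; simp
    exact this
end

section
/- Let A be a unital complex Banach algebra and n ≥ 1. Then every connected component of Lcₙ(A) is path connected. Moreover, for every u ∈ GLₙ(A) the map x ↦ u·x is a homeomorphism of Lcₙ(A) onto itself carrying the connected component of eₙ onto the connected component of u·eₙ, and every connected component of Lcₙ(A) is the image of the component of eₙ under such a map. In particular, all connected components of Lcₙ(A) are homeomorphic to one another. -/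
attribute [local instance] Matrix.linftyOpNormedRing in
theorem aux_isOpen (A : Type*) [NormedRing A] [CompleteSpace A] (n : ℕ) :
    IsOpen {x : Fin (n + 1) → A | ∃ u : Matrix (Fin (n + 1)) (Fin (n + 1)) A,
      IsUnit u ∧ u.mulVec (Pi.single (Fin.last n) (1 : A)) = x} := by
  have hC0 : CompleteSpace (Fin (n + 1) → Fin (n + 1) → A) := inferInstance
  have hC : @CompleteSpace (Matrix (Fin (n + 1)) (Fin (n + 1)) A)
      PseudoMetricSpace.toUniformSpace := hC0
  have hS : HasSummableGeomSeries (Matrix (Fin (n + 1)) (Fin (n + 1)) A) := inferInstance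
  have hU : IsOpen {u : Matrix (Fin (n + 1)) (Fin (n + 1)) A | IsUnit u} := Units.isOpen
  rw [isOpen_iff_mem_nhds]
  rintro z ⟨u, hu, rfl⟩
  have hc : Continuous fun x : Fin (n + 1) → A => u.updateCol (Fin.last n) x :=
    continuous_const.matrix_updateCol _ continuous_id
  refine Filter.mem_of_superset ((hU.preimage hc).mem_nhds ?_) ?_
  · simp only [Set.mem_preimage, Set.mem_ofPred_eq, Matrix.mulVec_single_one]
    convert hu
    ext i j
    by_cases h : j = Fin.last n
    · subst h; simp
    · simp [Matrix.updateCol_ne h]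
  · intro x hx
    refine ⟨_, hx, ?_⟩
    rw [Matrix.mulVec_single_one]
    ext i
    simp

theorem aux_image {X : Type*} [TopologicalSpace X] (h : X ≃ₜ X) (x : X) :
    h '' connectedComponent x = connectedComponent (h x) := by
  apply Set.Subset.antisymm
  · exact h.continuous.image_connectedComponent_subset x
  · intro y hy
    have := h.symm.continuous.image_connectedComponent_subset (h x) ⟨y, hy, rfl⟩
    rw [h.symm_apply_apply] at this
    exact ⟨_, this, h.apply_symm_apply y⟩

/-- Let `A` be a unital complex Banach algebra and `n ≥ 1` (size `n + 1 ≥ 1`).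
Every connected component of `Lcₙ(A)` is path connected; for every `u ∈ GLₙ(A)` the map
`x ↦ u·x` is a homeomorphism of `Lcₙ(A)` onto itself carrying the component of `eₙ` onto the
component of `u·eₙ`; and every connected component of `Lcₙ(A)` is the image of the component
of `eₙ` under such a map.  In particular all components of `Lcₙ(A)` are homeomorphic. -/
theorem stmt_6
    (A : Type*) [NormedRing A] [NormedAlgebra ℂ A] [CompleteSpace A] (n : ℕ) :
    -- the last standard basis vector `eₙ ∈ Aⁿ`
    let e : Fin (n + 1) → A := Pi.single (Fin.last n) (1 : A)
    -- `Lcₙ(A) = {u·eₙ : u ∈ GLₙ(A)}` with the subspace topology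
    let Lc : Type _ := {x : Fin (n + 1) → A //
      ∃ u : Matrix (Fin (n + 1)) (Fin (n + 1)) A, IsUnit u ∧ u.mulVec e = x}
    -- the basepoint `eₙ ∈ Lcₙ(A)`
    let e₀ : Lc := ⟨e, 1, isUnit_one, Matrix.one_mulVec e⟩
    (∀ z : Lc, IsPathConnected (connectedComponent z)) ∧
    (∀ (u : Matrix (Fin (n + 1)) (Fin (n + 1)) A) (hu : IsUnit u),
      ∃ h : Lc ≃ₜ Lc,
        (∀ x : Lc, (h x : Fin (n + 1) → A) = u.mulVec (x : Fin (n + 1) → A)) ∧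
        h '' connectedComponent e₀ = connectedComponent ⟨u.mulVec e, u, hu, rfl⟩) ∧
    (∀ z : Lc, ∃ (u : Matrix (Fin (n + 1)) (Fin (n + 1)) A) (_ : IsUnit u) (h : Lc ≃ₜ Lc),
        (∀ x : Lc, (h x : Fin (n + 1) → A) = u.mulVec (x : Fin (n + 1) → A)) ∧
        connectedComponent z = h '' connectedComponent e₀) ∧
    (∀ z : Lc,
      Nonempty ((connectedComponent e₀ : Set Lc) ≃ₜ (connectedComponent z : Set Lc))) := by
  intro e Lc e₀
  have hlpc : LocallyPathConnectedSpace Lc := by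
    let _ : NormedSpace ℝ A := NormedSpace.restrictScalars ℝ ℂ A
    exact (aux_isOpen A n).locallyPathConnectedSpace
  have hmain : ∀ (u : Matrix (Fin (n + 1)) (Fin (n + 1)) A) (hu : IsUnit u),
      ∃ h : Lc ≃ₜ Lc,
        (∀ x : Lc, (h x : Fin (n + 1) → A) = u.mulVec (x : Fin (n + 1) → A)) ∧
        h '' connectedComponent e₀ = connectedComponent ⟨u.mulVec e, u, hu, rfl⟩ := by
    rintro _ ⟨u, rfl⟩
    have hm : ∀ (v : (Matrix (Fin (n + 1)) (Fin (n + 1)) A)ˣ) (x : Lc),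
        ∃ w : Matrix (Fin (n + 1)) (Fin (n + 1)) A, IsUnit w ∧
          w.mulVec e = v.val.mulVec x.1 := by
      rintro v ⟨x, w, hw, rfl⟩
      exact ⟨v.val * w, v.isUnit.mul hw, by rw [Matrix.mulVec_mulVec]⟩
    have hcont : ∀ v : (Matrix (Fin (n + 1)) (Fin (n + 1)) A)ˣ,
        Continuous fun x : Lc => (⟨v.val.mulVec x.1, hm v x⟩ : Lc) := fun v =>
      Continuous.subtype_mk (continuous_const.matrix_mulVec continuous_subtype_val) _
    let h : Lc ≃ₜ Lc :=
      { toFun := fun x => ⟨u.val.mulVec x.1, hm u x⟩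
        invFun := fun x => ⟨u⁻¹.val.mulVec x.1, hm u⁻¹ x⟩
        left_inv := fun x => Subtype.ext (by
          show u⁻¹.val.mulVec (u.val.mulVec x.1) = x.1
          rw [Matrix.mulVec_mulVec, Units.inv_mul, Matrix.one_mulVec])
        right_inv := fun x => Subtype.ext (by
          show u.val.mulVec (u⁻¹.val.mulVec x.1) = x.1
          rw [Matrix.mulVec_mulVec, Units.mul_inv, Matrix.one_mulVec])
        continuous_toFun := hcont u
        continuous_invFun := hcont u⁻¹ }
    exact ⟨h, fun _ => rfl, aux_image h e₀⟩
  have h3 : ∀ z : Lc, ∃ (u : Matrix (Fin (n + 1)) (Fin (n + 1)) A) (_ : IsUnit u)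
      (h : Lc ≃ₜ Lc),
        (∀ x : Lc, (h x : Fin (n + 1) → A) = u.mulVec (x : Fin (n + 1) → A)) ∧
        connectedComponent z = h '' connectedComponent e₀ := by
    rintro ⟨_, u, hu, rfl⟩
    obtain ⟨h, h1, h2⟩ := hmain u hu
    exact ⟨u, hu, h, h1, h2.symm⟩
  refine ⟨fun z => ?_, hmain, h3, fun z => ?_⟩
  · rw [← pathComponent_eq_connectedComponent]
    exact isPathConnected_pathComponent
  · obtain ⟨u, hu, h, -, h2⟩ := h3 z
    rw [h2]
    exact ⟨h.image _⟩
end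

section
/- (Davie) Let A be a commutative unital complex Banach algebra and n ≥ 1. Then the map Γₙ : GLₙ(A) → GLₙ(C(Max(A), ℂ)) induced entrywise by the Gelfand transform is a homotopy equivalence of topological spaces: there exists a continuous map h : GLₙ(C(Max(A), ℂ)) → GLₙ(A) such that h ∘ Γₙ is homotopic to the identity of GLₙ(A) and Γₙ ∘ h is homotopic to the identity of GLₙ(C(Max(A), ℂ)). -/
set_option linter.all false

namespace Dav

noncomputable section

/-- exponential in a complex Banach algebra -/
def ex {C : Type*} [NormedRing C] [NormedAlgebra ℂ C] (x : C) : C :=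
  letI := NormedAlgebra.restrictScalars ℚ ℂ C
  NormedSpace.exp x

section ex
variable {C : Type*} [NormedCommRing C] [NormedAlgebra ℂ C] [CompleteSpace C]

theorem ex_add (x y : C) : ex (x + y) = ex x * ex y := by
  letI := NormedAlgebra.restrictScalars ℚ ℂ C
  exact NormedSpace.exp_add

theorem ex_zero : ex (0 : C) = 1 := by
  letI := NormedAlgebra.restrictScalars ℚ ℂ C
  exact NormedSpace.exp_zero

theorem map_ex {D : Type*} [NormedCommRing D] [NormedAlgebra ℂ D] (f : C →ₐ[ℂ] D)
    (hf : Continuous f) (x : C) : f (ex x) = ex (f x) := by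
  letI := NormedAlgebra.restrictScalars ℚ ℂ C
  letI := NormedAlgebra.restrictScalars ℚ ℂ D
  exact NormedSpace.map_exp f hf x

theorem ex_complex (z : ℂ) : ex z = Complex.exp z := by
  rw [Complex.exp_eq_exp_ℂ]
  unfold ex
  congr!

theorem chi_cont (χ : C →ₐ[ℂ] ℂ) : Continuous χ := (AlgHom.toContinuousLinearMap χ).continuous

theorem chi_ex (χ : C →ₐ[ℂ] ℂ) (x : C) : χ (ex x) = Complex.exp (χ x) := by
  rw [map_ex χ (chi_cont χ), ex_complex]

theorem chi_le (χ : C →ₐ[ℂ] ℂ) (x : C) : ‖χ x‖ ≤ ‖(1:C)‖ * ‖x‖ := by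
  rw [mul_comm]; exact AlgHom.norm_apply_le_self_mul_norm_one χ x

end ex

section loc
variable {C : Type*} [NormedCommRing C] [NormedAlgebra ℂ C]

/-- weight -/
def rho (α β k : ℝ) : ℝ := max (Real.exp (α * k)) (Real.exp (β * k))

theorem rho_pos (α β k : ℝ) : 0 < rho α β k := lt_max_of_lt_left (Real.exp_pos _)

theorem rho_add (α β k l : ℝ) : rho α β (k + l) ≤ rho α β k * rho α β l := by
  unfold rho
  rw [mul_add, mul_add, Real.exp_add, Real.exp_add]
  apply max_le
  · exact mul_le_mul (le_max_left _ _) (le_max_left _ _) (Real.exp_pos _).le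
      (lt_max_of_lt_left (Real.exp_pos _)).le
  · exact mul_le_mul (le_max_right _ _) (le_max_right _ _) (Real.exp_pos _).le
      (lt_max_of_lt_left (Real.exp_pos _)).le

theorem rho_zero (α β : ℝ) : rho α β 0 = 1 := by simp [rho]

theorem rho_mono {α β α' β' x : ℝ} (h1 : α ≤ x) (h2 : x ≤ β) (k : ℝ) :
    Real.exp (x * k) ≤ rho α β k := by
  unfold rho
  rcases le_total 0 k with hk | hk
  · exact le_max_of_le_right (Real.exp_le_exp.2 (by nlinarith))
  · exact le_max_of_le_left (Real.exp_le_exp.2 (by nlinarith))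

theorem rho_split_pos {α c1 c2 k : ℝ} (h : α ≤ c2) (hk : 0 ≤ k) : rho α c2 k ≤ rho c1 c2 k :=
  max_le (le_max_of_le_right (Real.exp_le_exp.2 (by nlinarith))) (le_max_right _ _)

theorem rho_split_neg {β c1 c2 k : ℝ} (h : c1 ≤ β) (hk : k ≤ 0) : rho c1 β k ≤ rho c1 c2 k :=
  max_le (le_max_left _ _) (le_max_of_le_left (Real.exp_le_exp.2 (by nlinarith)))

/-- `Rep b α β f x`: `f` has a finite representation of cost at most `x` -/
inductive Rep (b : C) (α β : ℝ) : C → ℝ → Prop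
  | mono (c : C) (k : ℝ) : Rep b α β (c * ex ((k : ℂ) • b)) (‖c‖ * rho α β k)
  | add {f g : C} {x y : ℝ} : Rep b α β f x → Rep b α β g y → Rep b α β (f + g) (x + y)
  | le {f : C} {x y : ℝ} : Rep b α β f x → x ≤ y → Rep b α β f y

variable {b : C} {α β : ℝ}

theorem Rep.nonneg {f : C} {x : ℝ} (h : Rep b α β f x) : 0 ≤ x := by
  induction h with
  | mono c k => exact mul_nonneg (norm_nonneg _) (rho_pos _ _ _).le
  | add _ _ h1 h2 => exact add_nonneg h1 h2
  | le _ h1 h2 => exact h2.trans h1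

theorem Rep.smul' [CompleteSpace C] {f : C} {x : ℝ} (h : Rep b α β f x) (d : C) :
    Rep b α β (d * f) (‖d‖ * x) := by
  induction h with
  | mono c k =>
    rw [← mul_assoc]
    refine (Rep.mono (d * c) k).le ?_
    rw [← mul_assoc]
    exact mul_le_mul_of_nonneg_right (norm_mul_le _ _) (rho_pos _ _ _).le
  | add _ _ h1 h2 => rw [mul_add, mul_add]; exact h1.add h2
  | le _ h1 h2 => exact h2.le (mul_le_mul_of_nonneg_left h1 (norm_nonneg _))

theorem Rep.csmul [CompleteSpace C] {f : C} {x : ℝ} (h : Rep b α β f x) (z : ℂ) :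
    Rep b α β (z • f) (‖z‖ * x) := by
  induction h with
  | mono c k =>
    rw [← smul_mul_assoc]
    refine (Rep.mono (z • c) k).le ?_
    rw [← mul_assoc]
    exact mul_le_mul_of_nonneg_right (norm_smul_le _ _) (rho_pos _ _ _).le
  | add _ _ h1 h2 => rw [smul_add, mul_add]; exact h1.add h2
  | le _ h1 h2 => exact h2.le (mul_le_mul_of_nonneg_left h1 (norm_nonneg _))

theorem Rep.mul [CompleteSpace C] {f g : C} {x y : ℝ} (h : Rep b α β f x) (h' : Rep b α β g y) :
    Rep b α β (f * g) (x * y) := by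
  induction h with
  | mono c k =>
    have hy := h'.nonneg
    induction h' with
    | mono d l =>
      have : c * ex ((k:ℂ) • b) * (d * ex ((l:ℂ) • b)) = (c * d) * ex (((k + l : ℝ) : ℂ) • b) := by
        push_cast; rw [add_smul, ex_add]; ring
      rw [this]
      refine (Rep.mono (c * d) (k + l)).le ?_
      calc ‖c * d‖ * rho α β (k + l) ≤ (‖c‖ * ‖d‖) * (rho α β k * rho α β l) :=
            mul_le_mul (norm_mul_le _ _) (rho_add _ _ _ _) (rho_pos _ _ _).le (by positivity)
        _ = _ := by ring
    | add a1 a2 h1 h2 =>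
      rw [mul_add, mul_add]; exact (h1 a1.nonneg).add (h2 a2.nonneg)
    | le a1 h1 h2 =>
      exact (h2 a1.nonneg).le (mul_le_mul_of_nonneg_left h1
        (mul_nonneg (norm_nonneg _) (rho_pos _ _ _).le))
  | add _ _ h1 h2 => rw [add_mul, add_mul]; exact h1.add h2
  | le _ h1 h2 => exact h2.le (mul_le_mul_of_nonneg_right h1 h'.nonneg)

theorem Rep.base [CompleteSpace C] (f : C) : Rep b α β f ‖f‖ := by
  have := Rep.mono (b := b) (α := α) (β := β) f 0
  simpa [ex_zero, rho_zero] using this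

theorem Rep.sub_int [CompleteSpace C] {α' β' : ℝ} (h1 : α ≤ α') (h2 : α' ≤ β') (h3 : β' ≤ β) {f : C}
    {x : ℝ}
    (h : Rep b α β f x) : Rep b α' β' f x := by
  induction h with
  | mono c k =>
    refine (Rep.mono c k).le (mul_le_mul_of_nonneg_left ?_ (norm_nonneg _))
    exact max_le (rho_mono (α' := 0) (β' := 0) h1 (h2.trans h3) k)
      (rho_mono (α' := 0) (β' := 0) (h1.trans h2) h3 k)
  | add _ _ h1 h2 => exact h1.add h2
  | le _ h1 h2 => exact h2.le h1

theorem Rep.split [CompleteSpace C] {c1 c2 : ℝ} (h1 : α ≤ c2) (h3 : c1 ≤ β) {f : C}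
    {x : ℝ} (h : Rep b c1 c2 f x) :
    ∃ f1 f2 x1 x2, f = f1 + f2 ∧ Rep b α c2 f1 x1 ∧ Rep b c1 β f2 x2 ∧ x1 + x2 ≤ x := by
  induction h with
  | mono c k =>
    rcases le_total 0 k with hk | hk
    · exact ⟨_, 0, _, 0, (add_zero _).symm, Rep.mono c k, by simpa using Rep.base (b := b) (0:C), by
        rw [add_zero]
        exact mul_le_mul_of_nonneg_left (rho_split_pos h1 hk) (norm_nonneg _)⟩
    · exact ⟨0, _, 0, _, (zero_add _).symm, by simpa using Rep.base (b := b) (0:C), Rep.mono c k, by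
        rw [zero_add]
        exact mul_le_mul_of_nonneg_left (rho_split_neg h3 hk) (norm_nonneg _)⟩
  | add _ _ h1 h2 =>
    obtain ⟨f1, f2, x1, x2, e, r1, r2, l⟩ := h1
    obtain ⟨f1', f2', x1', x2', e', r1', r2', l'⟩ := h2
    exact ⟨f1 + f1', f2 + f2', x1 + x1', x2 + x2', by rw [e, e']; ring, r1.add r1', r2.add r2',
      by linarith⟩
  | le _ h1 h2 =>
    obtain ⟨f1, f2, x1, x2, e, r1, r2, l⟩ := h2
    exact ⟨f1, f2, x1, x2, e, r1, r2, l.trans h1⟩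

theorem norm_cexp (z : ℂ) (k : ℝ) : ‖Complex.exp ((k:ℂ) * z)‖ = Real.exp (z.re * k) := by
  rw [Complex.norm_exp]; simp [mul_comm]

theorem Rep.chi [CompleteSpace C] (χ : C →ₐ[ℂ] ℂ) (h1 : α ≤ (χ b).re) (h2 : (χ b).re ≤ β) {f : C}
    {x : ℝ} (h : Rep b α β f x) : ‖χ f‖ ≤ ‖(1:C)‖ * x := by
  induction h with
  | mono c k =>
    rw [map_mul, norm_mul, chi_ex, map_smul, smul_eq_mul, norm_cexp, ← mul_assoc]
    exact mul_le_mul (chi_le χ c) (rho_mono (α' := 0) (β' := 0) h1 h2 k) (Real.exp_pos _).le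
      (by positivity)
  | add _ _ h1 h2 => rw [map_add, mul_add]; exact (norm_add_le _ _).trans (add_le_add h1 h2)
  | le _ h1 h2 => exact h2.trans (mul_le_mul_of_nonneg_left h1 (norm_nonneg _))

/-- the localization seminorm -/
def nI (b : C) (α β : ℝ) (f : C) : ℝ := sInf {x | Rep b α β f x}

theorem nI_bdd (b : C) (α β : ℝ) (f : C) : BddBelow {x | Rep b α β f x} :=
  ⟨0, fun _ h => Rep.nonneg h⟩

theorem nI_le {f : C} {x : ℝ} (h : Rep b α β f x) : nI b α β f ≤ x := csInf_le (nI_bdd _ _ _ _) h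

theorem nI_nonneg (f : C) : 0 ≤ nI b α β f := Real.sInf_nonneg fun _ h => Rep.nonneg h

variable [CompleteSpace C]

theorem Rep.of_lt {f : C} {x : ℝ} (h : nI b α β f < x) : Rep b α β f x := by
  obtain ⟨y, hy, hyx⟩ := exists_lt_of_csInf_lt ⟨_, Rep.base f⟩ h
  exact hy.le hyx.le

theorem nI_le_norm (f : C) : nI b α β f ≤ ‖f‖ := nI_le (Rep.base f)

theorem nI_mul (f g : C) : nI b α β (f * g) ≤ nI b α β f * nI b α β g := by
  have key : ∀ ε > 0, nI b α β (f * g) ≤ (nI b α β f + ε) * (nI b α β g + ε) := fun ε hε =>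
    nI_le ((Rep.of_lt (by linarith)).mul (Rep.of_lt (by linarith)))
  have : Filter.Tendsto (fun ε : ℝ => (nI b α β f + ε) * (nI b α β g + ε)) (nhdsWithin 0 (Set.Ioi 0))
      (nhds ((nI b α β f + 0) * (nI b α β g + 0))) := by
    apply tendsto_nhdsWithin_of_tendsto_nhds
    exact Continuous.tendsto (by fun_prop) 0
  rw [add_zero, add_zero] at this
  exact ge_of_tendsto this (eventually_nhdsWithin_of_forall fun ε hε => key ε hε)

theorem nI_add (f g : C) : nI b α β (f + g) ≤ nI b α β f + nI b α β g := by
  refine le_of_forall_pos_le_add fun ε hε => ?_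
  refine (nI_le ((Rep.of_lt (x := nI b α β f + ε/2) (by linarith)).add
    (Rep.of_lt (x := nI b α β g + ε/2) (by linarith)))).trans (by linarith)

theorem nI_smul (z : ℂ) (f : C) : nI b α β (z • f) ≤ ‖z‖ * nI b α β f := by
  have key : ∀ ε > 0, nI b α β (z • f) ≤ ‖z‖ * (nI b α β f + ε) := fun ε hε =>
    nI_le ((Rep.of_lt (by linarith)).csmul z)
  have : Filter.Tendsto (fun ε : ℝ => ‖z‖ * (nI b α β f + ε)) (nhdsWithin 0 (Set.Ioi 0))
      (nhds (‖z‖ * (nI b α β f + 0))) := by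
    apply tendsto_nhdsWithin_of_tendsto_nhds
    exact Continuous.tendsto (by fun_prop) 0
  rw [add_zero] at this
  exact ge_of_tendsto this (eventually_nhdsWithin_of_forall fun ε hε => key ε hε)

theorem nI_zero : nI b α β (0:C) = 0 :=
  le_antisymm (by simpa using nI_le_norm (b := b) (α := α) (β := β) (0:C)) (nI_nonneg _)

theorem nI_neg (f : C) : nI b α β (-f) = nI b α β f := by
  have h : ∀ f : C, nI b α β (-f) ≤ nI b α β f := fun f => by
    simpa using nI_smul (b := b) (α := α) (β := β) (-1) f
  exact le_antisymm (h f) (by simpa using h (-f))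

theorem nI_mono {α' β' : ℝ} (h1 : α ≤ α') (h2 : α' ≤ β') (h3 : β' ≤ β) (f : C) :
    nI b α' β' f ≤ nI b α β f :=
  le_of_forall_pos_le_add fun ε hε =>
    nI_le ((Rep.of_lt (x := nI b α β f + ε) (by linarith)).sub_int h1 h2 h3)

theorem nI_split {c1 c2 : ℝ} (h1 : α ≤ c2) (h3 : c1 ≤ β) (f : C) {ε : ℝ} (hε : 0 < ε) :
    ∃ f1 f2, f = f1 + f2 ∧ nI b α c2 f1 ≤ nI b c1 c2 f + ε ∧ nI b c1 β f2 ≤ nI b c1 c2 f + ε := by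
  obtain ⟨f1, f2, x1, x2, e, r1, r2, l⟩ :=
    (Rep.of_lt (b := b) (α := c1) (β := c2) (f := f) (x := nI b c1 c2 f + ε) (by linarith)).split h1 h3
  exact ⟨f1, f2, e, by linarith [nI_le r1, r2.nonneg], by linarith [nI_le r2, r1.nonneg]⟩

theorem chi_nI (χ : C →ₐ[ℂ] ℂ) (h1 : α ≤ (χ b).re) (h2 : (χ b).re ≤ β) (f : C) :
    ‖χ f‖ ≤ ‖(1:C)‖ * nI b α β f := by
  have key : ∀ ε > 0, ‖χ f‖ ≤ ‖(1:C)‖ * (nI b α β f + ε) := fun ε hε =>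
    Rep.chi χ h1 h2 (Rep.of_lt (by linarith))
  have : Filter.Tendsto (fun ε : ℝ => ‖(1:C)‖ * (nI b α β f + ε)) (nhdsWithin 0 (Set.Ioi 0))
      (nhds (‖(1:C)‖ * (nI b α β f + 0))) := by
    apply tendsto_nhdsWithin_of_tendsto_nhds
    exact Continuous.tendsto (by fun_prop) 0
  rw [add_zero] at this
  exact ge_of_tendsto this (eventually_nhdsWithin_of_forall fun ε hε => key ε hε)

/-- type synonym carrying the seminorm -/
def Pre (_ : C) (_ _ : ℝ) : Type _ := C

instance (b : C) (α β : ℝ) : CommRing (Pre b α β) := inferInstanceAs (CommRing C)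
instance (b : C) (α β : ℝ) : Algebra ℂ (Pre b α β) := inferInstanceAs (Algebra ℂ C)

/-- the ring seminorm -/
def rsn (b : C) (α β : ℝ) : RingSeminorm (Pre b α β) where
  toFun f := nI (C := C) b α β f
  map_zero' := nI_zero (C := C)
  add_le' := nI_add (C := C)
  neg' := nI_neg (C := C)
  mul_le' := nI_mul (C := C)

instance (b : C) (α β : ℝ) : SeminormedCommRing (Pre b α β) :=
  { (rsn b α β).toSeminormedRing with mul_comm := mul_comm }

instance (b : C) (α β : ℝ) : NormedAlgebra ℂ (Pre b α β) :=
  { (inferInstance : Algebra ℂ (Pre b α β)) with norm_smul_le := fun z f => nI_smul (C := C) z f }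

/-- the localized Banach algebra -/
abbrev Loc (b : C) (α β : ℝ) : Type _ := UniformSpace.Completion (Pre b α β)

/-- the localization homomorphism -/
def jI (b : C) (α β : ℝ) : C →ₐ[ℂ] Loc b α β where
  toFun f := ((show Pre b α β from f : Pre b α β) : Loc b α β)
  map_one' := UniformSpace.Completion.coe_one _
  map_mul' f g := UniformSpace.Completion.coe_mul _ _
  map_zero' := UniformSpace.Completion.coe_zero
  map_add' f g := UniformSpace.Completion.coe_add _ _
  commutes' r := rfl

theorem norm_jI (f : C) : ‖jI b α β f‖ = nI b α β f :=
  UniformSpace.Completion.norm_coe (E := Pre b α β) f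

theorem dense_jI : DenseRange (jI b α β) := UniformSpace.Completion.denseRange_coe (α := Pre b α β)

theorem cont_jI : Continuous (jI b α β) :=
  AddMonoidHomClass.continuous_of_bound (jI b α β) 1 fun f => by
    rw [norm_jI, one_mul]; exact nI_le_norm f

theorem char_mem_aux {x y K : ℝ} (h : ∀ k : ℝ, 0 ≤ k → Real.exp (x * k) ≤ K * Real.exp (y * k)) :
    x ≤ y := by
  by_contra hxy
  push Not at hxy
  have ht : Filter.Tendsto (fun k : ℝ => Real.exp ((x - y) * k)) Filter.atTop Filter.atTop :=
    Real.tendsto_exp_atTop.comp (Filter.tendsto_id.const_mul_atTop (sub_pos.2 hxy))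
  obtain ⟨k, hk, hk0⟩ := ((ht.eventually_gt_atTop K).and (Filter.eventually_ge_atTop 0)).exists
  have := h k hk0
  rw [sub_mul, Real.exp_sub, lt_div_iff₀ (Real.exp_pos _)] at hk
  linarith

theorem char_mem (hαβ : α ≤ β) (ψ : Loc b α β →ₐ[ℂ] ℂ) :
    α ≤ (ψ (jI b α β b)).re ∧ (ψ (jI b α β b)).re ≤ β := by
  set χ : C →ₐ[ℂ] ℂ := ψ.comp (jI b α β) with hχ
  set x := (ψ (jI b α β b)).re with hx
  have key : ∀ k : ℝ, Real.exp (x * k) ≤ (‖(1 : Loc b α β)‖ * ‖(1:C)‖) * rho α β k := by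
    intro k
    have h1 : ‖χ (ex ((k:ℂ) • b))‖ = Real.exp (x * k) := by
      rw [chi_ex, map_smul, smul_eq_mul, norm_cexp]; rfl
    rw [← h1, mul_assoc]
    refine (chi_le ψ _).trans (mul_le_mul_of_nonneg_left ?_ (norm_nonneg _))
    change ‖jI b α β (ex ((k:ℂ) • b))‖ ≤ _
    rw [norm_jI]
    refine nI_le ?_
    simpa using Rep.mono (b := b) (α := α) (β := β) 1 k
  constructor
  · have : -x ≤ -α := by
      refine char_mem_aux (K := ‖(1 : Loc b α β)‖ * ‖(1:C)‖) fun k hk => ?_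
      have := key (-k)
      have e : rho α β (-k) = Real.exp (-α * k) := by
        unfold rho; rw [max_eq_left]; · ring_nf
        exact Real.exp_le_exp.2 (by nlinarith)
      rw [e] at this
      convert this using 2; ring
    linarith
  · refine char_mem_aux (K := ‖(1 : Loc b α β)‖ * ‖(1:C)‖) fun k hk => ?_
    have := key k
    have e : rho α β k = Real.exp (β * k) := by
      unfold rho; rw [max_eq_right]
      exact Real.exp_le_exp.2 (by nlinarith)
    rwa [e] at this

theorem isUnit_jI_iff (hαβ : α ≤ β) (d : C) : IsUnit (jI b α β d) ↔
    ∀ χ : C →ₐ[ℂ] ℂ, α ≤ (χ b).re → (χ b).re ≤ β → χ d ≠ 0 := by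
  constructor
  · intro h χ h1 h2 h0
    obtain ⟨w, hw⟩ := h.exists_right_inv
    have hK : 0 < ‖(1:C)‖ := by
      rcases (norm_nonneg (1:C)).lt_or_eq with h | h
      · exact h
      · have : (1:C) = 0 := norm_eq_zero.1 h.symm
        have := congrArg χ this
        simp at this
    have hcont : Continuous fun w => ‖jI b α β d * w - 1‖ := by fun_prop
    have ho : IsOpen {w | ‖jI b α β d * w - 1‖ < 1 / ‖(1:C)‖} :=
      isOpen_lt hcont continuous_const
    obtain ⟨w', hw'⟩ := (dense_jI (b := b) (α := α) (β := β)).exists_mem_open ho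
      ⟨w, by simp [hw, hK]⟩
    have h3 := chi_nI χ h1 h2 (d * w' - 1)
    rw [← norm_jI, map_sub, map_mul, map_one, map_sub, map_mul, h0] at h3
    have h4 : ‖jI b α β d * jI b α β w' - 1‖ < 1 / ‖(1:C)‖ := hw'
    rw [lt_div_iff₀ hK] at h4
    simp at h3
    linarith
  · intro h
    by_contra hn
    obtain ⟨ψ, hψ⟩ := WeakDual.CharacterSpace.exists_apply_eq_zero hn
    obtain ⟨h1, h2⟩ := char_mem hαβ (WeakDual.CharacterSpace.toAlgHom ψ)
    exact h ((WeakDual.CharacterSpace.toAlgHom ψ).comp (jI b α β)) h1 h2 hψ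

end loc

end
end Dav

set_option linter.all false

namespace Dav
noncomputable section

theorem cartan {E EL ER EM : Type*} [Ring E] [NormedRing EL] [NormedRing ER] [NormedRing EM]
    (jL : E →+* EL) (jR : E →+* ER) (jM : E →+* EM) (κ : ℝ) (hκ : 0 < κ)
    (hL : ∀ f, ‖jM f‖ ≤ ‖jL f‖) (hR : ∀ f, ‖jM f‖ ≤ ‖jR f‖) (hd : DenseRange jM)
    (hs : ∀ (f : E) (ε : ℝ), 0 < ε → ∃ f1 f2, f = f1 + f2 ∧ ‖jL f1‖ ≤ κ * ‖jM f‖ + ε ∧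
      ‖jR f2‖ ≤ κ * ‖jM f‖ + ε)
    (uL uR : E) (vL : EL) (vR : ER) (vM : EM) (h1 : vL * jL uL = 1) (h2 : vR * jR uR = 1)
    (h3 : jM uL * vM = 1) (h4 : vM * jM uL = 1) (hm : ‖vM * jM uR - 1‖ ≤ 1 / (16 * κ)) :
    ∃ u, ‖vL * jL u - 1‖ < 1 / 2 ∧ ‖vR * jR u - 1‖ < 1 / 2 ∧ ‖vM * jM u - 1‖ < 1 / 2 := by
  set m := vM * jM uR - 1 with hmdef
  have key : ∀ N : ℕ, ∃ x y : E, ‖m + m * jM x + jM x - jM y‖ ≤ 1 / (16 * κ) * (1/4) ^ N ∧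
      ‖jR x‖ ≤ 1 / 8 * (1 - (1/4) ^ N) ∧ ‖jL y‖ ≤ 1 / 8 * (1 - (1/4)^N) := by
    intro N
    induction N with
    | zero => exact ⟨0, 0, by simpa using hm, by simp, by simp⟩
    | succ N ih =>
      obtain ⟨x, y, he, hx, hy⟩ := ih
      set e := m + m * jM x + jM x - jM y with hedef
      set q : ℝ := (1/4) ^ N with hq
      have hq0 : 0 < q := by positivity
      set s := 1 / (16 * κ) * q with hsdef
      have hs0 : 0 < s := by positivity
      have hκs : κ * s = q / 16 := by rw [hsdef]; field_simp
      obtain ⟨e', he'⟩ := hd.exists_dist_lt e (show 0 < s / 8 by positivity)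
      rw [dist_eq_norm] at he'
      have hn : ‖jM e'‖ ≤ 9 / 8 * s := by
        have := norm_sub_le e (e - jM e')
        rw [sub_sub_cancel] at this
        linarith
      obtain ⟨eL, eR, hsum, hl, hr⟩ := hs e' (κ * s / 8) (by positivity)
      have hb : κ * ‖jM e'‖ ≤ κ * (9 / 8 * s) := mul_le_mul_of_nonneg_left hn hκ.le
      have hl' : ‖jL eL‖ ≤ 5 / 64 * q := by linarith
      have hr' : ‖jR eR‖ ≤ 5 / 64 * q := by linarith
      refine ⟨x - eR, y + eL, ?_, ?_, ?_⟩
      · have : m + m * jM (x - eR) + jM (x - eR) - jM (y + eL) = (e - jM e') - m * jM eR := by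
          rw [hsum, hedef]; simp only [map_add, map_sub]; noncomm_ring
        rw [this]
        have h5 : ‖m * jM eR‖ ≤ 1 / (16 * κ) * (5 / 64 * q) :=
          (norm_mul_le _ _).trans (mul_le_mul hm ((hR _).trans hr') (norm_nonneg _) (by positivity))
        have h6 := norm_sub_le (e - jM e') (m * jM eR)
        have : 1 / (16 * κ) * (5 / 64 * q) = 5 / 64 * s := by rw [hsdef]; ring
        have h7 : 1 / (16 * κ) * (1/4)^(N+1) = s / 4 := by rw [pow_succ, hsdef]; ring
        rw [h7]; linarith
      · rw [map_sub, pow_succ]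
        have := norm_sub_le (jR x) (jR eR)
        linarith
      · rw [map_add, pow_succ]
        have := norm_add_le (jL y) (jL eL)
        linarith
  obtain ⟨δ, hδ, hδ1, hδ2, hδ3⟩ : ∃ δ > 0, ‖vL‖ * (2 * δ) ≤ 1 / 4 ∧ ‖vR‖ * (2 * δ) ≤ 1/4 ∧
      ‖vM‖ * (2 * δ) ≤ 1 / 4 := by
    have hp : 0 < ‖vL‖ + ‖vR‖ + ‖vM‖ + 1 := by positivity
    have e : (‖vL‖ + ‖vR‖ + ‖vM‖ + 1) * (2 * (1 / (8 * (‖vL‖ + ‖vR‖ + ‖vM‖ + 1)))) = 1 / 4 := by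
      field_simp; norm_num
    have hp' : 0 < 1 / (8 * (‖vL‖ + ‖vR‖ + ‖vM‖ + 1)) := by positivity
    have n1 := norm_nonneg vL
    have n2 := norm_nonneg vR
    have n3 := norm_nonneg vM
    refine ⟨1 / (8 * (‖vL‖ + ‖vR‖ + ‖vM‖ + 1)), hp', ?_, ?_, ?_⟩
    all_goals rw [← e]; exact mul_le_mul_of_nonneg_right (by linarith) (by positivity)
  obtain ⟨N, hN⟩ : ∃ N : ℕ, κ * (‖jM uL‖ * (1 / (16 * κ) * (1/4) ^ N)) < δ := by
    have : Filter.Tendsto (fun N : ℕ => κ * (‖jM uL‖ * (1 / (16 * κ) * (1/4 : ℝ) ^ N))) Filter.atTop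
        (nhds (κ * (‖jM uL‖ * (1 / (16 * κ) * 0)))) :=
      ((((tendsto_pow_atTop_nhds_zero_of_lt_one (by norm_num) (by norm_num)).const_mul _).const_mul
        _).const_mul _)
    simp only [mul_zero] at this
    exact (this.eventually (gt_mem_nhds hδ)).exists
  obtain ⟨x, y, he, hx, hy⟩ := key N
  set e := m + m * jM x + jM x - jM y with hedef
  have hq0 : (0:ℝ) < (1/4)^N := by positivity
  set d := uR * (1 + x) - uL * (1 + y) with hd'
  have hjd : jM d = jM uL * e := by
    have : jM uR = jM uL * (1 + m) := by rw [hmdef, add_sub_cancel, ← mul_assoc, h3, one_mul]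
    rw [hd', hedef, map_sub, map_mul, map_mul, this]
    simp only [map_add, map_one]; noncomm_ring
  obtain ⟨dL, dR, hsum, hl, hr⟩ := hs d δ hδ
  have hnd : κ * ‖jM d‖ ≤ δ := by
    rw [hjd]
    exact (mul_le_mul_of_nonneg_left ((norm_mul_le _ _).trans
      (mul_le_mul_of_nonneg_left he (norm_nonneg _))) hκ.le).trans hN.le
  refine ⟨uL * (1 + y) + dL, ?_, ?_, ?_⟩
  · have : vL * jL (uL * (1 + y) + dL) - 1 = jL y + vL * jL dL := by
      rw [map_add, map_mul, mul_add, ← mul_assoc, h1, map_add, map_one]; noncomm_ring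
    rw [this]
    have h5 : ‖vL * jL dL‖ ≤ ‖vL‖ * (2 * δ) :=
      (norm_mul_le _ _).trans (mul_le_mul_of_nonneg_left (by linarith) (norm_nonneg _))
    have := norm_add_le (jL y) (vL * jL dL)
    linarith
  · have e1 : uL * (1 + y) + dL = uR * (1 + x) - dR := by
      have : uR * (1 + x) - uL * (1 + y) = dL + dR := hsum
      rw [sub_eq_iff_eq_add] at this
      rw [this]; abel
    have : vR * jR (uR * (1 + x) - dR) - 1 = jR x - vR * jR dR := by
      rw [map_sub, map_mul, mul_sub, ← mul_assoc, h2, map_add, map_one]; noncomm_ring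
    rw [e1, this]
    have h5 : ‖vR * jR dR‖ ≤ ‖vR‖ * (2 * δ) :=
      (norm_mul_le _ _).trans (mul_le_mul_of_nonneg_left (by linarith) (norm_nonneg _))
    have := norm_sub_le (jR x) (vR * jR dR)
    linarith
  · have : vM * jM (uL * (1 + y) + dL) - 1 = jM y + vM * jM dL := by
      rw [map_add, map_mul, mul_add, ← mul_assoc, h4, map_add, map_one]; noncomm_ring
    rw [this]
    have h5 : ‖vM * jM dL‖ ≤ ‖vM‖ * (2 * δ) :=
      (norm_mul_le _ _).trans (mul_le_mul_of_nonneg_left (by linarith [hL dL]) (norm_nonneg _))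
    have := norm_add_le (jM y) (vM * jM dL)
    linarith [hL y]

theorem runge {D P : Type*} [NormedRing D] [NormedAlgebra ℂ D] [CompleteSpace D]
    [NormedRing P] [NormedAlgebra ℂ P] [CompleteSpace P] (θ : D →ₐ[ℂ] P) (hθ : Continuous θ)
    (hd : DenseRange θ) (γ : unitInterval → Pˣ) (hγ : Continuous γ) (h0 : γ 0 = 1)
    (O : Set Pˣ) (hO : IsOpen O) (h1 : γ 1 ∈ O) :
    ∃ k : Dˣ, Units.map (θ : D →* P) k ∈ O := by
  let := NormedAlgebra.restrictScalars ℚ ℂ D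
  let := NormedAlgebra.restrictScalars ℚ ℂ P
  set S : Subgroup Pˣ := ((Units.map (θ : D →* P)).range).topologicalClosure with hS
  have hexp : ∀ p : P, ∀ u : Pˣ, (u : P) = NormedSpace.exp p → u ∈ S := by
    intro p u hu
    change u ∈ closure _
    rw [Units.isOpenEmbedding_val.isInducing.closure_eq_preimage_closure_image]
    rw [Set.mem_preimage]
    rw [hu]
    have hc : Continuous (NormedSpace.exp : P → P) := NormedSpace.exp_continuous
    have hh1 : NormedSpace.exp p ∈ closure (NormedSpace.exp '' (Set.range θ)) :=
      image_closure_subset_closure_image hc ⟨p, hd p, rfl⟩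
    refine closure_mono ?_ hh1
    rintro _ ⟨_, ⟨d, rfl⟩, rfl⟩
    obtain ⟨v, hv⟩ := NormedSpace.isUnit_exp d
    refine ⟨Units.map (θ : D →* P) v, ⟨v, rfl⟩, ?_⟩
    simp only [Units.coe_map]
    rw [hv]
    exact NormedSpace.map_exp θ hθ d
  have hopen : IsOpen (S : Set Pˣ) := by
    apply Subgroup.isOpen_of_mem_nhds S (g := 1)
    have h2 : Filter.map (NormedSpace.exp : P → P) (nhds 0) = nhds (NormedSpace.exp (0:P)) :=
      HasStrictFDerivAt.map_nhds_eq_of_equiv (f' := ContinuousLinearEquiv.refl ℂ P)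
        (hasStrictFDerivAt_exp_zero (𝕂 := ℂ) (𝔸 := P))
    rw [NormedSpace.exp_zero] at h2
    rw [Units.isOpenEmbedding_val.isInducing.nhds_eq_comap, Filter.mem_comap]
    refine ⟨Set.range NormedSpace.exp, ?_, ?_⟩
    · rw [Units.val_one, ← h2]; exact Filter.range_mem_map
    · rintro u ⟨p, hp⟩
      exact hexp p u hp.symm
  have hclopen : IsClopen (γ ⁻¹' (S : Set Pˣ)) :=
    ⟨(Subgroup.isClosed_topologicalClosure _).preimage hγ, hopen.preimage hγ⟩
  have huniv : γ ⁻¹' (S : Set Pˣ) = Set.univ := hclopen.eq_univ ⟨0, by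
    change γ 0 ∈ S; rw [h0]; exact one_mem S⟩
  have hmem : γ 1 ∈ closure (((Units.map (θ : D →* P)).range : Subgroup Pˣ) : Set Pˣ) := by
    have : (1 : unitInterval) ∈ γ ⁻¹' (S : Set Pˣ) := by rw [huniv]; trivial
    exact this
  obtain ⟨g, hg, k, rfl⟩ := mem_closure_iff.1 hmem _ hO h1
  exact ⟨k, hg⟩

end
end Dav

set_option linter.all false

namespace Dav
noncomputable section

/-- matrices, with the row-sum operator norm -/
def Mn (n : ℕ) (C : Type*) : Type _ := Matrix (Fin n) (Fin n) C

section Mn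
variable {n : ℕ} {C D : Type*} [NormedCommRing C] [NormedAlgebra ℂ C] [NormedCommRing D]
  [NormedAlgebra ℂ D]

instance : NormedRing (Mn n C) :=
  (Matrix.linftyOpNormedRing : NormedRing (Matrix (Fin n) (Fin n) C))

instance : NormedAlgebra ℂ (Mn n C) :=
  (Matrix.linftyOpNormedAlgebra : @NormedAlgebra ℂ (Matrix (Fin n) (Fin n) C) _
    (Matrix.linftyOpNormedRing : NormedRing (Matrix (Fin n) (Fin n) C)).toSeminormedRing)

instance [CompleteSpace C] : CompleteSpace (Mn n C) :=
  inferInstanceAs (CompleteSpace (Matrix (Fin n) (Fin n) C))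

/-- determinant -/
def dt (M : Mn n C) : C := Matrix.det (show Matrix (Fin n) (Fin n) C from M)

/-- entrywise map -/
def mp (n : ℕ) (f : C →ₐ[ℂ] D) : Mn n C →ₐ[ℂ] Mn n D :=
  (f.mapMatrix : Matrix (Fin n) (Fin n) C →ₐ[ℂ] Matrix (Fin n) (Fin n) D)

theorem mp_apply (f : C →ₐ[ℂ] D) (M : Mn n C) (i j : Fin n) : mp n f M i j = f (M i j) := rfl

theorem dt_mp (f : C →ₐ[ℂ] D) (M : Mn n C) : dt (mp n f M) = f (dt M) :=
  (AlgHom.map_det f (show Matrix (Fin n) (Fin n) C from M)).symm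

theorem isUnit_dt (M : Mn n C) : IsUnit M ↔ IsUnit (dt M) :=
  Matrix.isUnit_iff_isUnit_det (show Matrix (Fin n) (Fin n) C from M)

theorem dt_mul (M N : Mn n C) : dt (M * N) = dt M * dt N :=
  Matrix.det_mul (show Matrix (Fin n) (Fin n) C from M) _

theorem cont_entry (i j : Fin n) : Continuous fun M : Mn n C => M i j :=
  (continuous_apply_apply i j : Continuous fun M : (Fin n) → (Fin n) → C => M i j)

theorem cont_Mn {Y : Type*} [TopologicalSpace Y] {f : Y → Mn n C}
    (h : ∀ i j, Continuous fun y => f y i j) : Continuous f :=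
  (continuous_matrix h : @Continuous Y (Matrix (Fin n) (Fin n) C) _ _ f)

theorem cont_dt : Continuous fun M : Mn n C => dt M :=
  (Continuous.matrix_det continuous_id :
    Continuous fun M : Matrix (Fin n) (Fin n) C => M.det)

theorem cont_mp {f : C →ₐ[ℂ] D} (hf : Continuous f) : Continuous (mp n f) :=
  cont_Mn fun i j => hf.comp (cont_entry i j)

theorem dense_mp {f : C →ₐ[ℂ] D} (hf : DenseRange f) : DenseRange (mp n f) :=
  DenseRange.piMap (X := fun _ : Fin n => Fin n → C) (Y := fun _ : Fin n => Fin n → D)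
    (f := fun _ v i => f (v i)) fun _ =>
    DenseRange.piMap (X := fun _ : Fin n => C) (Y := fun _ : Fin n => D)
    (f := fun _ => f) fun _ => hf

theorem norm_Mn_le (M : Mn n C) {x : ℝ} (hx : 0 ≤ x) (h : ∀ i, ∑ j, ‖M i j‖ ≤ x) : ‖M‖ ≤ x := by
  have : ‖M‖ = _ := Matrix.linfty_opNorm_def (show Matrix (Fin n) (Fin n) C from M)
  rw [this]
  lift x to NNReal using hx
  rw [NNReal.coe_le_coe]
  refine Finset.sup_le fun i _ => ?_
  rw [← NNReal.coe_le_coe]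
  simpa using h i

theorem le_norm_Mn (M : Mn n C) (i : Fin n) : ∑ j, ‖M i j‖ ≤ ‖M‖ := by
  have : ‖M‖ = _ := Matrix.linfty_opNorm_def (show Matrix (Fin n) (Fin n) C from M)
  rw [this]
  have h := Finset.le_sup (f := fun i : Fin n => ∑ j : Fin n, ‖M i j‖₊) (Finset.mem_univ i)
  rw [← NNReal.coe_le_coe] at h
  simpa using h

theorem norm_Mn_mono (M : Mn n C) (N : Mn n D) {ε : ℝ} (hε : 0 ≤ ε)
    (h : ∀ i j, ‖M i j‖ ≤ ‖N i j‖ + ε) : ‖M‖ ≤ ‖N‖ + n * ε := by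
  refine norm_Mn_le M (by positivity) fun i => ?_
  calc ∑ j, ‖M i j‖ ≤ ∑ j, (‖N i j‖ + ε) := Finset.sum_le_sum fun j _ => h i j
    _ = ∑ j, ‖N i j‖ + n * ε := by simp [Finset.sum_add_distrib]
    _ ≤ _ := by linarith [le_norm_Mn N i]

theorem isUnit_of_near {E : Type*} [NormedRing E] [CompleteSpace E] {v x : E} (hv : IsUnit v)
    (h : ‖v * x - 1‖ < 1) : IsUnit x := by
  obtain ⟨u, rfl⟩ := hv
  have h1 : IsUnit (1 - (1 - ↑u * x)) := isUnit_one_sub_of_norm_lt_one (by rwa [norm_sub_rev])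
  rw [sub_sub_cancel] at h1
  have : x = ↑u⁻¹ * (↑u * x) := by simp
  rw [this]
  exact u⁻¹.isUnit.mul h1

end Mn

/-- density of `C(I, E)` in `C(I, F)` -/
theorem bern_closure {F : Type*} [NormedAddCommGroup F] [NormedSpace ℝ F]
    (S : Submodule ℝ C(unitInterval, F)) (hS : IsClosed (S : Set C(unitInterval, F)))
    (h : ∀ (n k : ℕ) (v : F), bernstein n k • ContinuousMap.const unitInterval v ∈ S)
    (f : C(unitInterval, F)) : f ∈ S := by
  refine hS.mem_of_tendsto (bernsteinApproximation_uniform f) (Filter.Eventually.of_forall fun n => ?_)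
  exact Submodule.sum_mem _ fun k _ => h n k _

theorem dense_CI {E F : Type*} [NormedRing E] [NormedAlgebra ℂ E] [NormedRing F] [NormedAlgebra ℂ F]
    (θ : E →ₐ[ℂ] F) (hθ : Continuous θ) (hd : DenseRange θ) :
    DenseRange (AlgHom.compLeftContinuous (α := unitInterval) ℂ θ hθ) := by
  intro f
  let L : C(unitInterval, E) →ₗ[ℝ] C(unitInterval, F) :=
    (AlgHom.compLeftContinuous (α := unitInterval) ℂ θ hθ).toLinearMap.restrictScalars ℝ
  have := bern_closure (F := F) (LinearMap.range L).topologicalClosure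
    (Submodule.isClosed_topologicalClosure _) ?_ f
  · exact this
  · intro n k v
    have hc : Continuous fun v : F => bernstein n k • ContinuousMap.const unitInterval v := by
      have h1 : Continuous fun v : F => ContinuousMap.const unitInterval v :=
        ContinuousMap.continuous_const'
      refine ContinuousMap.continuous_of_continuous_uncurry _ ?_
      have : Continuous fun p : F × unitInterval => bernstein n k p.2 • p.1 := by fun_prop
      exact this
    have h2 : ∀ v ∈ Set.range θ, bernstein n k • ContinuousMap.const unitInterval v ∈
        (LinearMap.range L : Set C(unitInterval, F)) := by
      rintro _ ⟨e, rfl⟩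
      refine ⟨bernstein n k • ContinuousMap.const unitInterval e, ?_⟩
      ext x
      change θ (bernstein n k x • e) = bernstein n k x • θ e
      exact (θ.toLinearMap.restrictScalars ℝ).map_smul _ _
    exact map_mem_closure (f := fun v : F => bernstein n k • ContinuousMap.const unitInterval v)
      hc (hd v) h2

end
end Dav

set_option linter.all false

namespace Dav
noncomputable section
open WeakDual Set

theorem tube {Y : Type*} [TopologicalSpace Y] [CompactSpace Y] {U : Set Y} (hU : IsOpen U)
    {g : Y → ℝ} (hg : Continuous g) (h : ∀ y, g y ≤ 0 → y ∈ U) : ∃ ε > 0, ∀ y, g y ≤ ε → y ∈ U := by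
  rcases (Uᶜ).eq_empty_or_nonempty with he | hne
  · exact ⟨1, one_pos, fun y _ => by rw [compl_empty_iff] at he; rw [he]; trivial⟩
  · obtain ⟨y0, hy0, hmin⟩ := hU.isClosed_compl.isCompact.exists_isMinOn hne hg.continuousOn
    have h0 : 0 < g y0 := by
      by_contra hn
      exact hy0 (h y0 (not_lt.1 hn))
    refine ⟨g y0 / 2, by positivity, fun y hy => ?_⟩
    by_contra hn
    have : g y0 ≤ g y := hmin hn
    linarith

theorem joinedIn_of_homotopy {T E : Type*} [TopologicalSpace T] [TopologicalSpace E]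
    {F : Set C(T, E)} (G : ℝ → T → E) (hG : Continuous fun y : ℝ × T => G y.1 y.2) (p q : C(T, E))
    (h0 : ∀ t, G 0 t = p t) (h1 : ∀ t, G 1 t = q t)
    (hF : ∀ s, 0 ≤ s → s ≤ 1 → ∀ r : C(T, E), (∀ t, r t = G s t) → r ∈ F) : JoinedIn F p q := by
  have hGs : ∀ s, Continuous (G s) := fun s => hG.comp (Continuous.prodMk_right s)
  let γ : C(unitInterval, C(T, E)) := ⟨fun s => ⟨G s, hGs s⟩,
    ContinuousMap.continuous_of_continuous_uncurry _
      (hG.comp ((continuous_subtype_val.comp continuous_fst).prodMk continuous_snd))⟩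
  refine ⟨⟨γ, ?_, ?_⟩, ?_⟩
  · ext t; exact h0 t
  · ext t; exact h1 t
  · intro s; exact hF s s.2.1 s.2.2 _ fun t => rfl

section
variable {C : Type*} [NormedCommRing C] [NormedAlgebra ℂ C] [CompleteSpace C]

theorem cont_gelfand : Continuous (gelfandTransform ℂ C) :=
  AddMonoidHomClass.continuous_of_bound (gelfandTransform ℂ C) ‖(1:C)‖ fun f => by
    rw [ContinuousMap.norm_le _ (by positivity)]
    intro χ
    exact chi_le (CharacterSpace.toAlgHom χ) f

theorem cont_char_eval : Continuous fun y : characterSpace ℂ C × C => y.1 y.2 := by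
  have : Continuous fun y : characterSpace ℂ C × C => (gelfandTransform ℂ C y.2) y.1 :=
    (cont_gelfand.comp continuous_snd).eval continuous_fst
  exact this

/-- real part of a character at `b` -/
def tau (b : C) (χ : characterSpace ℂ C) : ℝ := (χ b).re

theorem cont_tau (b : C) : Continuous (tau b) :=
  Complex.continuous_re.comp (cont_char_eval.comp (continuous_id.prodMk continuous_const))

theorem isUnit_mp_jI {n : ℕ} {b : C} {α β : ℝ} (h : α ≤ β) (M : Mn n C) :
    IsUnit (mp n (jI b α β) M) ↔ ∀ χ : characterSpace ℂ C, α ≤ tau b χ → tau b χ ≤ β →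
      χ (dt M) ≠ 0 := by
  rw [isUnit_dt, dt_mp, isUnit_jI_iff h]
  constructor
  · intro h χ h1 h2
    exact h (CharacterSpace.toAlgHom χ) h1 h2
  · intro h χ h1 h2
    exact h (CharacterSpace.equivAlgHom.symm χ) h1 h2

theorem isUnit_iff_chi {n : ℕ} (M : Mn n C) :
    IsUnit M ↔ ∀ χ : characterSpace ℂ C, χ (dt M) ≠ 0 := by
  rw [isUnit_dt]
  constructor
  · intro h χ
    exact (h.map (CharacterSpace.toAlgHom χ)).ne_zero
  · intro h
    by_contra hn
    obtain ⟨χ, hχ⟩ := CharacterSpace.exists_apply_eq_zero hn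
    exact h χ hχ

/-- admissible loops of matrices over the window -/
def W (n : ℕ) (b : C) (α β : ℝ) : Set C(ℝ, Mn n C) :=
  {p | ∀ χ : characterSpace ℂ C, α ≤ tau b χ → tau b χ ≤ β → χ (dt (p (tau b χ))) ≠ 0}

theorem seg_unit {E F : Type*} [NormedRing E] [NormedAlgebra ℂ E] [NormedRing F] [NormedAlgebra ℂ F]
    [CompleteSpace F] (j : E →ₐ[ℂ] F) {v : F} (hv : IsUnit v) {a u : E} (ha : ‖v * j a - 1‖ < 1)
    (hu : ‖v * j u - 1‖ < 1) {s : ℝ} (h0 : 0 ≤ s) (h1 : s ≤ 1) :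
    IsUnit (j (a + (s:ℂ) • (u - a))) := by
  refine isUnit_of_near hv ?_
  have : v * j (a + (s:ℂ) • (u - a)) - 1 = ((1 - s : ℝ) : ℂ) • (v * j a - 1) + (s:ℂ) • (v * j u - 1) := by
    simp only [map_add, map_smul, map_sub, mul_add, mul_sub, mul_smul_comm]
    push_cast
    module
  rw [this]
  refine (norm_add_le _ _).trans_lt ?_
  rw [norm_smul, norm_smul, Complex.norm_real, Complex.norm_real, Real.norm_of_nonneg h0,
    Real.norm_of_nonneg (by linarith)]
  rcases h0.eq_or_lt with rfl | hs
  · simpa using ha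
  · nlinarith

theorem runge_window {E F : Type*} [NormedRing E] [NormedAlgebra ℂ E] [CompleteSpace E]
    [NormedRing F] [NormedAlgebra ℂ F] [CompleteSpace F] (jM : E →ₐ[ℂ] F) (cM : Continuous jM)
    (hd : DenseRange jM) (h : C(unitInterval, F)) (hunit : ∀ x, IsUnit (h x)) (hh0 : h 0 = 1) :
    ∃ K : C(unitInterval, E), K 0 = 1 ∧ (∀ x, IsUnit (K x)) ∧
      ∀ x, ‖h x * jM (K x) - 1‖ < 1 / 16 := by
  let γ0 : unitInterval → C(unitInterval, F) := fun σ =>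
    ⟨fun x => h (σ * x), by fun_prop⟩
  have hγ0 : Continuous γ0 := ContinuousMap.continuous_of_continuous_uncurry _ (by
    have : Continuous fun y : unitInterval × unitInterval => h (y.1 * y.2) := by fun_prop
    exact this)
  have hγu : ∀ σ, IsUnit (γ0 σ) := fun σ => by
    rw [ContinuousMap.isUnit_iff_forall_isUnit]; exact fun x => hunit _
  let γ : unitInterval → (C(unitInterval, F))ˣ := fun σ => (hγu σ).unit
  have hγ : Continuous γ := by
    rw [Units.isOpenEmbedding_val.isInducing.continuous_iff]
    exact hγ0
  have hγ1 : (γ 1 : C(unitInterval, F)) = h := by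
    ext1 x; change h (1 * x) = h x; rw [one_mul]
  have hγz : γ 0 = 1 := by
    ext1; ext1 x
    change h (0 * x) = 1
    rw [zero_mul, hh0]
  let cst : C(unitInterval, F) → C(unitInterval, F) :=
    fun g => .const _ (g 0)
  have hcst : Continuous cst :=
    ContinuousMap.continuous_const'.comp (continuous_eval_const (0 : unitInterval))
  let O : Set (C(unitInterval, F))ˣ :=
    {g | ‖h * ↑g⁻¹ * cst ↑g - 1‖ < 1 / 16}
  have hO : IsOpen O := by
    refine isOpen_lt ?_ continuous_const
    have i1 : Continuous fun g : (C(unitInterval, F))ˣ =>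
      ((g⁻¹ : (C(unitInterval, F))ˣ) : C(unitInterval, F)) :=
      Units.continuous_val.comp continuous_inv
    have i2 := hcst.comp (Units.continuous_val (M := C(unitInterval, F)))
    exact (((continuous_const.mul i1).mul i2).sub continuous_const).norm
  have hmem : γ 1 ∈ O := by
    have e1 : cst (γ 1 : C(unitInterval, F)) = 1 := by
      rw [hγ1]; ext1 x; exact hh0
    have e2 : h * ↑(γ 1)⁻¹ = 1 := by rw [← hγ1]; simp
    change ‖h * ↑(γ 1)⁻¹ * cst ↑(γ 1) - 1‖ < 1 / 16
    rw [e1, e2]; simp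
  obtain ⟨k, hk⟩ := runge (AlgHom.compLeftContinuous (α := unitInterval) ℂ jM cM) (by
      exact ContinuousMap.continuous_postcomp (⟨jM, cM⟩ : C(E, F)))
    (dense_CI jM cM hd) γ hγ hγz O hO hmem
  set K : C(unitInterval, E) := ↑k⁻¹ * .const _ ((k : C(unitInterval, E)) 0) with hK
  have hkx : ∀ x, IsUnit ((k : C(unitInterval, E)) x) :=
    (ContinuousMap.isUnit_iff_forall_isUnit _).1 k.isUnit
  have hkx' : ∀ x, IsUnit ((↑k⁻¹ : C(unitInterval, E)) x) :=
    (ContinuousMap.isUnit_iff_forall_isUnit _).1 k⁻¹.isUnit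
  have hKu : ∀ x, IsUnit (K x) := fun x => (hkx' x).mul (hkx 0)
  have hK0 : K 0 = 1 := by
    have : (↑k⁻¹ * ↑k : C(unitInterval, E)) = 1 := by simp
    exact congrArg (fun f : C(unitInterval, E) => f 0) this
  refine ⟨K, hK0, hKu, fun x => ?_⟩
  set U : (C(unitInterval, F))ˣ := Units.map (AlgHom.compLeftContinuous (α := unitInterval) ℂ jM cM :
        C(unitInterval, E) →* C(unitInterval, F)) k with hU
  have h5 := (ContinuousMap.norm_coe_le_norm _ x).trans_lt
      (show ‖h * ↑U⁻¹ * cst ↑U - 1‖ < 1 / 16 from hk)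
  have e : (h * ↑U⁻¹ * cst ↑U - 1) x = h x * jM (K x) - 1 := by
    have e1 : (↑U⁻¹ : C(unitInterval, F)) x = jM ((↑k⁻¹ : C(unitInterval, E)) x) := by
      rw [hU, ← map_inv]; rfl
    have e2 : (cst (U : C(unitInterval, F))) x = jM ((k : C(unitInterval, E)) 0) := rfl
    have e3 : K x = (↑k⁻¹ : C(unitInterval, E)) x * (k : C(unitInterval, E)) 0 := rfl
    rw [ContinuousMap.sub_apply, ContinuousMap.mul_apply, ContinuousMap.mul_apply, e1, e2, e3,
      map_mul, mul_assoc]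
    rfl
  rwa [e] at h5

theorem glue_b {n : ℕ} {b : C} {α c1 c2 β : ℝ} (h1 : α ≤ c1) (h2 : c1 < c2) (h3 : c2 ≤ β)
    (p : C(ℝ, Mn n C)) (uL uR : Mn n C) (hpL : ∀ t ≤ c1, p t = uL) (hpR : ∀ t, c2 ≤ t → p t = uR)
    (hL : ∀ χ : characterSpace ℂ C, α ≤ tau b χ → tau b χ ≤ c1 → χ (dt uL) ≠ 0)
    (hR : ∀ χ : characterSpace ℂ C, c2 ≤ tau b χ → tau b χ ≤ β → χ (dt uR) ≠ 0)
    (hM : ∀ t, c1 ≤ t → t ≤ c2 → ∀ χ : characterSpace ℂ C, c1 ≤ tau b χ → tau b χ ≤ c2 →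
      χ (dt (p t)) ≠ 0) :
    ∃ u, JoinedIn (W n b α β) p (.const _ u) := by
  set jL := mp n (jI b α c2) with hjL
  set jR := mp n (jI b c1 β) with hjR
  set jM := mp n (jI b c1 c2) with hjM
  have hpW : p ∈ W n b α β := by
    intro χ hα hβ
    rcases le_total (tau b χ) c1 with h | h
    · rw [hpL _ h]; exact hL χ hα h
    rcases le_total (tau b χ) c2 with h' | h'
    · exact hM _ h h' χ h h'
    · rw [hpR _ h']; exact hR χ h' hβ
  have hULM : IsUnit (jM uL) := by
    rw [hjM, isUnit_mp_jI h2.le, ← hpL c1 le_rfl]; exact hM c1 le_rfl h2.le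
  have hUL : IsUnit (jL uL) := by
    rw [hjL, isUnit_mp_jI (h1.trans h2.le)]
    intro χ hα hβ
    rcases le_total (tau b χ) c1 with h | h
    · exact hL χ hα h
    · rw [← hpL c1 le_rfl]; exact hM c1 le_rfl h2.le χ h hβ
  have hUR : IsUnit (jR uR) := by
    rw [hjR, isUnit_mp_jI (h2.le.trans h3)]
    intro χ hα hβ
    rcases le_total (tau b χ) c2 with h | h
    · rw [← hpR c2 le_rfl]; exact hM c2 h2.le le_rfl χ hα h
    · exact hR χ h hβ
  have cM : Continuous jM := cont_mp cont_jI
  obtain ⟨wM, hwM⟩ := hULM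
  set vM : Mn n (Loc b c1 c2) := ↑wM⁻¹ with hvM
  have hvM1 : jM uL * vM = 1 := by rw [← hwM, hvM]; simp
  have hvM2 : vM * jM uL = 1 := by rw [← hwM, hvM]; simp
  have hvMu : IsUnit vM := wM⁻¹.isUnit
  let h : C(unitInterval, Mn n (Loc b c1 c2)) :=
    ⟨fun x => vM * jM (p (c1 + x * (c2 - c1))), by fun_prop⟩
  have hunit : ∀ x, IsUnit (h x) := by
    intro x
    refine hvMu.mul ?_
    rw [hjM, isUnit_mp_jI h2.le]
    have := x.2.1
    have := x.2.2
    exact hM _ (by nlinarith) (by nlinarith)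
  have hh0 : h 0 = 1 := by
    change vM * jM (p (c1 + (0:ℝ) * (c2 - c1))) = 1
    rw [zero_mul, add_zero, hpL _ le_rfl, hvM2]
  obtain ⟨K, hK0, hKu, hKest'⟩ := runge_window jM cM (dense_mp dense_jI) h hunit hh0
  have hKest : ∀ x : unitInterval, ‖vM * (jM (p (c1 + x * (c2 - c1))) * jM (K x)) - 1‖ < 1 / 16 := by
    intro x
    rw [← mul_assoc]
    exact hKest' x
  -- the modified map
  have hc21 : 0 < c2 - c1 := by linarith
  let pr : ℝ → unitInterval := projIcc (0:ℝ) 1 zero_le_one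
  have hpr : Continuous pr := continuous_projIcc
  let p2 : C(ℝ, Mn n C) := ⟨fun t => p t * K (pr ((t - c1) / (c2 - c1))), by fun_prop⟩
  have hp2L : ∀ t ≤ c1, p2 t = uL := fun t ht => by
    change p t * K (pr ((t - c1) / (c2 - c1))) = uL
    have : pr ((t - c1) / (c2 - c1)) = 0 :=
      projIcc_of_le_left _ (div_nonpos_of_nonpos_of_nonneg (by linarith) hc21.le)
    rw [this, hK0, mul_one, hpL t ht]
  have hp2R : ∀ t, c2 ≤ t → p2 t = uR * K 1 := fun t ht => by
    change p t * K (pr ((t - c1) / (c2 - c1))) = _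
    have : pr ((t - c1) / (c2 - c1)) = 1 :=
      projIcc_of_right_le _ ((one_le_div hc21).2 (by linarith))
    rw [this, hpR t ht]
  have hp2M : ∀ t, c1 ≤ t → t ≤ c2 → ‖vM * jM (p2 t) - 1‖ < 1 / 16 := fun t ht1 ht2 => by
    have hm : (t - c1) / (c2 - c1) ∈ Icc (0:ℝ) 1 :=
      ⟨div_nonneg (by linarith) hc21.le, (div_le_one hc21).2 (by linarith)⟩
    have := hKest ⟨_, hm⟩
    have e : c1 + (t - c1) / (c2 - c1) * (c2 - c1) = t := by field_simp; ring
    simp only [e] at this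
    change ‖vM * jM (p t * K (pr ((t - c1) / (c2 - c1)))) - 1‖ < 1 / 16
    rw [show pr ((t - c1) / (c2 - c1)) = ⟨_, hm⟩ from projIcc_of_mem _ hm, map_mul]
    exact this
  have J1 : JoinedIn (W n b α β) p p2 := by
    refine joinedIn_of_homotopy (fun s t => p t * K (pr (s * ((t - c1) / (c2 - c1))))) (by fun_prop)
      _ _ ?_ ?_ ?_
    · intro t
      have : pr (0 * ((t - c1) / (c2 - c1))) = 0 := projIcc_of_le_left _ (by simp)
      simp only [this, hK0, mul_one]
    · intro t; simp only [one_mul]; rfl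
    · intro s _ _ r hr χ ha hb
      rw [hr, dt_mul, map_mul]
      refine mul_ne_zero (hpW χ ha hb) ?_
      exact (isUnit_iff_chi _).1 (hKu _) χ
  have hUR' : IsUnit (jR (uR * K 1)) := by
    rw [map_mul]; exact hUR.mul ((hKu 1).map jR)
  obtain ⟨wL, hwL⟩ := hUL
  obtain ⟨wR, hwR⟩ := hUR'
  obtain ⟨u, hu1, hu2, hu3⟩ := cartan (jL : Mn n C →+* Mn n (Loc b α c2))
    (jR : Mn n C →+* Mn n (Loc b c1 β)) (jM : Mn n C →+* Mn n (Loc b c1 c2)) 1 one_pos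
    (fun f => by
      have := norm_Mn_mono (jM f) (jL f) le_rfl fun i j => by
        rw [hjM, hjL, mp_apply, mp_apply, norm_jI, norm_jI, add_zero]
        exact nI_mono h1 h2.le le_rfl _
      simpa using this)
    (fun f => by
      have := norm_Mn_mono (jM f) (jR f) le_rfl fun i j => by
        rw [hjM, hjR, mp_apply, mp_apply, norm_jI, norm_jI, add_zero]
        exact nI_mono le_rfl h2.le h3 _
      simpa using this)
    (dense_mp dense_jI)
    (fun f ε hε => by
      have hε' : 0 < ε / (n + 1) := by positivity
      choose f1 f2 hf h1' h2' using fun i j => nI_split (b := b) (h1.trans h2.le) (h2.le.trans h3)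
        (f i j) hε'
      have hn : (n : ℝ) * (ε / (n + 1)) ≤ ε := by
        rw [mul_div_assoc', div_le_iff₀ (by positivity)]; nlinarith
      refine ⟨f1, f2, ?_, ?_, ?_⟩
      · exact Matrix.ext hf
      · rw [one_mul]
        refine (norm_Mn_mono (jL f1) (jM f) hε'.le fun i j => ?_).trans (by simpa using hn)
        have h7 := h1' i j
        rw [← norm_jI, ← norm_jI] at h7
        exact h7
      · rw [one_mul]
        refine (norm_Mn_mono (jR f2) (jM f) hε'.le fun i j => ?_).trans (by simpa using hn)
        have h7 := h2' i j
        rw [← norm_jI, ← norm_jI] at h7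
        exact h7)
    uL (uR * K 1) ↑wL⁻¹ ↑wR⁻¹ vM (by change _ * jL uL = 1; rw [← hwL]; simp)
      (by change _ * jR (uR * K 1) = 1; rw [← hwR]; simp) hvM1 hvM2 (by
        rw [← hp2R c2 le_rfl]
        simpa using (hp2M c2 h2.le le_rfl).le)
  refine ⟨u, J1.trans ?_⟩
  refine joinedIn_of_homotopy (fun s t => p2 t + (s:ℂ) • (u - p2 t)) (by fun_prop) _ _ ?_ ?_ ?_
  · intro t; simp
  · intro t; simp
  · intro s hs0 hs1 r hr χ ha hb
    rw [hr]
    rcases le_total (tau b χ) c1 with h | h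
    · rw [hp2L _ h]
      refine (isUnit_mp_jI (h1.trans h2.le) _).1 (seg_unit jL (v := ↑wL⁻¹) wL⁻¹.isUnit
        (by rw [← hwL]; simp) (hu1.trans (by norm_num)) hs0 hs1) χ ha (h.trans h2.le)
    rcases le_total (tau b χ) c2 with h' | h'
    · refine (isUnit_mp_jI h2.le _).1 (seg_unit jM (v := vM) hvMu
        ((hp2M _ h h').trans (by norm_num)) (hu3.trans (by norm_num)) hs0 hs1) χ h h'
    · rw [hp2R _ h']
      refine (isUnit_mp_jI (h2.le.trans h3) _).1 (seg_unit jR (v := ↑wR⁻¹) wR⁻¹.isUnit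
        (by rw [← hwR]; simp) (hu2.trans (by norm_num)) hs0 hs1) χ (h2.le.trans h') hb

end
end
end Dav

set_option linter.all false

namespace Dav
noncomputable section
open WeakDual Set

section
variable {C : Type*} [NormedCommRing C] [NormedAlgebra ℂ C] [CompleteSpace C]

theorem isOpen_good {n : ℕ} {Y : Type*} [TopologicalSpace Y] {f : Y → characterSpace ℂ C}
    {g : Y → Mn n C} (hf : Continuous f) (hg : Continuous g) :
    IsOpen {y | f y (dt (g y)) ≠ 0} := by
  have : Continuous fun y => f y (dt (g y)) := cont_char_eval.comp (hf.prodMk (cont_dt.comp hg))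
  exact isOpen_ne_fun this continuous_const

theorem window {n : ℕ} {b : C} {c : ℝ} {p q : C(ℝ, Mn n C)} (γ : Path p q)
    (h : ∀ s, ∀ χ : characterSpace ℂ C, tau b χ = c → χ (dt (γ s c)) ≠ 0) :
    ∃ ε > 0, ∀ s : ℝ, ∀ t, |t - c| ≤ ε → ∀ χ : characterSpace ℂ C, |tau b χ - c| ≤ ε →
      χ (dt (γ.extend s t)) ≠ 0 := by
  have hc : Continuous fun y : unitInterval × characterSpace ℂ C × Icc (c - 1) (c + 1) =>
      γ y.1 (y.2.2 : ℝ) := (γ.continuous.comp continuous_fst).eval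
        (continuous_subtype_val.comp (continuous_snd.comp continuous_snd))
  obtain ⟨ε, hε, hh⟩ := tube (Y := unitInterval × characterSpace ℂ C × Icc (c - 1) (c + 1))
    (isOpen_good (continuous_fst.comp continuous_snd) hc)
    (g := fun y => max |tau b y.2.1 - c| |(y.2.2 : ℝ) - c|) (by
      have := cont_tau b
      fun_prop) (by
      rintro ⟨s, χ, t, ht⟩ hy
      have h1 := (le_max_left _ _).trans hy
      have h2 := (le_max_right _ _).trans hy
      simp only at h1 h2
      have h1' := abs_nonpos_iff.1 h1
      have h2' := abs_nonpos_iff.1 h2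
      rw [sub_eq_zero] at h1' h2'
      subst h2'
      exact h s χ h1')
  refine ⟨min ε 1, lt_min hε one_pos, fun s t ht χ hχ => ?_⟩
  have ht1 := abs_le.1 (ht.trans (min_le_right _ _))
  exact hh ⟨projIcc 0 1 zero_le_one s, χ, ⟨t, by constructor <;> linarith⟩⟩
    (max_le (hχ.trans (min_le_left _ _)) (ht.trans (min_le_left _ _)))

theorem glue {n : ℕ} {b : C} {α c β : ℝ} (hα : α < c) (hβ : c < β)
    (p : C(ℝ, Mn n C)) (uL uR : Mn n C) (hL : JoinedIn (W n b α c) p (.const _ uL))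
    (hR : JoinedIn (W n b c β) p (.const _ uR)) : ∃ u, JoinedIn (W n b α β) p (.const _ u) := by
  obtain ⟨γL, hγL⟩ := hL
  obtain ⟨γR, hγR⟩ := hR
  obtain ⟨ε1, hε1, H1⟩ := window (b := b) (c := c) γL (fun s χ h => by
    have := hγL s χ (by linarith) (by linarith); rwa [h] at this)
  obtain ⟨ε2, hε2, H2⟩ := window (b := b) (c := c) γR (fun s χ h => by
    have := hγR s χ (by linarith) (by linarith); rwa [h] at this)
  obtain ⟨ε, hε, l1, l2, l3, l4⟩ : ∃ ε > 0, ε ≤ ε1 ∧ ε ≤ ε2 ∧ ε ≤ c - α ∧ ε ≤ β - c :=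
    ⟨min (min ε1 ε2) (min (c - α) (β - c)),
      lt_min (lt_min hε1 hε2) (lt_min (by linarith) (by linarith)),
      (min_le_left _ _).trans (min_le_left _ _), (min_le_left _ _).trans (min_le_right _ _),
      (min_le_right _ _).trans (min_le_left _ _), (min_le_right _ _).trans (min_le_right _ _)⟩
  have cL : Continuous fun y : ℝ × ℝ => γL.extend y.1 y.2 :=
    (γL.continuous_extend.comp continuous_fst).eval continuous_snd
  have cR : Continuous fun y : ℝ × ℝ => γR.extend y.1 y.2 :=
    (γR.continuous_extend.comp continuous_fst).eval continuous_snd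
  let G : ℝ → ℝ → Mn n C := fun s t =>
    γL.extend (s * ((c - t) / ε)) t + γR.extend (s * ((t - c) / ε)) t - p t
  have hG : Continuous fun y : ℝ × ℝ => G y.1 y.2 := by
    have a1 : Continuous fun y : ℝ × ℝ => γL.extend (y.1 * ((c - y.2) / ε)) y.2 :=
      cL.comp (f := fun y : ℝ × ℝ => (y.1 * ((c - y.2) / ε), y.2)) (by fun_prop)
    have a2 : Continuous fun y : ℝ × ℝ => γR.extend (y.1 * ((y.2 - c) / ε)) y.2 :=
      cR.comp (f := fun y : ℝ × ℝ => (y.1 * ((y.2 - c) / ε), y.2)) (by fun_prop)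
    exact (a1.add a2).sub (by fun_prop)
  have hGL : ∀ s t, 0 ≤ s → t ≤ c → G s t = γL.extend (s * ((c - t) / ε)) t := by
    intro s t hs ht
    have : γR.extend (s * ((t - c) / ε)) = p := γR.extend_of_le_zero
      (mul_nonpos_of_nonneg_of_nonpos hs (div_nonpos_of_nonpos_of_nonneg (by linarith) hε.le))
    simp only [G, this]; abel
  have hGR : ∀ s t, 0 ≤ s → c ≤ t → G s t = γR.extend (s * ((t - c) / ε)) t := by
    intro s t hs ht
    have : γL.extend (s * ((c - t) / ε)) = p := γL.extend_of_le_zero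
      (mul_nonpos_of_nonneg_of_nonpos hs (div_nonpos_of_nonpos_of_nonneg (by linarith) hε.le))
    simp only [G, this]; abel
  let p' : C(ℝ, Mn n C) := ⟨G 1, hG.comp (Continuous.prodMk_right 1)⟩
  have J : JoinedIn (W n b α β) p p' := by
    refine joinedIn_of_homotopy G hG _ _ ?_ (fun t => rfl) ?_
    · intro t; simp [G]
    · intro s h0 h1 r hr χ ha hb
      rw [hr]
      rcases le_total (tau b χ) c with h | h
      · rw [hGL _ _ h0 h]; exact hγL _ χ ha h
      · rw [hGR _ _ h0 h]; exact hγR _ χ h hb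
  have e1 : ∀ t ≤ c - ε, p' t = uL := by
    intro t ht
    change G 1 t = uL
    rw [hGL _ _ zero_le_one (by linarith), γL.extend_of_one_le]; · rfl
    rw [one_mul, one_le_div hε]; linarith
  have e2 : ∀ t, c + ε ≤ t → p' t = uR := by
    intro t ht
    change G 1 t = uR
    rw [hGR _ _ zero_le_one (by linarith), γR.extend_of_one_le]; · rfl
    rw [one_mul, one_le_div hε]; linarith
  have g1 : ∀ χ : characterSpace ℂ C, α ≤ tau b χ → tau b χ ≤ c - ε → χ (dt uL) ≠ 0 := by
    intro χ h1 h2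
    have := hγL 1 χ h1 (by linarith)
    rw [γL.target] at this; exact this
  have g2 : ∀ χ : characterSpace ℂ C, c + ε ≤ tau b χ → tau b χ ≤ β → χ (dt uR) ≠ 0 := by
    intro χ h1 h2
    have := hγR 1 χ (by linarith) h2
    rw [γR.target] at this; exact this
  have g3 : ∀ t, c - ε ≤ t → t ≤ c + ε → ∀ χ : characterSpace ℂ C, c - ε ≤ tau b χ →
      tau b χ ≤ c + ε → χ (dt (p' t)) ≠ 0 := by
    intro t h1 h2 χ h3 h4
    have hχ : |tau b χ - c| ≤ ε := abs_le.2 ⟨by linarith, by linarith⟩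
    have ht : |t - c| ≤ ε := abs_le.2 ⟨by linarith, by linarith⟩
    change χ (dt (G 1 t)) ≠ 0
    rcases le_total t c with h | h
    · rw [hGL _ _ zero_le_one h]; exact H1 _ t (ht.trans l1) χ (hχ.trans l1)
    · rw [hGR _ _ zero_le_one h]; exact H2 _ t (ht.trans l2) χ (hχ.trans l2)
  obtain ⟨u, hu⟩ := glue_b (b := b) (α := α) (c1 := c - ε) (c2 := c + ε) (β := β) (by linarith)
    (by linarith) (by linarith) p' uL uR e1 e2 g1 g2 g3
  exact ⟨u, J.trans hu⟩

theorem W_mono {n : ℕ} {b : C} {α β α' β' : ℝ} (h1 : α' ≤ α) (h2 : β ≤ β') :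
    W n b α' β' ⊆ W n b α β := fun _ hp χ a1 a2 => hp χ (h1.trans a1) (a2.trans h2)

theorem oka {n : ℕ} (b : C) (R : ℝ) (hR : 0 < R)
    (p : C(ℝ, Mn n C)) (hp : p ∈ W n b (-R) R) :
    ∃ u, JoinedIn (W n b (-R) R) p (.const _ u) := by
  haveI : CompactSpace {χ : characterSpace ℂ C // tau b χ ∈ Icc (-R) R} :=
    isCompact_iff_compactSpace.1 (isClosed_Icc.preimage (cont_tau b)).isCompact
  obtain ⟨δ, hδ, H⟩ := tube (Y := unitInterval × {χ : characterSpace ℂ C // tau b χ ∈ Icc (-R) R} ×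
      Icc (-R) R)
    (U := {y | y.2.1.1 (dt (p (tau b y.2.1.1) + ((y.1 : ℝ) : ℂ) • (p y.2.2 - p (tau b y.2.1.1)))) ≠ 0})
    (g := fun y => |tau b y.2.1.1 - y.2.2|) (by
      have := cont_tau b
      exact isOpen_good (by fun_prop) (by fun_prop)) (by
      have := cont_tau b
      fun_prop) (by
      rintro ⟨s, ⟨χ, hχ⟩, t, ht⟩ hy
      simp only at hy
      have := abs_nonpos_iff.1 hy
      rw [sub_eq_zero] at this
      subst this
      simpa using hp χ hχ.1 hχ.2)

  have loc : ∀ α β, -R ≤ α → α ≤ β → β ≤ R → β - α ≤ δ →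
      JoinedIn (W n b α β) p (.const _ (p α)) := by
    intro α β h1 h2 h3 h4
    refine joinedIn_of_homotopy (fun s t => p t + (s:ℂ) • (p α - p t)) (by fun_prop) _ _ (by simp)
      (by simp) ?_
    intro s hs0 hs1 r hr χ ha hb
    rw [hr]
    exact H ⟨⟨s, hs0, hs1⟩, ⟨χ, by constructor <;> linarith⟩, ⟨α, h1, by linarith⟩⟩
      (abs_le.2 ⟨by simp only; linarith, by simp only; linarith⟩)
  obtain ⟨N, hN⟩ := exists_nat_gt (2 * R / δ)
  have hN0 : 0 < (N : ℝ) := lt_of_le_of_lt (by positivity) hN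
  set d := 2 * R / N with hd
  have hd0 : 0 < d := by positivity
  have hdδ : d ≤ δ := by
    rw [hd, div_le_iff₀ hN0]; rw [div_lt_iff₀ hδ] at hN; linarith
  have hNd : N * d = 2 * R := by rw [hd]; field_simp
  have key : ∀ k : ℕ, k + 1 ≤ N → ∃ u, JoinedIn (W n b (-R) (-R + (k + 1 : ℕ) * d)) p (.const _ u) := by
    intro k
    induction k with
    | zero =>
      intro hk
      refine ⟨_, loc _ _ le_rfl (by push_cast; linarith) ?_ (by push_cast; linarith)⟩
      have : ((0 + 1 : ℕ) : ℝ) * d ≤ N * d := by gcongr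
      linarith
    | succ k ih =>
      intro hk
      obtain ⟨u, hu⟩ := ih (by omega)
      have h9 : ((k + 1 + 1 : ℕ) : ℝ) * d ≤ N * d := by gcongr
      have h10 : (0:ℝ) < (k + 1 : ℕ) * d := by positivity
      have h11 : ((k + 1 + 1 : ℕ) : ℝ) * d = (k + 1 : ℕ) * d + d := by push_cast; ring
      refine glue (c := -R + (k + 1 : ℕ) * d) (by linarith) (by linarith) p u _ hu
        (loc _ _ (by linarith) (by linarith) (by linarith) (by linarith))
  obtain ⟨M, rfl⟩ : ∃ M, N = M + 1 := ⟨N - 1, by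
    have : 0 < N := by exact_mod_cast hN0
    omega⟩
  obtain ⟨u, hu⟩ := key M le_rfl
  rw [hNd] at hu
  refine ⟨u, ?_⟩
  convert hu using 2
  ring

end
end
end Dav

set_option linter.all false

namespace Dav
noncomputable section
open WeakDual Set

theorem dens_path {D N F : Type*} [AddCommGroup D] [Module ℝ D] [NormedAddCommGroup N]
    [NormedSpace ℝ N] [NormedAddCommGroup F] [NormedSpace ℝ F]
    (Q : D →ₗ[ℝ] N) (hQ : DenseRange Q) (T : D →ₗ[ℝ] F) (W : Set N) (hW : IsOpen W) (Z : Set F)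
    (hZ : ∀ d, Q d ∈ W → T d ∈ Z) {d0 d1 : D} (h : JoinedIn W (Q d0) (Q d1)) :
    JoinedIn Z (T d0) (T d1) := by
  obtain ⟨γ, hγ⟩ := h
  have L : ∀ w ε, Metric.ball w ε ⊆ W → ∀ d d', Q d ∈ Metric.ball w ε → Q d' ∈ Metric.ball w ε →
      JoinedIn Z (T d) (T d') := by
    intro w ε hb d d' h1 h2
    refine JoinedIn.of_segment_subset ?_
    rintro _ ⟨a, b, ha, hb', hab, rfl⟩
    have : a • T d + b • T d' = T (a • d + b • d') := by simp
    rw [this]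
    refine hZ _ (hb ?_)
    rw [map_add, map_smul, map_smul]
    exact convex_ball w ε h1 h2 ha hb' hab
  let P : unitInterval → Prop := fun s => ∃ d, ∃ ε > 0, Metric.ball (γ s) ε ⊆ W ∧
    Q d ∈ Metric.ball (γ s) ε ∧ JoinedIn Z (T d0) (T d)
  have key : ∀ w w' ε ε', Metric.ball w ε ⊆ W → Metric.ball w' ε' ⊆ W →
      (Metric.ball w ε ∩ Metric.ball w' ε').Nonempty → ∀ d, Q d ∈ Metric.ball w ε →
      JoinedIn Z (T d0) (T d) → ∃ d', Q d' ∈ Metric.ball w' ε' ∧ JoinedIn Z (T d0) (T d') := by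
    intro w w' ε ε' h1 h2 h3 d hd hj
    obtain ⟨d', hd'⟩ := hQ.exists_mem_open (Metric.isOpen_ball.inter Metric.isOpen_ball) h3
    exact ⟨d', hd'.2, hj.trans (L _ _ h1 _ _ hd hd'.1)⟩
  have hP : IsLocallyConstant P := by
    rw [IsLocallyConstant.iff_eventually_eq]
    intro s
    obtain ⟨ε, hε, hb⟩ := Metric.isOpen_iff.1 hW _ (hγ s)
    have : ∀ᶠ s' in nhds s, γ s' ∈ Metric.ball (γ s) ε :=
      γ.continuous.continuousAt.eventually_mem (Metric.ball_mem_nhds _ hε)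
    filter_upwards [this] with s' hs'
    refine propext ⟨?_, ?_⟩
    · rintro ⟨d, ε', hε', hb', hd, hj⟩
      obtain ⟨d', h1, h2⟩ := key _ _ _ _ hb' hb ⟨γ s', Metric.mem_ball_self hε', hs'⟩ d hd hj
      exact ⟨d', ε, hε, hb, h1, h2⟩
    · rintro ⟨d, ε1, hε1, hb1, hd, hj⟩
      obtain ⟨ε', hε', hb'⟩ := Metric.isOpen_iff.1 hW _ (hγ s')
      obtain ⟨d2, h3, h4⟩ := key _ _ _ _ hb1 hb
        ⟨γ s, Metric.mem_ball_self hε1, Metric.mem_ball_self hε⟩ d hd hj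
      obtain ⟨d', h1, h2⟩ := key _ _ _ _ hb hb' ⟨γ s', hs', Metric.mem_ball_self hε'⟩ d2 h3 h4
      exact ⟨d', ε', hε', hb', h1, h2⟩
  have h0 : P 0 := by
    obtain ⟨ε, hε, hb⟩ := Metric.isOpen_iff.1 hW _ (hγ 0)
    refine ⟨d0, ε, hε, hb, ?_, JoinedIn.refl (hZ _ ?_)⟩
    · rw [γ.source]; exact Metric.mem_ball_self hε
    · rw [← γ.source]; exact hγ 0
  have h1 : P 1 := by
    have := hP.apply_eq_of_isPreconnected isPreconnected_univ (mem_univ 0) (mem_univ 1)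
    rwa [← this]
  obtain ⟨d, ε, hε, hb, hd, hj⟩ := h1
  exact hj.trans (L _ _ hb _ _ hd (by rw [γ.target]; exact Metric.mem_ball_self hε))

section
variable {C B : Type*} [NormedCommRing C] [NormedAlgebra ℂ C] [CompleteSpace C]
  [NormedCommRing B] [NormedAlgebra ℂ B] [CompleteSpace B]

/-- scalar matrix -/
def sc (n : ℕ) (x : B) : Mn n B := Matrix.scalar (Fin n) x

theorem sc_mul {n : ℕ} (x : B) (M : Mn n B) (i j : Fin n) : (sc n x * M) i j = x * M i j := by
  change (Matrix.scalar (Fin n) x * (show Matrix (Fin n) (Fin n) B from M)) i j = _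
  exact Matrix.diagonal_mul _ _ _ _

theorem Mn_ext {n : ℕ} {B : Type*} {M N : Mn n B} (h : ∀ i j, M i j = N i j) : M = N := Matrix.ext h

theorem Mn_smul {n : ℕ} (x : ℝ) (M : Mn n B) (i j : Fin n) : (x • M) i j = x • M i j := rfl
theorem Mn_add {n : ℕ} (N M : Mn n B) (i j : Fin n) : (N + M) i j = N i j + M i j := rfl

abbrev PD (n : ℕ) (C : Type*) [NormedCommRing C] [NormedAlgebra ℂ C] := Polynomial ℝ →₀ Mn n C

def Qt (n : ℕ) (t : ℝ) : PD n C →ₗ[ℝ] Mn n C :=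
  Finsupp.lsum ℝ fun P => (P.eval t) • LinearMap.id

theorem Qt_cont {n : ℕ} (d : PD n C) : Continuous fun t => Qt n t d := by
  have : (fun t => Qt n t d) = fun t => d.sum fun P e => P.eval t • e := by
    ext1 t; rfl
  rw [this]
  unfold Finsupp.sum
  exact continuous_finsetSum _ fun P _ => (Polynomial.continuous P).smul continuous_const

def Qr (n : ℕ) (ι : C →ₐ[ℂ] B) (r : B) : PD n C →ₗ[ℝ] Mn n B :=
  Finsupp.lsum ℝ fun P => (LinearMap.mulLeft ℝ (sc n (Polynomial.aeval r P))) ∘ₗ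
    (mp n ι).toLinearMap.restrictScalars ℝ

theorem Qr_single {n : ℕ} (ι : C →ₐ[ℂ] B) (r : B) (P : Polynomial ℝ) (e : Mn n C) :
    Qr n ι r (Finsupp.single P e) = sc n (Polynomial.aeval r P) * mp n ι e := by
  simp [Qr]
  rfl

theorem Qt_single {n : ℕ} (t : ℝ) (P : Polynomial ℝ) (e : Mn n C) :
    Qt n t (Finsupp.single P e) = P.eval t • e := by
  simp [Qt]

theorem Qr_eval {n : ℕ} (ι : C →ₐ[ℂ] B) (r : B) (ψ : B →ₐ[ℂ] ℂ) (t : ℝ) (ht : ψ r = t)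
    (d : PD n C) : mp n ψ (Qr n ι r d) = mp n (ψ.comp ι) (Qt n t d) := by
  have h1 : ∀ P : Polynomial ℝ, ψ (Polynomial.aeval r P) = (P.eval t : ℝ) := by
    intro P
    have := Polynomial.aeval_algHom_apply (ψ.restrictScalars ℝ) r P
    rw [← AlgHom.restrictScalars_apply ℝ ψ, ← this, AlgHom.restrictScalars_apply, ht]
    exact Polynomial.aeval_algebraMap_apply ℂ t P
  induction d using Finsupp.induction_linear with
  | zero => simp
  | add f g hf hg => rw [map_add, map_add, map_add, map_add, hf, hg]
  | single P e =>
    rw [Qr_single, Qt_single]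
    refine Mn_ext fun i j => ?_
    rw [mp_apply, mp_apply, sc_mul, Mn_smul, map_mul, h1, mp_apply]
    have := (ψ.comp ι).toLinearMap.map_smul_of_tower (P.eval t) (e i j)
    change _ = (ψ.comp ι).toLinearMap (P.eval t • e i j)
    rw [this]
    simp

theorem isOpen_forall_compact {Y K : Type*} [TopologicalSpace Y] [TopologicalSpace K] [CompactSpace K]
    {U : Set (Y × K)} (hU : IsOpen U) : IsOpen {y | ∀ k, (y, k) ∈ U} := by
  have : {y | ∀ k, (y, k) ∈ U} = (Prod.fst '' Uᶜ)ᶜ := by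
    ext y; simp
  rw [this]
  exact (isClosedMap_fst_of_compactSpace _ hU.isClosed_compl).isOpen_compl

theorem stepO {n : ℕ} (ι : C →ₐ[ℂ] B)
    (hchar : ∀ χ : characterSpace ℂ C, ∃ ψ : characterSpace ℂ B, ∀ x, χ x = ψ (ι x))
    (b : C) (r : B) (hr : ∀ ψ : characterSpace ℂ B, ψ r = ((ψ (ι b)).re : ℂ))
    (v : Mn n B) (hv : IsUnit v) (hP : ∀ i j, ∃ P : Polynomial C, v i j = P.eval₂ (ι : C →+* B) r) :
    ∃ u : Mn n C, JoinedIn {x : Mn n B | IsUnit x} v (mp n ι u) := by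
  -- as a value of `Qr`
  obtain ⟨d, hd⟩ : ∃ d : PD n C, Qr n ι r d = v := by
    choose P hP using hP
    obtain ⟨N, hN⟩ : ∃ N, ∀ i j, (P i j).natDegree < N := by
      refine ⟨(Finset.univ.sup fun i => Finset.univ.sup fun j => (P i j).natDegree) + 1, fun i j => ?_⟩
      rw [Nat.lt_succ_iff]
      exact (Finset.le_sup (f := fun j => (P i j).natDegree) (Finset.mem_univ j)).trans
        (Finset.le_sup (f := fun i => Finset.univ.sup fun j => (P i j).natDegree) (Finset.mem_univ i))
    let mk' : ℕ → Mn n C := fun k i j => (P i j).coeff k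
    refine ⟨∑ k ∈ Finset.range N, Finsupp.single (Polynomial.X ^ k)
      (mk' k), ?_⟩
    rw [map_sum]
    refine Mn_ext fun i j => ?_
    rw [hP, Polynomial.eval₂_eq_sum_range' _ (hN i j)]
    have : ∀ (s : Finset ℕ) (f : ℕ → Mn n B), (∑ k ∈ s, f k) i j = ∑ k ∈ s, f k i j := by
      intro s f
      exact Matrix.sum_apply i j s f
    rw [this]
    refine Finset.sum_congr rfl fun k _ => ?_
    rw [Qr_single, sc_mul, mp_apply]
    change _ * ι ((P i j).coeff k) = ι ((P i j).coeff k) * _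
    simp [mul_comm]
  set R : ℝ := ‖(1:C)‖ * ‖b‖ + 1 with hR
  have hR0 : 0 < R := by positivity
  have htau : ∀ χ : characterSpace ℂ C, -R ≤ tau b χ ∧ tau b χ ≤ R := by
    intro χ
    have h1 := chi_le (CharacterSpace.toAlgHom χ) b
    have h2 := (Complex.abs_re_le_norm (χ b)).trans h1
    have := abs_le.1 h2
    unfold tau
    constructor <;> linarith
  have hunit : ∀ (d : PD n C), (∀ χ : characterSpace ℂ C, χ (dt (Qt n (tau b χ) d)) ≠ 0) ↔
      IsUnit (Qr n ι r d) := by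
    intro d
    have h3 : ∀ (χ : characterSpace ℂ C) (ψ : characterSpace ℂ B), (∀ x, χ x = ψ (ι x)) →
        ψ (dt (Qr n ι r d)) = χ (dt (Qt n (tau b χ) d)) := by
      intro χ ψ h
      have h4 := Qr_eval ι r (CharacterSpace.toAlgHom ψ) (tau b χ) (by
        change ψ r = _
        rw [hr, tau, h]) d
      have h5 := congrArg dt h4
      rw [dt_mp, dt_mp] at h5
      rw [h]
      exact h5
    rw [isUnit_iff_chi]
    constructor
    · intro h ψ
      let χ : characterSpace ℂ C := CharacterSpace.equivAlgHom.symm ((CharacterSpace.toAlgHom ψ).comp ι)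
      rw [h3 χ ψ (fun x => rfl)]
      exact h χ
    · intro h χ
      obtain ⟨ψ, hψ⟩ := hchar χ
      rw [← h3 χ ψ hψ]
      exact h ψ
  let p : C(ℝ, Mn n C) := ⟨_, Qt_cont d⟩
  obtain ⟨u, hu⟩ := oka b R hR0 p (fun χ _ _ => (hunit d).2 (hd ▸ hv) χ)
  refine ⟨u, ?_⟩
  -- restriction to the interval
  let aff : C(unitInterval, ℝ) := ⟨fun x => -R + x * (2 * R), by fun_prop⟩
  let res : C(ℝ, Mn n C) → C(unitInterval, Mn n C) := fun q => q.comp aff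
  have hres : Continuous res := ContinuousMap.continuous_precomp aff
  let Q : PD n C →ₗ[ℝ] C(unitInterval, Mn n C) :=
    { toFun := fun d => res ⟨_, Qt_cont d⟩
      map_add' := fun d e => by ext1 x; exact map_add (Qt n (aff x)) d e
      map_smul' := fun c d => by ext1 x; exact map_smul (Qt n (aff x)) c d }
  let xx : characterSpace ℂ C → unitInterval := fun χ => ⟨(tau b χ + R) / (2 * R),
    div_nonneg (by linarith [(htau χ).1]) (by positivity),
    (div_le_one (by positivity)).2 (by linarith [(htau χ).2])⟩
  have hxx : Continuous xx := by
    have := cont_tau b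
    exact Continuous.subtype_mk (by fun_prop) _
  have haff : ∀ χ, aff (xx χ) = tau b χ := by
    intro χ
    change -R + (tau b χ + R) / (2 * R) * (2 * R) = _
    field_simp
    ring
  let W' : Set C(unitInterval, Mn n C) := {q | ∀ χ : characterSpace ℂ C, χ (dt (q (xx χ))) ≠ 0}
  have hW' : IsOpen W' := by
    refine isOpen_forall_compact (U := {y : C(unitInterval, Mn n C) × characterSpace ℂ C |
      y.2 (dt (y.1 (xx y.2))) ≠ 0}) ?_
    exact isOpen_good continuous_snd (continuous_fst.eval (hxx.comp continuous_snd))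
  have hQd : DenseRange Q := by
    intro f
    have := bern_closure (F := Mn n C) (LinearMap.range Q).topologicalClosure
      (Submodule.isClosed_topologicalClosure _) (fun m k v => ?_) f
    · exact this
    · refine subset_closure ?_
      refine ⟨Finsupp.single ((bernsteinPolynomial ℝ m k).comp
        ((Polynomial.X + Polynomial.C R) * Polynomial.C (2 * R)⁻¹)) v, ?_⟩
      ext1 x
      change Qt n (-R + x * (2 * R)) _ = bernstein m k x • v
      rw [Qt_single]
      congr 1
      simp only [Polynomial.eval_comp, Polynomial.eval_mul, Polynomial.eval_add, Polynomial.eval_X,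
        Polynomial.eval_C]
      have : (-R + (x:ℝ) * (2 * R) + R) * (2 * R)⁻¹ = x := by field_simp; ring
      rw [this]
      rfl
  have hu2 : JoinedIn W' (Q d) (Q (Finsupp.single 1 u)) := by
    obtain ⟨γ, hγ⟩ := hu
    have hu1 : Q (Finsupp.single 1 u) = res (.const _ u) := by
      ext1 x
      change Qt n _ _ = u
      rw [Qt_single]; simp
    rw [hu1]
    refine ⟨γ.map hres, fun s => ?_⟩
    intro χ
    change χ (dt (γ s (aff (xx χ)))) ≠ 0
    rw [haff]
    exact hγ s χ (htau χ).1 (htau χ).2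
  have : JoinedIn {x : Mn n B | IsUnit x} (Qr n ι r d) (Qr n ι r (Finsupp.single 1 u)) :=
    dens_path Q hQd (Qr n ι r) W' hW' {x : Mn n B | IsUnit x} (fun d hd => ?_) hu2
  · rw [hd, Qr_single] at this
    have e : sc n (Polynomial.aeval r (1 : Polynomial ℝ)) * mp n ι u = mp n ι u := by
      refine Mn_ext fun i j => ?_
      rw [sc_mul]; simp
    rwa [e] at this
  · refine (hunit d).1 fun χ => ?_
    have := hd χ
    change χ (dt (Qt n (aff (xx χ)) d)) ≠ 0 at this
    rwa [haff] at this

end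
end
end Dav

set_option linter.all false

namespace Dav
noncomputable section
open WeakDual Set

section
variable {A B : Type*} [NormedCommRing A] [NormedAlgebra ℂ A] [CompleteSpace A]
  [NormedCommRing B] [NormedAlgebra ℂ B] [CompleteSpace B]

theorem re_zero_of_bdd {C : Type*} [NormedCommRing C] [NormedAlgebra ℂ C] [CompleteSpace C]
    (χ : C →ₐ[ℂ] ℂ) (x : C) (K : ℝ) (h : ∀ t : ℝ, ‖ex ((t:ℂ) • x)‖ ≤ K) : (χ x).re = 0 := by
  have h1 : ∀ t : ℝ, Real.exp ((χ x).re * t) ≤ ‖(1:C)‖ * K := by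
    intro t
    rw [← norm_cexp]
    have := chi_ex χ ((t:ℂ) • x)
    rw [map_smul, smul_eq_mul] at this
    rw [← this]
    exact (chi_le χ _).trans (by gcongr; exact h t)
  refine le_antisymm ?_ ?_
  · refine char_mem_aux (K := ‖(1:C)‖ * K) fun k hk => ?_
    simpa using h1 k
  · have : -(χ x).re ≤ 0 := char_mem_aux (K := ‖(1:C)‖ * K) fun k hk => by
      simpa using h1 (-k)
    linarith

/-- `r` is a "real part" of `Φ b` -/
def IsRe (Φ : A →ₐ[ℂ] B) (b : A) (r : B) : Prop :=
  ∃ K : ℝ, ∀ t : ℝ, ‖ex ((t:ℂ) • (Complex.I • r))‖ ≤ K ∧ ‖ex ((t:ℂ) • (Φ b - r))‖ ≤ K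

theorem IsRe.spec {Φ : A →ₐ[ℂ] B} {b : A} {r : B} (h : IsRe Φ b r)
    (S : Subalgebra ℂ B) [CompleteSpace S] (χ : S →ₐ[ℂ] ℂ) (p q : S) (hp : (p : B) = Φ b)
    (hq : (q : B) = r) : χ q = ((χ p).re : ℂ) := by
  obtain ⟨K, hK⟩ := h
  have hc : Continuous S.val := continuous_subtype_val
  have e1 := re_zero_of_bdd χ (Complex.I • q) K (fun t => by
    have := (hK t).1
    rw [← hq] at this
    have h2 := map_ex S.val hc ((t:ℂ) • (Complex.I • q))
    change ‖S.val (ex _)‖ ≤ K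
    rw [h2]; exact this)
  have e2 := re_zero_of_bdd χ (p - q) K (fun t => by
    have := (hK t).2
    rw [← hq, ← hp] at this
    have h2 := map_ex S.val hc ((t:ℂ) • (p - q))
    change ‖S.val (ex _)‖ ≤ K
    rw [h2]; exact this)
  rw [map_smul, smul_eq_mul] at e1
  rw [map_sub, Complex.sub_re] at e2
  apply Complex.ext
  · simp; linarith
  · simpa using e1

theorem IsRe.spec' {Φ : A →ₐ[ℂ] B} {b : A} {r : B} (h : IsRe Φ b r)
    (χ : B →ₐ[ℂ] ℂ) : χ r = ((χ (Φ b)).re : ℂ) := by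
  haveI : CompleteSpace (⊤ : Subalgebra ℂ B) :=
    (isClosed_univ : IsClosed (univ : Set B)).completeSpace_coe
  exact h.spec ⊤ (χ.comp (⊤ : Subalgebra ℂ B).val) ⟨Φ b, trivial⟩ ⟨r, trivial⟩ rfl rfl

def AdjS (Φ : A →ₐ[ℂ] B) (l : Set (A × B)) : Subalgebra ℂ B :=
  Algebra.adjoin ℂ (range Φ ∪ Prod.snd '' l)

theorem AdjS_mono (Φ : A →ₐ[ℂ] B) {l l' : Set (A × B)} (h : l ⊆ l') : AdjS Φ l ≤ AdjS Φ l' :=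
  Algebra.adjoin_mono (union_subset_union_right _ (image_mono h))

theorem AdjS_finite (Φ : A →ₐ[ℂ] B) (T : Set (A × B)) {x : B} (hx : x ∈ AdjS Φ T) :
    ∃ l : List (A × B), (∀ p ∈ l, p ∈ T) ∧ x ∈ AdjS Φ {p | p ∈ l} := by
  unfold AdjS at hx
  induction hx using Algebra.adjoin_induction with
  | mem x hx =>
    rcases hx with hx | ⟨p, hp, rfl⟩
    · exact ⟨[], by simp, Algebra.subset_adjoin (Or.inl hx)⟩
    · exact ⟨[p], by simpa using hp, Algebra.subset_adjoin (Or.inr ⟨p, by simp, rfl⟩)⟩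
  | algebraMap c => exact ⟨[], by simp, Subalgebra.algebraMap_mem _ _⟩
  | add x y _ _ h1 h2 =>
    obtain ⟨l1, h1, h1'⟩ := h1
    obtain ⟨l2, h2, h2'⟩ := h2
    exact ⟨l1 ++ l2, fun p hp => (List.mem_append.1 hp).elim (h1 p) (h2 p),
      add_mem (AdjS_mono Φ (fun p hp => List.mem_append_left _ hp) h1')
        (AdjS_mono Φ (fun p hp => List.mem_append_right _ hp) h2')⟩
  | mul x y _ _ h1 h2 =>
    obtain ⟨l1, h1, h1'⟩ := h1
    obtain ⟨l2, h2, h2'⟩ := h2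
    exact ⟨l1 ++ l2, fun p hp => (List.mem_append.1 hp).elim (h1 p) (h2 p),
      mul_mem (AdjS_mono Φ (fun p hp => List.mem_append_left _ hp) h1')
        (AdjS_mono Φ (fun p hp => List.mem_append_right _ hp) h2')⟩

theorem approx_unit {n : ℕ} (S : Subalgebra ℂ B) (v : Mn n B) (hv : IsUnit v)
    (h : ∀ i j, v i j ∈ closure (S : Set B)) :
    ∃ v' : Mn n B, JoinedIn {x : Mn n B | IsUnit x} v v' ∧ ∀ i j, v' i j ∈ S := by
  have hd : DenseRange (mp n (Subalgebra.inclusion S.le_topologicalClosure)) := by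
    refine dense_mp ?_
    exact (denseRange_inclusion_iff S.le_topologicalClosure).2 le_rfl
  let v0 : Mn n S.topologicalClosure := fun i j => ⟨v i j, h i j⟩
  have hv0 : mp n S.topologicalClosure.val v0 = v := rfl
  have hopen : IsOpen {x : Mn n B | IsUnit x} := Units.isOpen
  obtain ⟨ε, hε, hb⟩ := Metric.isOpen_iff.1 hopen v hv
  have hc : Continuous (mp n S.topologicalClosure.val) := cont_mp continuous_subtype_val
  obtain ⟨w, hw⟩ := hd.exists_mem_open (Metric.isOpen_ball.preimage hc)
    ⟨v0, show mp n S.topologicalClosure.val v0 ∈ Metric.ball v ε by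
      rw [hv0]; exact Metric.mem_ball_self hε⟩
  refine ⟨_, ?_, fun i j => (w i j).2⟩
  exact ((convex_ball v ε).isPathConnected ⟨v, Metric.mem_ball_self hε⟩).joinedIn v
    (Metric.mem_ball_self hε) _ hw |>.mono hb

theorem stepS_list {n : ℕ} (Φ : A →ₐ[ℂ] B)
    (hchar : ∀ χ : characterSpace ℂ A, ∃ ψ : characterSpace ℂ B, ∀ x, χ x = ψ (Φ x))
    (l : List (A × B)) (hl : ∀ p ∈ l, IsRe Φ p.1 p.2) :
    ∀ v : Mn n B, IsUnit v → (∀ i j, v i j ∈ AdjS Φ {p | p ∈ l}) →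
      ∃ u : Mn n A, JoinedIn {x : Mn n B | IsUnit x} v (mp n Φ u) := by
  induction l with
  | nil =>
    intro v hv h
    have h1 : AdjS Φ {p | p ∈ ([] : List (A × B))} ≤ Φ.range := by
      refine Algebra.adjoin_le ?_
      rintro x (hx | ⟨p, hp, _⟩)
      · exact hx
      · simp at hp
    choose u hu using fun i j => h1 (h i j)
    refine ⟨u, ?_⟩
    have : mp n Φ u = v := Mn_ext fun i j => hu i j
    rw [this]
    exact JoinedIn.refl hv
  | cons p l ih =>
    intro v hv h
    obtain ⟨b, r⟩ := p
    set S := AdjS Φ {p | p ∈ l} with hS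
    set C := S.topologicalClosure with hC
    haveI : CompleteSpace C := S.isClosed_topologicalClosure.completeSpace_coe
    have hbC : ∀ a, Φ a ∈ C := fun a =>
      S.le_topologicalClosure (Algebra.subset_adjoin (Or.inl ⟨a, rfl⟩))
    have hrl : ∀ p ∈ l, IsRe Φ p.1 p.2 := fun p hp => hl p (List.mem_cons_of_mem _ hp)
    have hr : IsRe Φ b r := hl (b, r) List.mem_cons_self
    have hcharC : ∀ χ : characterSpace ℂ C, ∃ ψ : characterSpace ℂ B, ∀ x, χ x = ψ (C.val x) := by
      intro χ
      let Φ' : A →ₐ[ℂ] C := Φ.codRestrict C hbC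
      obtain ⟨ψ, hψ⟩ := hchar (CharacterSpace.equivAlgHom.symm
        ((CharacterSpace.toAlgHom χ).comp Φ'))
      have hψ' : ∀ a, χ (Φ' a) = ψ (Φ a) := hψ
      refine ⟨ψ, ?_⟩
      have key : ∀ x (hx : x ∈ S), χ ⟨x, S.le_topologicalClosure hx⟩ = ψ x := by
        intro x hx
        have hx' := hx
        rw [hS] at hx
        unfold AdjS at hx
        induction hx using Algebra.adjoin_induction with
        | mem x h =>
          rcases h with ⟨a, rfl⟩ | ⟨p, hp, rfl⟩
          · exact hψ' a
          · have e1 := (hrl p hp).spec C (CharacterSpace.toAlgHom χ) (Φ' p.1)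
              ⟨p.2, S.le_topologicalClosure hx'⟩ rfl rfl
            have e2 := (hrl p hp).spec' (CharacterSpace.toAlgHom ψ)
            refine Eq.trans e1 (Eq.trans ?_ e2.symm)
            congr 2
            exact hψ' p.1
        | algebraMap c =>
          have e1 := (CharacterSpace.toAlgHom χ).commutes c
          have e2 := (CharacterSpace.toAlgHom ψ).commutes c
          exact e1.trans e2.symm
        | add x y hxx hy h1 h2 =>
          have e := map_add χ (⟨x, S.le_topologicalClosure hxx⟩ : C) ⟨y, S.le_topologicalClosure hy⟩
          rw [h1 hxx hxx, h2 hy hy] at e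
          rw [map_add]; exact e
        | mul x y hxx hy h1 h2 =>
          have e := map_mul χ (⟨x, S.le_topologicalClosure hxx⟩ : C) ⟨y, S.le_topologicalClosure hy⟩
          rw [h1 hxx hxx, h2 hy hy] at e
          rw [map_mul]; exact e
      have hcl : IsClosed {x : C | χ x = ψ (C.val x)} := by
        refine isClosed_eq ?_ ?_
        · exact chi_cont (CharacterSpace.toAlgHom χ)
        · exact (chi_cont (CharacterSpace.toAlgHom ψ)).comp continuous_subtype_val
      have hd : DenseRange (Set.inclusion (S.le_topologicalClosure) : S → C) :=
        (denseRange_inclusion_iff S.le_topologicalClosure).2 le_rfl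
      exact fun x => hd.induction_on (p := fun x : C => χ x = ψ (C.val x)) x hcl
        (fun s => key s.1 s.2)
    obtain ⟨u, hu⟩ := stepO C.val hcharC ⟨Φ b, hbC b⟩ r
      (fun ψ => hr.spec' (CharacterSpace.toAlgHom ψ)) v hv (fun i j => by
        have hx := h i j
        generalize v i j = x at hx
        unfold AdjS at hx
        induction hx using Algebra.adjoin_induction with
        | mem x h =>
          rcases h with ⟨a, rfl⟩ | ⟨p, hp, rfl⟩
          · exact ⟨Polynomial.C ⟨Φ a, hbC a⟩, by simp⟩
          · rcases List.mem_cons.1 hp with rfl | hp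
            · exact ⟨Polynomial.X, by simp⟩
            · refine ⟨Polynomial.C ⟨p.2, S.le_topologicalClosure
                (Algebra.subset_adjoin (Or.inr ⟨p, hp, rfl⟩))⟩, by simp⟩
        | algebraMap c => exact ⟨Polynomial.C (algebraMap ℂ C c), by rw [Polynomial.eval₂_C]; rfl⟩
        | add x y _ _ h1 h2 =>
          obtain ⟨P, rfl⟩ := h1
          obtain ⟨Q, rfl⟩ := h2
          exact ⟨P + Q, by rw [Polynomial.eval₂_add]⟩
        | mul x y _ _ h1 h2 =>
          obtain ⟨P, rfl⟩ := h1
          obtain ⟨Q, rfl⟩ := h2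
          exact ⟨P * Q, by rw [Polynomial.eval₂_mul]⟩)
    obtain ⟨v', hv', hv'S⟩ := approx_unit S (mp n C.val u) hu.target_mem (fun i j => (u i j).2)
    obtain ⟨w, hw⟩ := ih hrl v' hv'.target_mem hv'S
    exact ⟨w, hu.trans (hv'.trans hw)⟩

theorem stepS {n : ℕ} (Φ : A →ₐ[ℂ] B)
    (hchar : ∀ χ : characterSpace ℂ A, ∃ ψ : characterSpace ℂ B, ∀ x, χ x = ψ (Φ x))
    (hd : ∀ x, x ∈ closure (AdjS Φ {p | IsRe Φ p.1 p.2} : Set B)) (v : Mn n B) (hv : IsUnit v) :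
    ∃ u : Mn n A, IsUnit u ∧ JoinedIn {x : Mn n B | IsUnit x} v (mp n Φ u) := by
  obtain ⟨v', hv', hv'S⟩ := approx_unit _ v hv (fun i j => hd _)
  choose l hl hl' using fun i j => AdjS_finite Φ _ (hv'S i j)
  obtain ⟨u, hu⟩ := stepS_list Φ hchar
    ((List.finRange n).flatMap fun i => (List.finRange n).flatMap (l i)) (fun p hp => by
      simp only [List.mem_flatMap] at hp
      obtain ⟨i, _, j, _, hp⟩ := hp
      exact hl i j p hp) v' hv'.target_mem (fun i j => AdjS_mono Φ (fun p hp => by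
        simp only [mem_setOf_eq, List.mem_flatMap]
        exact ⟨i, List.mem_finRange _, j, List.mem_finRange _, hp⟩) (hl' i j))
  refine ⟨u, ?_, hv'.trans hu⟩
  rw [isUnit_iff_chi]
  intro χ
  obtain ⟨ψ, hψ⟩ := hchar χ
  rw [hψ, ← dt_mp]
  exact (isUnit_iff_chi _).1 hu.target_mem ψ

end
end
end Dav

set_option linter.all false

namespace Dav
noncomputable section
open WeakDual Set

section chars
variable {A : Type*} [NormedCommRing A] [NormedAlgebra ℂ A] [CompleteSpace A]
  {K : Type*} [TopologicalSpace K] [CompactSpace K] [T2Space K]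

theorem char_CK (φ : C(K, A) →ₐ[ℂ] ℂ) :
    ∃ (x : K) (χ : characterSpace ℂ A), ∀ f : C(K, A), φ f = χ (f x) := by
  have hal : Continuous (Algebra.ofId ℂ A) := continuous_algebraMap ℂ A
  let θ : C(K, ℂ) →ₐ[ℂ] C(K, A) := AlgHom.compLeftContinuous (α := K) ℂ (Algebra.ofId ℂ A) hal
  let φ1 : characterSpace ℂ C(K, ℂ) := CharacterSpace.equivAlgHom.symm (φ.comp θ)
  obtain ⟨x, hx⟩ := (CharacterSpace.continuousMapEval_bijective (X := K) (𝕜 := ℂ)).2 φ1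
  have hx' : ∀ h : C(K, ℂ), φ (θ h) = h x := fun h => by
    have : (CharacterSpace.continuousMapEval K ℂ x) h = φ1 h := by rw [hx]
    exact this.symm
  let cst : A →ₐ[ℂ] C(K, A) :=
    { toFun := fun a => .const _ a
      map_one' := rfl
      map_mul' := fun _ _ => rfl
      map_zero' := rfl
      map_add' := fun _ _ => rfl
      commutes' := fun _ => rfl }
  let χ : characterSpace ℂ A := CharacterSpace.equivAlgHom.symm (φ.comp cst)
  refine ⟨x, χ, fun f => ?_⟩
  set g : C(K, A) := f - .const _ (f x) with hg
  have hgx : g x = 0 := by simp [hg]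
  have hφ : φ g = 0 := by
    rw [← norm_eq_zero]
    refine le_antisymm (le_of_forall_pos_le_add fun ε hε => ?_) (norm_nonneg _)
    rw [zero_add]
    obtain ⟨δ, hδ, hδε⟩ : ∃ δ > 0, ‖(1 : C(K, A))‖ * δ ≤ ε := by
      refine ⟨ε / (‖(1 : C(K, A))‖ + 1), by positivity, ?_⟩
      rw [mul_div_assoc', div_le_iff₀ (by positivity)]
      nlinarith [norm_nonneg (1 : C(K, A))]
    let h : C(K, ℂ) := ⟨fun y => ((1 - min (‖g y‖ / δ) 1 : ℝ) : ℂ), by fun_prop⟩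
    have hh : h x = 1 := by simp [h, hgx]
    have e : φ g = φ (θ h * g) := by rw [map_mul, hx', hh, one_mul]
    rw [e]
    refine (chi_le φ _).trans (le_trans ?_ hδε)
    gcongr
    rw [ContinuousMap.norm_le _ hδ.le]
    intro y
    have e2 : (θ h * g) y = (1 - min (‖g y‖ / δ) 1 : ℝ) • g y := by
      change algebraMap ℂ A (h y) * g y = _
      rw [← Algebra.smul_def]
      rfl
    rw [e2, norm_smul]
    rcases le_total (‖g y‖ / δ) 1 with h1 | h1
    · have h2 : 0 ≤ ‖g y‖ / δ := by positivity
      rw [min_eq_left h1, Real.norm_of_nonneg (by linarith)]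
      have := (div_le_one hδ).1 h1
      nlinarith [norm_nonneg (g y)]
    · rw [min_eq_right h1]; simp [hδ.le]
  have : φ g = φ f - χ (f x) := by
    rw [hg, map_sub]; rfl
  rw [hφ] at this
  exact (sub_eq_zero.1 this.symm)

end chars

section sub
variable {P : Type*} [NormedCommRing P] [NormedAlgebra ℂ P]

/-- a subalgebra as a type -/
def STy (S : Subalgebra ℂ P) : Type _ := ↥S

instance (S : Subalgebra ℂ P) : NormedCommRing (STy S) := (inferInstance : NormedCommRing ↥S)
instance (S : Subalgebra ℂ P) : NormedAlgebra ℂ (STy S) := (inferInstance : NormedAlgebra ℂ ↥S)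

def sval (S : Subalgebra ℂ P) : STy S →ₐ[ℂ] P := S.val

def smk (S : Subalgebra ℂ P) (x : P) (hx : x ∈ S) : STy S := (⟨x, hx⟩ : ↥S)

theorem sval_smk (S : Subalgebra ℂ P) (x : P) (hx : x ∈ S) : sval S (smk S x hx) = x := rfl
theorem sval_mem (S : Subalgebra ℂ P) (x : STy S) : sval S x ∈ S := x.2
theorem sval_inj (S : Subalgebra ℂ P) {x y : STy S} (h : sval S x = sval S y) : x = y := Subtype.ext h
theorem sval_cont (S : Subalgebra ℂ P) : Continuous (sval S) := continuous_subtype_val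
theorem sval_norm (S : Subalgebra ℂ P) (x : STy S) : ‖x‖ = ‖sval S x‖ := rfl
theorem sval_ind (S : Subalgebra ℂ P) : Topology.IsInducing (sval S) := Topology.IsInducing.subtypeVal
theorem sty_complete [CompleteSpace P] {S : Subalgebra ℂ P} (h : IsClosed (S : Set P)) :
    CompleteSpace (STy S) := h.completeSpace_coe

/-- closure of a subalgebra -/
def tcl (S : Subalgebra ℂ P) : Subalgebra ℂ P := S.topologicalClosure
theorem tcl_closed (S : Subalgebra ℂ P) : IsClosed (tcl S : Set P) := S.isClosed_topologicalClosure
theorem tcl_le (S : Subalgebra ℂ P) {x : P} (h : x ∈ S) : x ∈ tcl S := S.le_topologicalClosure h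
theorem mem_tcl (S : Subalgebra ℂ P) {x : P} : x ∈ tcl S ↔ x ∈ closure (S : Set P) := Iff.rfl
theorem sval_clos {S : Subalgebra ℂ P} (T : Subalgebra ℂ (STy S)) {x : STy S}
    (h : sval S x ∈ tcl (T.map (sval S))) : x ∈ closure (T : Set (STy S)) := by
  rw [(sval_ind S).closure_eq_preimage_closure_image, mem_preimage]
  exact h
theorem ex_ev (f : P →ₐ[ℂ] ℂ) (t : ℝ) (y : P) (hy : (f y).re = 0) [CompleteSpace P] :
    ‖f (ex ((t:ℂ) • y))‖ ≤ 1 := by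
  rw [map_ex f (chi_cont f), map_smul, ex_complex, smul_eq_mul, norm_cexp, hy]; simp

end sub

section prod
variable (P Q : Type*) [NormedCommRing P] [NormedAlgebra ℂ P] [NormedCommRing Q] [NormedAlgebra ℂ Q]
/-- product wrapper -/
def PT : Type _ := P × Q
instance : NormedCommRing (PT P Q) := (inferInstance : NormedCommRing (P × Q))
instance : NormedAlgebra ℂ (PT P Q) := (inferInstance : NormedAlgebra ℂ (P × Q))
instance [CompleteSpace P] [CompleteSpace Q] : CompleteSpace (PT P Q) :=
  (inferInstance : CompleteSpace (P × Q))
instance : IsTopologicalRing (PT P Q) := inferInstance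
instance : IsSemitopologicalSemiring (PT P Q) := inferInstance
def p1 : PT P Q →ₐ[ℂ] P := AlgHom.fst ℂ P Q
def p2 : PT P Q →ₐ[ℂ] Q := AlgHom.snd ℂ P Q
theorem cont_p1 : Continuous (p1 P Q) := continuous_fst
theorem cont_p2 : Continuous (p2 P Q) := continuous_snd
variable {P Q}
def pmk (x : P) (y : Q) : PT P Q := (x, y)
theorem p1_pmk (x : P) (y : Q) : p1 P Q (pmk x y) = x := rfl
theorem p2_pmk (x : P) (y : Q) : p2 P Q (pmk x y) = y := rfl
theorem pext {a b : PT P Q} (h1 : p1 P Q a = p1 P Q b) (h2 : p2 P Q a = p2 P Q b) : a = b := Prod.ext h1 h2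
theorem pt_norm (a : PT P Q) : ‖a‖ = max ‖p1 P Q a‖ ‖p2 P Q a‖ := rfl
theorem cont_pmk {T : Type*} [TopologicalSpace T] {f : T → P} {g : T → Q} (hf : Continuous f) (hg : Continuous g) :
    Continuous fun t => pmk (f t) (g t) := hf.prodMk hg
theorem pmk_add0 (a b : P) : (pmk a 0 + pmk b 0 : PT P Q) = pmk (a + b) 0 :=
  Prod.ext rfl (add_zero 0)
theorem pmk_sub0 (a b : P) : (pmk a 0 - pmk b 0 : PT P Q) = pmk (a - b) 0 :=
  Prod.ext rfl (sub_zero 0)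
theorem pmk_mul0 (a b : P) : (pmk a 0 * pmk b 0 : PT P Q) = pmk (a * b) 0 :=
  Prod.ext rfl (mul_zero 0)
theorem pmk_smul0 (c : ℂ) (b : P) : (c • pmk b 0 : PT P Q) = pmk (c • b) 0 :=
  Prod.ext rfl (smul_zero c)
end prod

section
variable {A : Type*} [NormedCommRing A] [NormedAlgebra ℂ A] [CompleteSpace A]
  {K : Type*} [TopologicalSpace K] [CompactSpace K] [T2Space K]
  {L : Type*} [TopologicalSpace L] [CompactSpace L]

variable (A K L) in
/-- ambient algebra -/
abbrev AM : Type _ := PT C(K × characterSpace ℂ A, ℂ) C(L, A)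

variable (A) in
def Bs (e : C(L, K)) : Subalgebra ℂ (AM A K L) where
  carrier := {p | ∀ l χ, p1 _ _ p (e l, χ) = χ (p2 _ _ p l)}
  mul_mem' := fun {p q} hp hq l χ => by
    rw [map_mul, map_mul]
    change p1 _ _ p _ * p1 _ _ q _ = χ (p2 _ _ p l * p2 _ _ q l)
    rw [hp, hq, map_mul]
  add_mem' := fun {p q} hp hq l χ => by
    rw [map_add, map_add]
    change p1 _ _ p _ + p1 _ _ q _ = χ (p2 _ _ p l + p2 _ _ q l)
    rw [hp, hq, map_add]
  algebraMap_mem' := fun c l χ => ((CharacterSpace.toAlgHom χ).commutes c).symm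

theorem Bs_closed (e : C(L, K)) :
    IsClosed (Bs A e : Set (AM A K L)) := by
  have : (Bs A e : Set (AM A K L)) =
      ⋂ l, ⋂ χ : characterSpace ℂ A, {p : AM A K L | p1 C(K × characterSpace ℂ A, ℂ) C(L, A) p (e l, χ) = χ (p2 C(K × characterSpace ℂ A, ℂ) C(L, A) p l)} := by
    ext p; simp [Bs]
  rw [this]
  refine isClosed_iInter fun l => isClosed_iInter fun χ => isClosed_eq ?_ ?_
  · exact (continuous_eval_const _).comp (cont_p1 _ _)
  · exact (chi_cont (CharacterSpace.toAlgHom χ)).comp ((continuous_eval_const l).comp (cont_p2 _ _))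

variable (A) in
abbrev BT (e : C(L, K)) : Type _ := STy (Bs A e)

instance (e : C(L, K)) : CompleteSpace (BT A e) := sty_complete (Bs_closed e)

/-- relative Gelfand transform -/
def gam (f : C(K, A)) : C(K × characterSpace ℂ A, ℂ) :=
  ⟨fun p => p.2 (f p.1), cont_char_eval.comp (continuous_snd.prodMk (f.continuous.comp continuous_fst))⟩

variable (A) in
def PhiB (e : C(L, K)) : C(K, A) →ₐ[ℂ] BT A e where
  toFun f := smk (Bs A e) (pmk (gam f) (f.comp e)) fun l χ => rfl
  map_one' := sval_inj _ (pext (ContinuousMap.ext fun p => map_one p.2) rfl)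
  map_zero' := sval_inj _ (pext (ContinuousMap.ext fun p => map_zero p.2) rfl)
  map_mul' f g := sval_inj _ (pext (ContinuousMap.ext fun p => map_mul p.2 _ _) rfl)
  map_add' f g := sval_inj _ (pext (ContinuousMap.ext fun p => map_add p.2 _ _) rfl)
  commutes' c := sval_inj _ (pext
    (ContinuousMap.ext fun p => (CharacterSpace.toAlgHom p.2).commutes c) rfl)

variable (A) in
def B1 (e : C(L, K)) : BT A e →ₐ[ℂ] C(K × characterSpace ℂ A, ℂ) :=
  (p1 _ _).comp (sval (Bs A e))

variable (A) in
def B2 (e : C(L, K)) : BT A e →ₐ[ℂ] C(L, A) :=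
  (p2 _ _).comp (sval (Bs A e))

theorem cont_B1 (e : C(L, K)) : Continuous (B1 A e) := (cont_p1 _ _).comp (sval_cont _)
theorem cont_B2 (e : C(L, K)) : Continuous (B2 A e) := (cont_p2 _ _).comp (sval_cont _)

def evA {Y R : Type*} [TopologicalSpace Y] [CompactSpace Y] [NormedCommRing R] [NormedAlgebra ℂ R]
    (y : Y) : C(Y, R) →ₐ[ℂ] R := ContinuousMap.evalAlgHom ℂ R y

theorem cont_evA {Y R : Type*} [TopologicalSpace Y] [CompactSpace Y] [NormedCommRing R]
    [NormedAlgebra ℂ R] (y : Y) : Continuous (evA (R := R) y) := continuous_eval_const y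

theorem hcharB (e : C(L, K)) (φ : characterSpace ℂ C(K, A)) :
    ∃ ψ : characterSpace ℂ (BT A e), ∀ f, φ f = ψ (PhiB A e f) := by
  obtain ⟨x, χ, h⟩ := char_CK (CharacterSpace.toAlgHom φ)
  let ψ0 : BT A e →ₐ[ℂ] ℂ := (evA (x, χ)).comp (B1 A e)
  let ψ : characterSpace ℂ (BT A e) := CharacterSpace.equivAlgHom.symm ψ0
  exact ⟨ψ, fun f => h f⟩

/-- the real part element -/
def rB (e : C(L, K)) (b : C(K, A)) (hb : ∀ l, b (e l) = 0) : BT A e :=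
  smk (Bs A e) (pmk ⟨fun p => ((gam b p).re : ℂ), by fun_prop⟩ 0) fun l χ => by
    change ((χ (b (e l))).re : ℂ) = χ 0
    rw [hb]; simp

theorem norm_ex_le (e : C(L, K)) (y : BT A e) (h1 : ∀ p, (B1 A e y p).re = 0) (h2 : B2 A e y = 0) (t : ℝ) :
    ‖ex ((t:ℂ) • y : BT A e)‖ ≤ max 1 ‖(1 : C(L, A))‖ := by
  change max ‖B1 A e (ex ((t:ℂ) • y : BT A e))‖ ‖B2 A e (ex ((t:ℂ) • y : BT A e))‖ ≤ _
  refine max_le_max ?_ ?_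
  · rw [ContinuousMap.norm_le _ zero_le_one]
    intro p
    exact ex_ev ((evA p).comp (B1 A e)) t y (h1 p)
  · have h3 := map_ex (B2 A e) (cont_B2 e) ((t:ℂ) • y)
    have h4 : B2 A e ((t:ℂ) • y) = 0 := by
      rw [map_smul, h2, smul_zero]
    rw [h3, h4, ex_zero]

theorem isRe_rB (e : C(L, K)) (b : C(K, A)) (hb : ∀ l, b (e l) = 0) :
    IsRe (PhiB A e) b (rB e b hb) := by
  refine ⟨_, fun t => ⟨norm_ex_le e _ ?_ ?_ t, norm_ex_le e _ ?_ ?_ t⟩⟩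
  · intro p
    change (Complex.I • (((gam b p).re : ℝ) : ℂ)).re = 0
    simp
  · change Complex.I • (0 : C(L, A)) = 0
    simp
  · intro p
    change (gam b p - (((gam b p).re : ℝ) : ℂ)).re = 0
    simp
  · ext l
    change b (e l) - 0 = 0
    simp [hb]

/-- multiplication by a real function -/
def mul0 (μ : C(K, ℝ)) : C(K × characterSpace ℂ A, ℂ) := ⟨fun p => (μ p.1 : ℂ), by fun_prop⟩

theorem dense_B (e : C(L, K)) (hext : ∀ g : C(L, A), ∃ f : C(K, A), f.comp e = g) (x : BT A e) :
    x ∈ closure (AdjS (PhiB A e) {p | IsRe (PhiB A e) p.1 p.2} : Set (BT A e)) := by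
  set T := AdjS (PhiB A e) {p | IsRe (PhiB A e) p.1 p.2} with hT
  set P := tcl (T.map (sval (Bs A e))) with hP
  have hPc : IsClosed (P : Set (AM A K L)) :=
    tcl_closed _
  have m1 : ∀ f, sval (Bs A e) (PhiB A e f) ∈ P := fun f =>
    tcl_le _ ⟨_, Algebra.subset_adjoin (Or.inl ⟨f, rfl⟩), rfl⟩
  have m2 : ∀ b hb, sval (Bs A e) (rB e b hb) ∈ P := fun b hb =>
    tcl_le _ ⟨_, Algebra.subset_adjoin
      (Or.inr ⟨(b, rB e b hb), isRe_rB e b hb, rfl⟩), rfl⟩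
  let good : C(K, ℝ) → Prop := fun μ => (∀ x, 0 ≤ μ x) ∧ ∀ l, μ (e l) = 0
  let smulA : C(K, ℝ) → C(K, A) → C(K, A) := fun μ F => ⟨fun x => μ x • F x, by fun_prop⟩
  have gs : ∀ μ F p, gam (smulA μ F) p = (μ p.1 : ℂ) * gam F p := by
    intro μ F p
    change p.2 ((μ p.1 : ℂ) • F p.1) = _
    rw [map_smul]; rfl
  have hsm : ∀ μ F, good μ → (pmk (mul0 μ * gam F) 0 : AM A K L) ∈ P := by
    intro μ F hμ
    convert m1 (smulA μ F) using 1
    refine pext (ContinuousMap.ext fun p => (gs μ F p).symm) (ContinuousMap.ext fun l => ?_)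
    change 0 = μ (e l) • F (e l)
    rw [hμ.2, zero_smul]
  let S : Subalgebra ℂ C(K × characterSpace ℂ A, ℂ) :=
    { carrier := {f | ∀ μ, good μ → (pmk (mul0 μ * f) 0 : AM A K L) ∈ P}
      add_mem' := fun {f g} hf hg μ hμ => by
        have := add_mem (hf μ hμ) (hg μ hμ)
        rwa [pmk_add0, ← mul_add] at this
      mul_mem' := fun {f g} hf hg μ hμ => by
        let ν : C(K, ℝ) := ⟨fun x => Real.sqrt (μ x), by fun_prop⟩
        have hν : good ν := ⟨fun x => Real.sqrt_nonneg _, fun l => by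
          change Real.sqrt (μ (e l)) = 0
          rw [hμ.2]; simp⟩
        have := mul_mem (hf ν hν) (hg ν hν)
        rw [pmk_mul0] at this
        convert this using 2
        refine ContinuousMap.ext fun p => ?_
        change (μ p.1 : ℂ) * (f p * g p) = ((ν p.1 : ℂ) * f p) * ((ν p.1 : ℂ) * g p)
        have : (μ p.1 : ℂ) = (ν p.1 : ℂ) * (ν p.1 : ℂ) := by
          rw [← Complex.ofReal_mul]
          congr 1
          exact (Real.mul_self_sqrt (hμ.1 _)).symm
        rw [this]; ring
      algebraMap_mem' := fun c μ hμ => by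
        have h0 := P.smul_mem (hsm μ 1 hμ) c
        rw [pmk_smul0] at h0
        convert h0 using 2
        refine ContinuousMap.ext fun p => ?_
        change (μ p.1 : ℂ) * (algebraMap ℂ ℂ c) = c • ((μ p.1 : ℂ) * p.2 1)
        rw [map_one]; simp [mul_comm] }
  have hSc : IsClosed (S : Set C(K × characterSpace ℂ A, ℂ)) := by
    have : (S : Set C(K × characterSpace ℂ A, ℂ)) = ⋂ μ, ⋂ (_ : good μ),
        (fun f => (pmk (mul0 μ * f) 0 : AM A K L)) ⁻¹' P := by
      ext f; simp [S]
    rw [this]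
    refine isClosed_iInter fun μ => isClosed_iInter fun _ => hPc.preimage ?_
    exact cont_pmk (by fun_prop) continuous_const
  let G : Set C(K × characterSpace ℂ A, ℂ) := range gam
  have hG : G ⊆ S := by
    rintro _ ⟨F, rfl⟩ μ hμ
    exact hsm μ F hμ
  have hG' : star G ⊆ S := by
    intro f hf μ hμ
    obtain ⟨F, hF⟩ := hf
    have hb : ∀ l, smulA μ F (e l) = 0 := fun l => by
      change μ (e l) • F (e l) = 0
      rw [hμ.2, zero_smul]
    have := sub_mem (P.smul_mem (m2 (smulA μ F) hb) 2) (hsm μ F hμ)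
    have hrB : sval (Bs A e) (rB e (smulA μ F) hb) =
      pmk ⟨fun p => ((gam (smulA μ F) p).re : ℂ), by fun_prop⟩ 0 := rfl
    rw [hrB, pmk_smul0, pmk_sub0] at this
    convert this using 2
    refine ContinuousMap.ext fun p => ?_
    change (μ p.1 : ℂ) * f p = (2:ℂ) • (((gam (smulA μ F) p).re : ℝ) : ℂ) - (μ p.1 : ℂ) * gam F p
    rw [gs, hF]
    change (μ p.1 : ℂ) * f p = (2:ℂ) • (((μ p.1 * (starRingEnd ℂ (f p)) : ℂ).re : ℝ) : ℂ) -
      (μ p.1 : ℂ) * (starRingEnd ℂ (f p))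
    apply Complex.ext <;> simp
    ring
  have hStop : ∀ f, f ∈ S := by
    let SS := StarAlgebra.adjoin ℂ G
    have h1 : SS.toSubalgebra ≤ S := by
      rw [StarAlgebra.adjoin_toSubalgebra]
      exact Algebra.adjoin_le (union_subset hG hG')
    have h2 : SS.topologicalClosure = ⊤ := by
      refine ContinuousMap.starSubalgebra_topologicalClosure_eq_top_of_separatesPoints SS ?_
      rintro ⟨x, χ⟩ ⟨y, ξ⟩ hne
      have hsub : ∀ F, gam F ∈ SS := fun F => StarAlgebra.subset_adjoin ℂ G ⟨F, rfl⟩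
      by_cases hχ : χ = ξ
      · have hxy : x ≠ y := fun h => hne (by rw [h, hχ])
        obtain ⟨h, h0, h1, -⟩ := exists_continuous_zero_one_of_isClosed (isClosed_singleton (x := x))
          (isClosed_singleton (x := y)) (by simpa using hxy)
        refine ⟨_, ⟨gam (smulA h 1), hsub _, rfl⟩, ?_⟩
        change gam (smulA h 1) (x, χ) ≠ gam (smulA h 1) (y, ξ)
        rw [gs, gs]
        simp only [h0 rfl, h1 rfl]
        change ((0:ℝ):ℂ) * χ 1 ≠ ((1:ℝ):ℂ) * ξ 1
        rw [map_one, map_one]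
        simp
      · obtain ⟨a, ha⟩ : ∃ a, χ a ≠ ξ a := by
          by_contra hcon
          push Not at hcon
          exact hχ (CharacterSpace.ext hcon)
        exact ⟨_, ⟨gam (.const _ a), hsub _, rfl⟩, ha⟩
    intro f
    have : f ∈ SS.topologicalClosure := by rw [h2]; trivial
    exact closure_minimal h1 hSc this
  have hvan : ∀ f : C(K × characterSpace ℂ A, ℂ), (∀ l χ, f (e l, χ) = 0) →
      (pmk (f) 0 : AM A K L) ∈ P := by
    intro f hf
    rw [← SetLike.mem_coe, ← hPc.closure_eq, Metric.mem_closure_iff]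
    intro ε hε
    have hε2 : 0 < ε / 2 := by positivity
    let N : K → ℝ := fun x => ‖f.curry x‖
    have hN : Continuous N := by fun_prop
    let μ : C(K, ℝ) := ⟨fun x => min 1 (N x / (ε / 2)), by fun_prop⟩
    have hμ : good μ := ⟨fun x => le_min zero_le_one (by positivity), fun l => by
      have : N (e l) = 0 := by
        change ‖f.curry (e l)‖ = 0
        rw [norm_eq_zero]
        ext χ; exact hf l χ
      change min 1 (N (e l) / (ε / 2)) = 0
      rw [this]; simp⟩
    refine ⟨_, hStop f μ hμ, ?_⟩
    rw [dist_eq_norm, pmk_sub0]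
    refine lt_of_le_of_lt (b := ε / 2) (max_le ?_ ((norm_zero (E := C(L, A))).le.trans hε2.le)) (by linarith)
    rw [ContinuousMap.norm_le _ hε2.le]
    intro p
    have hle : ‖f p‖ ≤ N p.1 := ContinuousMap.norm_coe_le_norm (f.curry p.1) p.2
    have e1 : (f - mul0 μ * f : C(K × characterSpace ℂ A, ℂ)) p = ((1 - μ p.1 : ℝ) : ℂ) * f p := by
      change f p - (μ p.1 : ℂ) * f p = _
      push_cast; ring
    have hμ1 : μ p.1 ≤ 1 := min_le_left _ _
    change ‖(f - mul0 μ * f : C(K × characterSpace ℂ A, ℂ)) p‖ ≤ _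
    rw [e1, norm_mul, Complex.norm_real, Real.norm_of_nonneg (by linarith)]
    have hμ0 := hμ.1 p.1
    rcases le_total 1 (N p.1 / (ε / 2)) with h1 | h1
    · have : μ p.1 = 1 := min_eq_left h1
      rw [this]; simp [hε2.le]
    · have := (div_le_one hε2).1 h1
      nlinarith [norm_nonneg (f p)]
  apply sval_clos
  have hx := sval_mem _ x
  generalize sval _ x = y at hx ⊢
  obtain ⟨f, g, rfl⟩ : ∃ f g, y = pmk f g := ⟨p1 _ _ y, p2 _ _ y, rfl⟩
  obtain ⟨F, hF⟩ := hext g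
  have h1 := hvan (f - gam F) (fun l χ => by
    have h2 := hx l χ
    change f (e l, χ) - χ (F (e l)) = 0
    rw [sub_eq_zero]
    change f (e l, χ) = χ (g l) at h2
    rw [h2, ← hF]; rfl)
  have h2 := add_mem h1 (m1 F)
  have e2 : (pmk f g : AM A K L) =
      pmk (f - gam F) 0 + sval (Bs A e) (PhiB A e F) := by
    refine pext ?_ ?_
    · change f = f - gam F + gam F
      abel
    · change g = 0 + F.comp e
      rw [hF, zero_add]
  rw [← e2] at h2
  exact h2

end
end
end Dav

set_option linter.all false

namespace Dav
noncomputable section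
open WeakDual Set

section
variable {A : Type*} [NormedCommRing A] [NormedAlgebra ℂ A] [CompleteSpace A]
  {K : Type*} [TopologicalSpace K] [CompactSpace K] [T2Space K]
  {L : Type*} [TopologicalSpace L] [CompactSpace L] [T2Space L]

theorem B_ext (e : C(L, K)) {x y : BT A e} (h1 : B1 A e x = B1 A e y) (h2 : B2 A e x = B2 A e y) : x = y :=
  sval_inj _ (pext h1 h2)

def bmk (e : C(L, K)) (f : C(K × characterSpace ℂ A, ℂ)) (g : C(L, A))
    (h : ∀ l χ, f (e l, χ) = χ (g l)) : BT A e := smk (Bs A e) (pmk f g) h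

theorem B_unit (e : C(L, K)) (x : BT A e) (h1 : ∀ p, B1 A e x p ≠ 0) (h2 : ∀ l, IsUnit (B2 A e x l)) :
    IsUnit x := by
  have hx : ∀ l χ, B1 A e x (e l, χ) = χ (B2 A e x l) := sval_mem _ x
  have u1 : IsUnit (B1 A e x) := (ContinuousMap.isUnit_iff_forall_ne_zero _).2 h1
  have u2 : IsUnit (B2 A e x) := (ContinuousMap.isUnit_iff_forall_isUnit _).2 h2
  obtain ⟨f, hf⟩ := u1.exists_right_inv
  obtain ⟨g, hg⟩ := u2.exists_right_inv
  have hf' : ∀ p, B1 A e x p * f p = 1 := fun p => congrArg (fun h : C(K × characterSpace ℂ A, ℂ) => h p) hf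
  have hg' : ∀ l, B2 A e x l * g l = 1 := fun p => congrArg (fun h : C(L, A) => h p) hg
  refine IsUnit.of_mul_eq_one (bmk e f g fun l χ => ?_) ?_
  · refine mul_left_cancel₀ (h1 (e l, χ)) ?_
    rw [hf', hx, ← map_mul, hg', map_one]
  · refine B_ext e ?_ ?_
    · rw [map_mul, map_one]; exact hf
    · rw [map_mul, map_one]; exact hg

/-- evaluation at a point of K -/
def evK (e : C(L, K)) (x : K) : BT A e →ₐ[ℂ] C(characterSpace ℂ A, ℂ) :=
  (ContinuousMap.compRightAlgHom ℂ ℂ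
    (⟨fun χ => (x, χ), by fun_prop⟩ : C(characterSpace ℂ A, K × characterSpace ℂ A))).comp (B1 A e)

def evL (e : C(L, K)) (l : L) : BT A e →ₐ[ℂ] A := (evA l).comp (B2 A e)

theorem evK_curry (e : C(L, K)) (x : K) (b : BT A e) : evK e x b = (B1 A e b).curry x := rfl

set_option maxHeartbeats 1000000 in
theorem conc {n : ℕ} (e : C(L, K)) (hext : ∀ g : C(L, A), ∃ f : C(K, A), f.comp e = g)
    (v : K → Mn n C(characterSpace ℂ A, ℂ)) (hv : Continuous v) (hvu : ∀ x, IsUnit (v x))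
    (w : L → Mn n A) (hw : Continuous w) (hwu : ∀ l, IsUnit (w l))
    (hc : ∀ l, v (e l) = mp n (gelfandTransform ℂ A) (w l)) :
    ∃ (U : K → Mn n A) (V : unitInterval × K → Mn n C(characterSpace ℂ A, ℂ))
      (Wt : unitInterval × L → Mn n A), Continuous U ∧ Continuous V ∧ Continuous Wt ∧
      (∀ x, IsUnit (U x)) ∧ (∀ p, IsUnit (V p)) ∧ (∀ p, IsUnit (Wt p)) ∧
      (∀ t l, V (t, e l) = mp n (gelfandTransform ℂ A) (Wt (t, l))) ∧
      (∀ x, V (0, x) = v x) ∧ (∀ l, Wt (0, l) = w l) ∧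
      (∀ x, V (1, x) = mp n (gelfandTransform ℂ A) (U x)) ∧ (∀ l, Wt (1, l) = U (e l)) := by
  let f : Fin n → Fin n → C(K × characterSpace ℂ A, ℂ) := fun i j =>
    ContinuousMap.uncurry ⟨fun x => v x i j, (cont_entry i j).comp hv⟩
  let g : Fin n → Fin n → C(L, A) := fun i j => ⟨fun l => w l i j, (cont_entry i j).comp hw⟩
  have hfg : ∀ i j l χ, f i j (e l, χ) = χ (g i j l) := by
    intro i j l χ
    change v (e l) i j χ = χ (w l i j)
    rw [hc]; rfl
  let z : Mn n (BT A e) := fun i j => bmk e (f i j) (g i j) (hfg i j)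
  have zK : ∀ x, mp n (evK e x) z = v x := fun x => Mn_ext fun i j => by
    rw [mp_apply]; ext χ; rfl
  have zL : ∀ l, mp n (evL e l) z = w l := fun l => Mn_ext fun i j => by
    rw [mp_apply]; rfl
  have hz : IsUnit z := by
    rw [isUnit_dt]
    refine B_unit e _ ?_ ?_
    · rintro ⟨x, χ⟩
      have h1 := (isUnit_dt _).1 (hvu x)
      rw [← zK x, dt_mp] at h1
      exact (h1.map (evA (R := ℂ) χ)).ne_zero
    · intro l
      have h1 := (isUnit_dt _).1 (hwu l)
      rw [← zL l, dt_mp] at h1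
      exact h1
  obtain ⟨u, hu, γ, hγ⟩ := stepS (PhiB A e) (hcharB e) (dense_B e hext) z hz
  refine ⟨fun x => mp n (evA x) u, fun p => mp n (evK e p.2) (γ p.1),
    fun p => mp n (evL e p.2) (γ p.1), ?_, ?_, ?_, ?_, ?_, ?_, ?_, ?_, ?_, ?_, ?_⟩
  · refine cont_Mn fun i j => ?_
    exact (u i j).continuous
  · refine cont_Mn fun i j => ?_
    have h1 : Continuous fun p : unitInterval × K => B1 A e (γ p.1 i j) :=
      (cont_B1 e).comp ((cont_entry i j).comp (γ.continuous.comp continuous_fst))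
    exact (ContinuousMap.continuous_curry.comp h1).eval continuous_snd
  · refine cont_Mn fun i j => ?_
    have h1 : Continuous fun p : unitInterval × L => B2 A e (γ p.1 i j) :=
      (cont_B2 e).comp ((cont_entry i j).comp (γ.continuous.comp continuous_fst))
    exact h1.eval continuous_snd
  · intro x; exact hu.map _
  · intro p; exact (hγ p.1).map _
  · intro p; exact (hγ p.1).map _
  · intro t l
    refine Mn_ext fun i j => ?_
    refine ContinuousMap.ext fun χ => ?_
    have := sval_mem (Bs A e) (γ t i j)
    exact this l χ
  · intro x; simp only [γ.source]; exact zK x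
  · intro x; simp only [γ.source]; exact zL x
  · intro x; simp only [γ.target]; refine Mn_ext fun i j => ?_
    ext χ; rfl
  · intro x; simp only [γ.target]; refine Mn_ext fun i j => ?_
    rfl

end
end
end Dav

set_option linter.all false

namespace Dav
noncomputable section
open Set

/-- every map of a compact space into the set is null homotopic -/
def Null.{u, v} {Z : Type v} [TopologicalSpace Z] (Y : Set Z) : Prop :=
  ∀ (K : Type u) [TopologicalSpace K] [CompactSpace K] [T2Space K] (f : C(K, Y)),
    ∃ z : Y, f.Homotopic (.const K z)

section
variable {ι : Type*}

/-- simplex -/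
def Sx (σ : Finset ι) : Set (ι → ℝ) :=
  {w | (∀ i, 0 ≤ w i) ∧ (∀ i, i ∉ σ → w i = 0) ∧ ∑ i ∈ σ, w i = 1}

/-- boundary -/
def bSx (σ : Finset ι) : Set (ι → ℝ) := {w | w ∈ Sx σ ∧ ∃ i ∈ σ, w i = 0}

theorem Sx_closed (σ : Finset ι) : IsClosed (Sx σ) := by
  have : Sx σ = (⋂ i, {w | 0 ≤ w i}) ∩ (⋂ i, ⋂ (_ : i ∉ σ), {w | w i = 0}) ∩
      {w | ∑ i ∈ σ, w i = 1} := by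
    ext w; simp [Sx, and_assoc]
  rw [this]
  refine ((isClosed_iInter fun i => isClosed_le continuous_const (continuous_apply i)).inter
    (isClosed_iInter fun i => isClosed_iInter fun _ => isClosed_eq (continuous_apply i)
      continuous_const)).inter (isClosed_eq (by fun_prop) continuous_const)

theorem Sx_le (σ : Finset ι) {w : ι → ℝ} (hw : w ∈ Sx σ) (i : ι) : w i ≤ 1 := by
  by_cases h : i ∈ σ
  · rw [← hw.2.2]
    exact Finset.single_le_sum (f := w) (fun j _ => hw.1 j) h
  · rw [hw.2.1 i h]; exact zero_le_one

theorem Sx_compact (σ : Finset ι) : IsCompact (Sx σ) := by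
  have h : IsCompact (Set.univ.pi fun _ : ι => Icc (0:ℝ) 1) :=
    isCompact_univ_pi fun _ => isCompact_Icc
  exact h.of_isClosed_subset (Sx_closed σ) fun w hw i _ => ⟨hw.1 i, Sx_le σ hw i⟩

theorem bSx_closed (σ : Finset ι) : IsClosed (bSx σ) := by
  have : bSx σ = Sx σ ∩ ⋃ i ∈ σ, {w | w i = 0} := by
    ext w; simp [bSx]
  rw [this]
  refine (Sx_closed σ).inter (σ.finite_toSet.isClosed_biUnion fun i _ =>
    isClosed_eq (continuous_apply i) continuous_const)

theorem bSx_compact (σ : Finset ι) : IsCompact (bSx σ) :=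
  (Sx_compact σ).of_isClosed_subset (bSx_closed σ) fun w hw => hw.1

variable {Z : Type*} [TopologicalSpace Z]

open Classical in
theorem ext_simplex.{u} {ι : Type u} (σ : Finset ι) (hσ : σ.Nonempty) {Y : Set Z} (hY : Null.{u} Y)
    (b : (ι → ℝ) → Z) (hb : ContinuousOn b (bSx σ)) (hbY : ∀ w ∈ bSx σ, b w ∈ Y) :
    ∃ d : (ι → ℝ) → Z, ContinuousOn d (Sx σ) ∧ (∀ w ∈ Sx σ, d w ∈ Y) ∧ ∀ w ∈ bSx σ, d w = b w := by
  haveI : CompactSpace (bSx σ) := isCompact_iff_compactSpace.1 (bSx_compact σ)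
  obtain ⟨z, ⟨H⟩⟩ := hY (bSx σ) ⟨fun w => ⟨b w, hbY w w.2⟩,
    (continuousOn_iff_continuous_restrict.1 hb).subtype_mk _⟩
  set μ : (ι → ℝ) → ℝ := fun w => σ.inf' hσ w with hμ
  have hμc : Continuous μ := Continuous.finset_inf'_apply hσ fun i _ => continuous_apply i
  set m : ℝ := (σ.card : ℝ) with hm
  have hm0 : 0 < m := by simpa [hm] using hσ
  have hμ0 : ∀ w ∈ Sx σ, 0 ≤ μ w := fun w hw => Finset.le_inf' _ _ fun i _ => hw.1 i
  have hμle : ∀ w, ∀ i ∈ σ, μ w ≤ w i := fun w i hi => Finset.inf'_le _ hi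
  have hbd : ∀ w ∈ bSx σ, μ w = 0 := fun w hw => by
    obtain ⟨i, hi, h0⟩ := hw.2
    exact le_antisymm (h0 ▸ hμle w i hi) (hμ0 w hw.1)
  let pr : (ι → ℝ) → ι → ℝ := fun w i => if i ∈ σ then (w i - μ w) / (1 - m * μ w) else 0
  have hpr : ∀ w ∈ Sx σ, m * μ w ≤ 1 / 2 → pr w ∈ bSx σ := by
    intro w hw hl
    have h1 : 0 < 1 - m * μ w := by linarith
    refine ⟨⟨fun i => ?_, fun i hi => if_neg hi, ?_⟩, ?_⟩
    · by_cases hi : i ∈ σ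
      · simp only [pr, if_pos hi]
        exact div_nonneg (by linarith [hμle w i hi]) h1.le
      · simp [pr, hi]
    · rw [Finset.sum_congr rfl fun i hi => if_pos hi, ← Finset.sum_div, Finset.sum_sub_distrib, hw.2.2,
        Finset.sum_const, nsmul_eq_mul]
      exact div_self h1.ne'
    · obtain ⟨i, hi, h⟩ := Finset.exists_mem_eq_inf' hσ w
      refine ⟨i, hi, ?_⟩
      simp only [pr, if_pos hi]
      rw [show w i = μ w from h.symm]; simp
  let d : (ι → ℝ) → Z := fun w => if h : w ∈ Sx σ ∧ m * μ w ≤ 1 / 2 then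
    (H (Set.projIcc 0 1 zero_le_one (2 * (m * μ w)), ⟨pr w, hpr w h.1 h.2⟩) : Y) else z
  have hdY : ∀ w, d w ∈ Y := by
    intro w
    by_cases h : w ∈ Sx σ ∧ m * μ w ≤ 1 / 2
    · simp only [d, dif_pos h]; exact Subtype.coe_prop _
    · simp only [d, dif_neg h]; exact z.2
  refine ⟨d, ?_, fun w _ => hdY w, ?_⟩
  · have e : Sx σ = {w | w ∈ Sx σ ∧ m * μ w ≤ 1 / 2} ∪ {w | w ∈ Sx σ ∧ 1 / 2 ≤ m * μ w} := by
      ext w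
      simp only [mem_union, mem_setOf_eq]
      rcases le_total (m * μ w) (1/2) with h | h <;> tauto
    have hmc : Continuous fun w => m * μ w := continuous_const.mul hμc
    rw [e]
    refine ContinuousOn.union_of_isClosed ?_ ?_ ?_ ?_
    · rw [continuousOn_iff_continuous_restrict]
      have : ({w | w ∈ Sx σ ∧ m * μ w ≤ 1 / 2}).domRestrict d = fun w : ({w | w ∈ Sx σ ∧ m * μ w ≤ 1 / 2} : Set (ι → ℝ)) =>
          ((H (Set.projIcc 0 1 zero_le_one (2 * (m * μ w.1)), ⟨pr w, hpr w w.2.1 w.2.2⟩) : Y) : Z) := by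
        ext w; exact dif_pos w.2
      rw [this]
      refine continuous_subtype_val.comp (H.continuous.comp (Continuous.prodMk ?_ ?_))
      · exact continuous_projIcc.comp (continuous_const.mul (hmc.comp continuous_subtype_val))
      · refine Continuous.subtype_mk (continuous_pi fun i => ?_) _
        by_cases hi : i ∈ σ
        · simp only [pr, if_pos hi]
          refine Continuous.div ?_ ?_ ?_
          · exact (((continuous_apply i).sub hμc)).comp continuous_subtype_val
          · exact (continuous_const.sub hmc).comp continuous_subtype_val
          · intro w
            have := w.2.2
            change m * μ w.1 ≤ 1/2 at this
            have : 0 < 1 - m * μ w.1 := by linarith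
            exact this.ne'
        · simp only [pr, if_neg hi]; exact continuous_const
    · refine (continuousOn_const (c := (z : Z))).congr fun w hw => ?_
      by_cases h : w ∈ Sx σ ∧ m * μ w ≤ 1 / 2
      · have h2 : m * μ w = 1/2 := le_antisymm h.2 hw.2
        simp only [d, dif_pos h]
        have : Set.projIcc (0:ℝ) 1 zero_le_one (2 * (m * μ w)) = 1 := by
          rw [h2]; norm_num
        rw [this, H.apply_one]; rfl
      · simp only [d, dif_neg h]
    · exact (Sx_closed σ).inter (isClosed_le hmc continuous_const)
    · exact (Sx_closed σ).inter (isClosed_le continuous_const hmc)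
  · intro w hw
    have h0 := hbd w hw
    have h : w ∈ Sx σ ∧ m * μ w ≤ 1 / 2 := ⟨hw.1, by rw [h0]; norm_num⟩
    simp only [d, dif_pos h]
    have e1 : Set.projIcc (0:ℝ) 1 zero_le_one (2 * (m * μ w)) = 0 := by
      rw [h0]; simp
    have e2 : pr w = w := by
      ext i
      by_cases hi : i ∈ σ
      · simp [pr, hi, h0]
      · simp [pr, hi, hw.1.2.1 i hi]
    have e3 : (⟨pr w, hpr w h.1 h.2⟩ : bSx σ) = ⟨w, hw⟩ := Subtype.ext e2
    rw [e1, e3, H.apply_zero]; rfl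

open Classical in
/-- support as a finset -/
def sp {ι : Type*} (w : ι → ℝ) : Finset ι :=
  if h : (Function.support w).Finite then h.toFinset else ∅

theorem Sx_supp {σ : Finset ι} {w : ι → ℝ} (hw : w ∈ Sx σ) : Function.support w ⊆ σ := fun i hi => by
  by_contra h
  exact hi (hw.2.1 i h)

theorem mem_sp {w : ι → ℝ} (h : (Function.support w).Finite) (i : ι) : i ∈ sp w ↔ w i ≠ 0 := by
  simp [sp, h]

theorem mem_sp' {σ : Finset ι} {w : ι → ℝ} (hw : w ∈ Sx σ) (i : ι) : i ∈ sp w ↔ w i ≠ 0 :=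
  mem_sp (σ.finite_toSet.subset (Sx_supp hw)) i

theorem sp_sub {σ : Finset ι} {w : ι → ℝ} (hw : w ∈ Sx σ) : sp w ⊆ σ := fun i hi =>
  Sx_supp hw ((mem_sp' hw i).1 hi)

theorem sp_eq {σ : Finset ι} {w : ι → ℝ} (hw : w ∈ Sx σ) (h : w ∉ bSx σ) : sp w = σ := by
  refine (sp_sub hw).antisymm fun i hi => (mem_sp' hw i).2 fun h0 => h ⟨hw, i, hi, h0⟩

theorem sp_ssub {σ : Finset ι} {w : ι → ℝ} (h : w ∈ bSx σ) : sp w ⊂ σ := by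
  refine Finset.ssubset_iff_subset_ne.2 ⟨sp_sub h.1, fun h0 => ?_⟩
  obtain ⟨i, hi, h1⟩ := h.2
  rw [← h0] at hi
  exact (mem_sp' h.1 i).1 hi h1

theorem Sx_erase [DecidableEq ι] {σ : Finset ι} {w : ι → ℝ} (h : w ∈ Sx σ) {i : ι} (hi : i ∈ σ) (h0 : w i = 0) :
    w ∈ Sx (σ.erase i) := by
  refine ⟨h.1, fun j hj => ?_, ?_⟩
  · by_cases hji : j = i
    · rw [hji, h0]
    · exact h.2.1 j fun hjσ => hj (Finset.mem_erase.2 ⟨hji, hjσ⟩)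
  · rw [← h.2.2, ← Finset.add_sum_erase _ _ hi, h0, zero_add]

theorem Sx_of_erase [DecidableEq ι] {σ : Finset ι} {w : ι → ℝ} {i : ι} (hi : i ∈ σ)
    (h : w ∈ Sx (σ.erase i)) : w ∈ bSx σ := by
  have h0 : w i = 0 := h.2.1 i (Finset.notMem_erase _ _)
  refine ⟨⟨h.1, fun j hj => h.2.1 j fun hh => hj (Finset.mem_of_mem_erase hh), ?_⟩, i, hi, h0⟩
  rw [← Finset.add_sum_erase _ _ hi, h0, zero_add, h.2.2]

/-- one extension step -/
def Ext (Zs : Finset ι → Set Z) (σ : Finset ι) (b : (ι → ℝ) → Z) : (ι → ℝ) → Z :=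
  open Classical in
  if h : ∃ d : (ι → ℝ) → Z, ContinuousOn d (Sx σ) ∧ (∀ w ∈ Sx σ, d w ∈ Zs σ) ∧ ∀ w ∈ bSx σ, d w = b w then
    h.choose else b

open Classical in
/-- skeletal construction -/
def skel (Zs : Finset ι → Set Z) (z0 : Z) : ℕ → (ι → ℝ) → Z
  | 0 => fun _ => z0
  | k + 1 => fun w => if (sp w).card = k + 1 then Ext Zs (sp w) (skel Zs z0 k) w else skel Zs z0 k w

open Classical in
theorem skel_succ (Zs : Finset ι → Set Z) (z0 : Z) (k : ℕ) (w : ι → ℝ) : skel Zs z0 (k + 1) w =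
    if (sp w).card = k + 1 then Ext Zs (sp w) (skel Zs z0 k) w else skel Zs z0 k w := rfl

theorem skel_stable (Zs : Finset ι → Set Z) (z0 : Z) (w : ι → ℝ) (k : ℕ) (hk : (sp w).card ≤ k) :
    skel Zs z0 k w = skel Zs z0 (sp w).card w := by
  induction k, hk using Nat.le_induction with
  | base => rfl
  | succ k hk ih =>
    rw [← ih, skel_succ, if_neg (by omega)]

open Classical in
theorem skel_spec.{u} {ι : Type u} (Zs : Finset ι → Set Z) (hmono : ∀ σ τ, σ ⊆ τ → Zs σ ⊆ Zs τ) (z0 : Z)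
    (good : Finset ι → Prop) (hg : ∀ σ τ, σ ⊆ τ → good τ → good σ)
    (hnull : ∀ σ, good σ → σ.Nonempty → Null.{u} (Zs σ)) (k : ℕ) :
    ∀ σ : Finset ι, good σ → σ.Nonempty → σ.card ≤ k →
      ContinuousOn (skel Zs z0 k) (Sx σ) ∧ ∀ w ∈ Sx σ, skel Zs z0 k w ∈ Zs (sp w) := by
  induction k with
  | zero =>
    intro σ _ hne hc
    exact absurd (Finset.card_pos.2 hne) (by omega)
  | succ k ih =>
    intro σ hσ hne hc
    rcases Nat.lt_or_ge k σ.card with h | h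
    · have hcard : σ.card = k + 1 := by omega
      have hbc : ContinuousOn (skel Zs z0 k) (bSx σ) := by
        have e : bSx σ = ⋃ i : σ, Sx (σ.erase i) := by
          ext w
          simp only [mem_iUnion]
          constructor
          · rintro ⟨hw, i, hi, h0⟩
            exact ⟨⟨i, hi⟩, Sx_erase hw hi h0⟩
          · rintro ⟨i, hi⟩
            exact Sx_of_erase i.2 hi
        rw [e]
        refine LocallyFinite.continuousOn_iUnion (locallyFinite_of_finite _) (fun i => Sx_closed _) fun i => ?_
        rcases (σ.erase (i : ι)).eq_empty_or_nonempty with h0 | h0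
        · rw [h0]
          intro w hw
          have := hw.2.2
          simp at this
        · exact (ih _ (hg _ _ (Finset.erase_subset _ _) hσ) h0
            (by rw [Finset.card_erase_of_mem i.2]; omega)).1
      have hbv : ∀ w ∈ bSx σ, skel Zs z0 k w ∈ Zs (sp w) := by
        rintro w ⟨hw, i, hi, h0⟩
        have hw' := Sx_erase hw hi h0
        have hne' : (σ.erase i).Nonempty := by
          by_contra hcon
          rw [Finset.not_nonempty_iff_eq_empty] at hcon
          rw [hcon] at hw'
          have := hw'.2.2
          simp at this
        exact (ih _ (hg _ _ (Finset.erase_subset _ _) hσ) hne'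
            (by rw [Finset.card_erase_of_mem hi]; omega)).2 w hw'
      have hex := ext_simplex σ hne (hnull σ hσ hne) (skel Zs z0 k) hbc
        (fun w hw => hmono _ _ (sp_sub hw.1) (hbv w hw))
      have hE : Ext Zs σ (skel Zs z0 k) = hex.choose := dif_pos hex
      obtain ⟨h1, h2, h3⟩ := hex.choose_spec
      rw [← hE] at h1 h2 h3
      have heq : ∀ w ∈ Sx σ, skel Zs z0 (k + 1) w = Ext Zs σ (skel Zs z0 k) w := by
        intro w hw
        by_cases hb : w ∈ bSx σ
        · have := Finset.card_lt_card (sp_ssub hb)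
          rw [skel_succ, if_neg (by omega), h3 w hb]
        · rw [skel_succ, sp_eq hw hb, if_pos hcard]
      refine ⟨h1.congr heq, fun w hw => ?_⟩
      by_cases hb : w ∈ bSx σ
      · rw [heq w hw, h3 w hb]; exact hbv w hb
      · rw [heq w hw, sp_eq hw hb]; exact h2 w hw
    · have heq : ∀ w ∈ Sx σ, skel Zs z0 (k + 1) w = skel Zs z0 k w := by
        intro w hw
        have := Finset.card_le_card (sp_sub hw)
        rw [skel_succ, if_neg (by omega)]
      obtain ⟨h1, h2⟩ := ih σ hσ hne h
      exact ⟨h1.congr heq, fun w hw => by rw [heq w hw]; exact h2 w hw⟩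

theorem nerve.{u} {ι : Type u} {P : Type*} [TopologicalSpace P] [hP : Nonempty P] (φ : P → ι → ℝ)
    (hφ : ∀ i, Continuous fun p => φ p i) (hlf : LocallyFinite fun i => {p | φ p i ≠ 0})
    (h0 : ∀ p i, 0 ≤ φ p i) (h1 : ∀ p, ∑ᶠ i, φ p i = 1)
    (Zs : Finset ι → Set Z) (hmono : ∀ σ τ, σ ⊆ τ → Zs σ ⊆ Zs τ)
    (hnull : ∀ σ : Finset ι, (∃ p, ∀ i ∈ σ, φ p i ≠ 0) → σ.Nonempty → Null.{u} (Zs σ)) :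
    ∃ c : (ι → ℝ) → Z, Continuous (fun p => c (φ p)) ∧ ∀ p, c (φ p) ∈ Zs (sp (φ p)) := by
  classical
  have hfin : ∀ p, (Function.support (φ p)).Finite := fun p => hlf.point_finite p
  have hsp : ∀ p i, i ∈ sp (φ p) ↔ φ p i ≠ 0 := fun p i => mem_sp (hfin p) i
  have hmem : ∀ p σ, (∀ i, i ∉ σ → φ p i = 0) → φ p ∈ Sx σ := by
    intro p σ h
    refine ⟨h0 p, h, ?_⟩
    rw [← h1 p, finsum_eq_sum_of_support_subset]
    intro i hi
    by_contra hcon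
    exact hi (h i hcon)
  have hmem' : ∀ p, φ p ∈ Sx (sp (φ p)) := fun p => hmem p _ fun i hi => by
    by_contra hcon
    exact hi ((hsp p i).2 hcon)
  have hne : ∀ p, (sp (φ p)).Nonempty := by
    intro p
    by_contra hcon
    rw [Finset.not_nonempty_iff_eq_empty] at hcon
    have := (hmem' p).2.2
    rw [hcon] at this
    simp at this
  rcases isEmpty_or_nonempty Z with hZ | ⟨⟨z0⟩⟩
  · have : IsEmpty P := ⟨fun p => by
      obtain ⟨z, -⟩ := hnull (sp (φ p)) ⟨p, fun i hi => (hsp p i).1 hi⟩ (hne p) PEmpty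
        ⟨fun x => x.elim, continuous_of_discreteTopology⟩
      exact hZ.elim z⟩
    exact this.elim (Classical.choice hP)
  let good : Finset ι → Prop := fun σ => ∃ p, ∀ i ∈ σ, φ p i ≠ 0
  have hg : ∀ σ τ, σ ⊆ τ → good τ → good σ := fun σ τ h ⟨p, hp⟩ => ⟨p, fun i hi => hp i (h hi)⟩
  have key := skel_spec Zs hmono z0 good hg hnull
  let c : (ι → ℝ) → Z := fun w => skel Zs z0 (sp w).card w
  refine ⟨c, ?_, fun p => (key _ (sp (φ p)) ⟨p, fun i hi => (hsp p i).1 hi⟩ (hne p) le_rfl).2 _ (hmem' p)⟩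
  have hφc : Continuous φ := continuous_pi hφ
  have hlf2 : LocallyFinite fun σ : Finset ι => {p | sp (φ p) = σ} := by
    intro p
    obtain ⟨N, hN, hf⟩ := hlf p
    refine ⟨N, hN, (hf.toFinset.powerset.finite_toSet).subset ?_⟩
    rintro σ ⟨q, hq, hqN⟩
    simp only [Finset.coe_powerset, mem_preimage, mem_powerset_iff]
    intro i hi
    rw [Set.Finite.coe_toFinset]
    refine ⟨q, ?_, hqN⟩
    rw [← show sp (φ q) = σ from hq] at hi
    exact (hsp q i).1 hi
  refine hlf2.closure.continuous ?_ (fun _ => isClosed_closure) fun σ => ?_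
  · exact eq_univ_of_forall fun p => mem_iUnion.2 ⟨sp (φ p), subset_closure rfl⟩
  · rcases ({p | sp (φ p) = σ}).eq_empty_or_nonempty with he | ⟨p, hp⟩
    · rw [he, closure_empty]; exact continuousOn_empty _
    · have hσ : good σ := ⟨p, fun i hi => (hsp p i).1 (by rw [show sp (φ p) = σ from hp]; exact hi)⟩
      have hσne : σ.Nonempty := by rw [← show sp (φ p) = σ from hp]; exact hne p
      have hsub : ∀ q ∈ closure {p | sp (φ p) = σ}, φ q ∈ Sx σ := by
        intro q hq
        have hcl : IsClosed (φ ⁻¹' Sx σ) := (Sx_closed σ).preimage hφc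
        refine closure_minimal ?_ hcl hq
        intro r hr
        have := hmem' r
        rw [show sp (φ r) = σ from hr] at this
        exact this
      have hc : ContinuousOn c (Sx σ) := (key σ.card σ hσ hσne le_rfl).1.congr fun w hw =>
        (skel_stable Zs z0 w _ (Finset.card_le_card (sp_sub hw))).symm
      exact hc.comp hφc.continuousOn hsub


end
end
end Dav

set_option linter.all false

namespace Dav
noncomputable section
open Set

theorem hull_sub {E X : Type*} [NormedAddCommGroup E] [NormedSpace ℝ E] {O : Set E} (D : X → E) (r : X → ℝ)
    (hr : ∀ i, Metric.ball (D i) (4 * r i) ⊆ O) (hr0 : ∀ i, 0 < r i) (σ : Finset X) (hσ : σ.Nonempty) (x : E)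
    (hx : ∀ i ∈ σ, dist x (D i) < r i) :
    convexHull ℝ (⋃ i ∈ σ, Metric.ball (D i) (r i)) ⊆ O := by
  obtain ⟨i, hi, hmax⟩ := σ.exists_max_image r hσ
  refine (convexHull_min ?_ (convex_ball (D i) (4 * r i))).trans (hr i)
  intro y hy
  simp only [mem_iUnion] at hy
  obtain ⟨j, hj, hy⟩ := hy
  rw [Metric.mem_ball] at hy ⊢
  have h1 := hx j hj
  have h2 := hx i hi
  have h3 := hmax j hj
  have h4 : dist y (D i) ≤ dist y (D j) + dist (D j) x + dist x (D i) := dist_triangle4 _ _ _ _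
  rw [dist_comm (D j) x] at h4
  linarith [hr0 i]

theorem cover {E X : Type*} [NormedAddCommGroup E] [NormedSpace ℝ E] [TopologicalSpace X] [NormalSpace X]
    [ParacompactSpace X] {O : Set E} (hO : IsOpen O) (D : X → E) (hD : Continuous D) (hDO : ∀ x, D x ∈ O) :
    ∃ (φ : X → X → ℝ) (Cs : Finset X → Set E), (∀ i, Continuous fun p => φ p i) ∧
      (LocallyFinite fun i => {p | φ p i ≠ 0}) ∧ (∀ p i, 0 ≤ φ p i) ∧ (∀ p, ∑ᶠ i, φ p i = 1) ∧
      (∀ σ τ, σ ⊆ τ → Cs σ ⊆ Cs τ) ∧ (∀ σ, Convex ℝ (Cs σ)) ∧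
      (∀ p (σ : Finset X), (∀ i ∈ σ, φ p i ≠ 0) → σ.Nonempty → D p ∈ Cs σ ∧ Cs σ ⊆ O) := by
  have h1 : ∀ x, ∃ r > 0, Metric.ball (D x) (4 * r) ⊆ O := by
    intro x
    obtain ⟨ε, hε, h⟩ := Metric.isOpen_iff.1 hO _ (hDO x)
    exact ⟨ε / 4, by positivity, by convert h using 2; ring⟩
  choose r hr0 hr using h1
  obtain ⟨f, hf⟩ := PartitionOfUnity.exists_isSubordinate (isClosed_univ (X := X))
    (fun x => D ⁻¹' Metric.ball (D x) (r x)) (fun x => Metric.isOpen_ball.preimage hD)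
    (fun x _ => mem_iUnion.2 ⟨x, by simp [hr0]⟩)
  have hnear : ∀ p i, f i p ≠ 0 → dist (D p) (D i) < r i := fun p i h =>
    hf i (subset_closure h)
  refine ⟨fun p i => f i p, fun σ => convexHull ℝ (⋃ i ∈ σ, Metric.ball (D i) (r i)), fun i => (f i).continuous,
    f.locallyFinite, fun p i => f.nonneg i p, fun p => f.sum_eq_one (mem_univ p), ?_, fun σ => convex_convexHull _ _, ?_⟩
  · intro σ τ h
    exact convexHull_mono (biUnion_subset_biUnion_left h)
  · intro p σ h hne
    refine ⟨?_, hull_sub D r hr hr0 σ hne (D p) fun i hi => hnear p i (h i hi)⟩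
    obtain ⟨i, hi⟩ := hne
    exact subset_convexHull _ _ (mem_biUnion (show i ∈ (σ : Set X) from hi) (hnear p i (h i hi)))

section
universe u
variable {R S : Type u} [NormedRing R] [NormedAlgebra ℂ R] [CompleteSpace R]
  [NormedRing S] [NormedAlgebra ℂ S] [CompleteSpace S]

theorem cont_inv {Y : Type*} [TopologicalSpace Y] {f : Y → R} (hf : Continuous f) (hu : ∀ y, IsUnit (f y)) :
    Continuous fun y => Ring.inverse (f y) := by
  rw [continuous_iff_continuousAt]
  intro y
  obtain ⟨u, hu'⟩ := hu y
  have h : ContinuousAt Ring.inverse (f y) := hu' ▸ NormedRing.inverse_continuousAt u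
  exact ContinuousAt.comp h hf.continuousAt

theorem inv_unit {x : R} (h : IsUnit x) : IsUnit (Ring.inverse x) := h.ringInverse

open unitInterval

/-- pairs: element and path -/
abbrev PP (R S : Type*) [NormedRing R] [NormedRing S] := R × C(I, S)

def mkC {K : Type*} [TopologicalSpace K] {Y : Set (PP R S)} (a : K → R) (p : K × I → S) (ha : Continuous a)
    (hp : Continuous p)
    (hY : ∀ x (z : PP R S), z.1 = a x → (∀ t, z.2 t = p (x, t)) → z ∈ Y) : C(K, Y) :=
  ⟨fun x => ⟨(a x, (ContinuousMap.curry ⟨p, hp⟩) x), hY x _ rfl fun t => rfl⟩,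
    (ha.prodMk (ContinuousMap.curry ⟨p, hp⟩).continuous).subtype_mk _⟩

theorem homot_mk {K : Type*} [TopologicalSpace K] {Y : Set (PP R S)} (f g : C(K, Y))
    (a : I × K → R) (p : (I × K) × I → S) (ha : Continuous a) (hp : Continuous p)
    (hY : ∀ x (z : PP R S), z.1 = a x → (∀ t, z.2 t = p (x, t)) → z ∈ Y)
    (h0 : ∀ x, a (0, x) = (f x).1.1) (h0' : ∀ x t, p ((0, x), t) = (f x).1.2 t)
    (h1 : ∀ x, a (1, x) = (g x).1.1) (h1' : ∀ x t, p ((1, x), t) = (g x).1.2 t) : f.Homotopic g :=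
  ⟨{ toContinuousMap := mkC a p ha hp hY
     map_zero_left := fun x => Subtype.ext (Prod.ext (h0 x) (ContinuousMap.ext (h0' x)))
     map_one_left := fun x => Subtype.ext (Prod.ext (h1 x) (ContinuousMap.ext (h1' x))) }⟩

def Ep (Γ : R →ₐ[ℂ] S) : Set (PP R S) := {z | IsUnit z.1 ∧ (∀ t, IsUnit (z.2 t)) ∧ z.2 0 = Γ z.1}
def F1 (Γ : R →ₐ[ℂ] S) : Set (PP R S) := {z | z ∈ Ep Γ ∧ z.2 1 = 1}

theorem mem_F1 (Γ : R →ₐ[ℂ] S) {z : PP R S} {a : R} {p : I → S} (h1 : z.1 = a) (h2 : ∀ t, z.2 t = p t)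
    (ha : IsUnit a) (hp : ∀ t, IsUnit (p t)) (h0 : p 0 = Γ a) (hp1 : p 1 = 1) : z ∈ F1 Γ :=
  ⟨⟨h1 ▸ ha, fun t => (h2 t).symm ▸ hp t, by rw [h2, h1, h0]⟩, by rw [h2, hp1]⟩

theorem one_F1 (Γ : R →ₐ[ℂ] S) : ((1, 1) : PP R S) ∈ F1 Γ :=
  mem_F1 Γ (a := 1) (p := fun _ => 1) rfl (fun _ => rfl) isUnit_one (fun _ => isUnit_one) (map_one Γ).symm rfl

/-- the relative lifting hypothesis on cylinders -/
def HC (Γ : R →ₐ[ℂ] S) : Prop :=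
  ∀ (K : Type u) [TopologicalSpace K] [CompactSpace K] [T2Space K] (v : K × I → S) (w0 w1 : K → R),
    Continuous v → Continuous w0 → Continuous w1 → (∀ x, IsUnit (v x)) → (∀ x, IsUnit (w0 x)) →
    (∀ x, IsUnit (w1 x)) → (∀ x, v (x, 0) = Γ (w0 x)) → (∀ x, v (x, 1) = Γ (w1 x)) →
    ∃ (U : K × I → R) (V : I × (K × I) → S) (W0 W1 : I × K → R), Continuous U ∧ Continuous V ∧
      Continuous W0 ∧ Continuous W1 ∧ (∀ x, IsUnit (U x)) ∧ (∀ x, IsUnit (V x)) ∧ (∀ x, IsUnit (W0 x)) ∧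
      (∀ x, IsUnit (W1 x)) ∧ (∀ t x, V (t, (x, 0)) = Γ (W0 (t, x))) ∧ (∀ t x, V (t, (x, 1)) = Γ (W1 (t, x))) ∧
      (∀ x, V (0, x) = v x) ∧ (∀ x, W0 (0, x) = w0 x) ∧ (∀ x, W1 (0, x) = w1 x) ∧
      (∀ x, V (1, x) = Γ (U x)) ∧ (∀ x, W0 (1, x) = U (x, 0)) ∧ (∀ x, W1 (1, x) = U (x, 1))

theorem F1_null (Γ : R →ₐ[ℂ] S) (hΓ : Continuous Γ) (hC : HC Γ)
    (K : Type u) [TopologicalSpace K] [CompactSpace K] [T2Space K] (f : C(K, F1 Γ)) :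
    f.Homotopic (.const K ⟨(1, 1), one_F1 Γ⟩) := by
  have hf1 : Continuous fun x => (f x).1.1 := continuous_fst.comp (continuous_subtype_val.comp f.continuous)
  have hf2 : Continuous fun x => (f x).1.2 := continuous_snd.comp (continuous_subtype_val.comp f.continuous)
  obtain ⟨U, V, W0, W1, hU, hV, hW0, hW1, uU, uV, uW0, uW1, e0, e1, i0, i1, i2, j0, j1, j2⟩ :=
    hC K (fun q => (f q.1).1.2 q.2) (fun x => (f x).1.1) (fun _ => 1)
      ((hf2.comp continuous_fst).eval continuous_snd) hf1 continuous_const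
      (fun q => (f q.1).2.1.2.1 q.2) (fun x => (f x).2.1.1) (fun _ => isUnit_one)
      (fun x => (f x).2.1.2.2) (fun x => ((f x).2.2).trans (map_one Γ).symm)
  let U' : K × I → R := fun q => U q * Ring.inverse (U (q.1, 1))
  have hU' : Continuous U' := hU.mul (cont_inv (by fun_prop) fun q => uU _)
  have uU' : ∀ q, IsUnit (U' q) := fun q => (uU _).mul (inv_unit (uU _))
  have U'1 : ∀ x, U' (x, 1) = 1 := fun x => Ring.mul_inverse_cancel _ (uU _)
  let m : C(K, F1 Γ) := mkC (fun x => U' (x, 0)) (fun q => Γ (U' q)) (by fun_prop) (hΓ.comp hU')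
    (fun x z h1 h2 => mem_F1 Γ h1 h2 (uU' _) (fun t => (uU' _).map Γ) rfl (by
      change Γ (U' (x, 1)) = 1
      rw [U'1, map_one]))
  have s1 : f.Homotopic m := by
    refine homot_mk f m (fun q => W0 q * Ring.inverse (W1 q))
      (fun q => V (q.1.1, (q.1.2, q.2)) * Γ (Ring.inverse (W1 q.1)))
      (hW0.mul (cont_inv hW1 uW1)) ((hV.comp (by fun_prop)).mul
        (hΓ.comp ((cont_inv hW1 uW1).comp continuous_fst))) ?_ ?_ ?_ ?_ ?_
    · rintro ⟨s, x⟩ z h1 h2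
      refine mem_F1 Γ h1 h2 ((uW0 _).mul (inv_unit (uW1 _))) (fun t => (uV _).mul ((inv_unit (uW1 _)).map Γ)) ?_ ?_
      · change V (s, (x, 0)) * Γ (Ring.inverse (W1 (s, x))) = _
        rw [e0, map_mul]
      · change V (s, (x, 1)) * Γ (Ring.inverse (W1 (s, x))) = _
        rw [e1, ← map_mul, Ring.mul_inverse_cancel _ (uW1 _), map_one]
    · intro x
      simp only [i1, i2, Ring.inverse_one, mul_one]
    · intro x t
      simp only [i0, i2, Ring.inverse_one, mul_one, map_one]
    · intro x
      simp only [j1, j2]; rfl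
    · intro x t
      simp only [j0, j2, ← map_mul]; rfl
  refine s1.trans ?_
  refine homot_mk m _ (fun q => U' (q.2, q.1)) (fun q => Γ (U' (q.1.2, max q.2 q.1.1)))
    (by fun_prop) (hΓ.comp (hU'.comp (by fun_prop))) ?_ ?_ ?_ ?_ ?_
  · rintro ⟨s, x⟩ z h1 h2
    refine mem_F1 Γ h1 h2 (uU' _) (fun t => (uU' _).map Γ) ?_ ?_
    · change Γ (U' (x, max 0 s)) = Γ (U' (x, s))
      rw [max_eq_right (show (0:I) ≤ s from s.2.1)]
    · change Γ (U' (x, max 1 s)) = 1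
      rw [max_eq_left (show s ≤ (1:I) from s.2.2), U'1, map_one]
  · intro x; rfl
  · intro x t
    change Γ (U' (x, max t 0)) = Γ (U' (x, t))
    rw [max_eq_left (show (0:I) ≤ t from t.2.1)]
  · intro x; exact U'1 x
  · intro x t
    change Γ (U' (x, max t 1)) = 1
    rw [max_eq_right (show t ≤ (1:I) from t.2.2), U'1, map_one]

end
end
end Dav

set_option linter.all false

namespace Dav
noncomputable section
open Set

section
universe u
variable {R S : Type u} [NormedRing R] [NormedAlgebra ℂ R] [CompleteSpace R]
  [NormedRing S] [NormedAlgebra ℂ S] [CompleteSpace S]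
open unitInterval

theorem seg_mem {E : Type*} [AddCommGroup E] [Module ℝ E] {C : Set E} (hc : Convex ℝ C) {a b : E} (ha : a ∈ C)
    (hb : b ∈ C) (t : I) : (1 - (t : ℝ)) • a + (t : ℝ) • b ∈ C :=
  hc ha hb (sub_nonneg.2 t.2.2) t.2.1 (by ring)

theorem cont_seg {E Y : Type*} [NormedAddCommGroup E] [NormedSpace ℝ E] [TopologicalSpace Y] {t : Y → ℝ} {a b : Y → E}
    (ht : Continuous t) (ha : Continuous a) (hb : Continuous b) : Continuous fun y => (1 - t y) • a y + t y • b y := by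
  fun_prop

def Zs1 (Γ : R →ₐ[ℂ] S) (C : Set S) : Set (PP R S) := {z | z ∈ Ep Γ ∧ z.2 1 ∈ C}

theorem mem_Zs1 (Γ : R →ₐ[ℂ] S) {C : Set S} {z : PP R S} {a : R} {p : I → S} (h1 : z.1 = a) (h2 : ∀ t, z.2 t = p t)
    (ha : IsUnit a) (hp : ∀ t, IsUnit (p t)) (h0 : p 0 = Γ a) (hp1 : p 1 ∈ C) : z ∈ Zs1 Γ C :=
  ⟨⟨h1 ▸ ha, fun t => (h2 t).symm ▸ hp t, by rw [h2, h1, h0]⟩, by rw [h2]; exact hp1⟩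

theorem Zs1_null (Γ : R →ₐ[ℂ] S) (hΓ : Continuous Γ) (hC : HC Γ) (C : Set S) (hconv : Convex ℝ C)
    (hCu : ∀ x ∈ C, IsUnit x) (u0 : R) (γ0 : C(I, S)) (hu0 : IsUnit u0) (hγ0 : ∀ t, IsUnit (γ0 t))
    (h00 : γ0 0 = Γ u0) (h01 : γ0 1 ∈ C) : Null.{u} (Zs1 Γ C) := by
  intro K _ _ _ f
  have hz0 : ((u0, γ0) : PP R S) ∈ Zs1 Γ C := ⟨⟨hu0, hγ0, h00⟩, h01⟩
  refine ⟨⟨(u0, γ0), hz0⟩, ?_⟩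
  have hf1 : Continuous fun x => (f x).1.1 := continuous_fst.comp (continuous_subtype_val.comp f.continuous)
  have hf2 : Continuous fun x => (f x).1.2 := continuous_snd.comp (continuous_subtype_val.comp f.continuous)
  let w : K → S := fun x => (f x).1.2 1
  have hw : Continuous w := hf2.eval continuous_const
  have hwC : ∀ x, w x ∈ C := fun x => (f x).2.2
  have hwi : Continuous fun x => Ring.inverse (w x) := cont_inv hw fun x => hCu _ (hwC x)
  let v0 := γ0 1
  let p : (I × K) × I → S := fun q => (f q.1.2).1.2 q.2 * (Ring.inverse (w q.1.2) *
    ((1 - ((q.1.1 * q.2 : I) : ℝ)) • w q.1.2 + ((q.1.1 * q.2 : I) : ℝ) • v0))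
  have hp : Continuous p := by
    refine Continuous.mul ((hf2.comp (by fun_prop)).eval continuous_snd) ((hwi.comp (by fun_prop)).mul ?_)
    exact cont_seg (by fun_prop) (hw.comp (by fun_prop)) continuous_const
  have hpu : ∀ q, IsUnit (p q) := fun q => ((f q.1.2).2.1.2.1 _).mul
    ((inv_unit (hCu _ (hwC _))).mul (hCu _ (seg_mem hconv (hwC _) h01 _)))
  have hp0 : ∀ s x, p ((s, x), 0) = Γ (f x).1.1 := by
    intro s x
    simp only [p, mul_zero, Set.Icc.coe_zero, sub_zero, one_smul, zero_smul, add_zero]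
    rw [Ring.inverse_mul_cancel _ (hCu _ (hwC _)), mul_one]
    exact (f x).2.1.2.2
  have hp1 : ∀ s x, p ((s, x), 1) = (1 - (s : ℝ)) • w x + (s : ℝ) • v0 := by
    intro s x
    simp only [p, mul_one]
    rw [← mul_assoc]
    change w x * _ * _ = _
    rw [Ring.mul_inverse_cancel _ (hCu _ (hwC _)), one_mul]
  have hp11 : ∀ x, p ((1, x), 1) = v0 := by
    intro x
    rw [hp1]; simp
  have hps : ∀ x t, p ((0, x), t) = (f x).1.2 t := by
    intro x t
    simp only [p, zero_mul, Set.Icc.coe_zero, sub_zero, one_smul, zero_smul, add_zero]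
    rw [Ring.inverse_mul_cancel _ (hCu _ (hwC _)), mul_one]
  let f1 : C(K, Zs1 Γ C) := mkC (fun x => (f x).1.1) (fun q => p ((1, q.1), q.2)) hf1 (hp.comp (by fun_prop))
    (fun x z h1 h2 => mem_Zs1 Γ h1 h2 (f x).2.1.1 (fun t => hpu _) (hp0 _ _) (by
      change p ((1, x), 1) ∈ C
      rw [hp11]; exact h01))
  have s1 : f.Homotopic f1 := by
    refine homot_mk f f1 (fun q => (f q.2).1.1) p (hf1.comp continuous_snd) hp ?_ (fun x => rfl) ?_ (fun x => rfl)
      (fun x t => rfl)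
    · rintro ⟨s, x⟩ z h1 h2
      refine mem_Zs1 Γ h1 h2 (f x).2.1.1 (fun t => hpu _) (hp0 _ _) ?_
      change p ((s, x), 1) ∈ C
      rw [hp1]; exact seg_mem hconv (hwC x) h01 s
    · intro x t; exact hps x t
  refine s1.trans ?_
  have hγi : Continuous fun t => Ring.inverse (γ0 t) := cont_inv γ0.continuous hγ0
  let g : C(K, F1 Γ) := mkC (fun x => Ring.inverse u0 * (f x).1.1) (fun q => Ring.inverse (γ0 q.2) * p ((1, q.1), q.2))
    (continuous_const.mul hf1) ((hγi.comp continuous_snd).mul (hp.comp (by fun_prop)))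
    (fun x z h1 h2 => mem_F1 Γ h1 h2 ((inv_unit hu0).mul (f x).2.1.1) (fun t => (inv_unit (hγ0 _)).mul (hpu _)) (by
      change Ring.inverse (γ0 0) * p ((1, x), 0) = _
      rw [hp0, h00, map_mul]
      congr 1
      have h2 : Γ u0 * Γ (Ring.inverse u0) = 1 := by
        rw [← map_mul, Ring.mul_inverse_cancel _ hu0, map_one]
      have h3 : Ring.inverse (Γ u0) * Γ u0 = 1 := Ring.inverse_mul_cancel _ (hu0.map Γ)
      exact left_inv_eq_right_inv h3 h2) (by
      change Ring.inverse (γ0 1) * p ((1, x), 1) = _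
      rw [hp11]
      exact Ring.inverse_mul_cancel _ (hγ0 _)))
  have hMm : ∀ z : F1 Γ, ((u0, γ0) : PP R S) * z.1 ∈ Zs1 Γ C := by
    intro z
    refine mem_Zs1 Γ (a := u0 * z.1.1) (p := fun t => γ0 t * z.1.2 t) rfl (fun _ => rfl) (hu0.mul z.2.1.1)
      (fun t => (hγ0 t).mul (z.2.1.2.1 t)) ?_ ?_
    · change γ0 0 * z.1.2 0 = _
      rw [h00, z.2.1.2.2, map_mul]
    · change γ0 1 * z.1.2 1 ∈ C
      rw [z.2.2, mul_one]; exact h01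
  let M : C(F1 Γ, Zs1 Γ C) := ⟨fun z => ⟨((u0, γ0) : PP R S) * z.1, hMm z⟩,
    (continuous_const.mul continuous_subtype_val).subtype_mk _⟩
  have s2 := ContinuousMap.Homotopic.comp (ContinuousMap.Homotopic.refl M) (F1_null Γ hΓ hC K g)
  have e1 : M.comp g = f1 := by
    ext1 x
    refine Subtype.ext (Prod.ext ?_ (ContinuousMap.ext fun t => ?_))
    · change u0 * (Ring.inverse u0 * (f x).1.1) = (f x).1.1
      rw [← mul_assoc, Ring.mul_inverse_cancel _ hu0, one_mul]
    · change γ0 t * (Ring.inverse (γ0 t) * p ((1, x), t)) = p ((1, x), t)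
      rw [← mul_assoc, Ring.mul_inverse_cancel _ (hγ0 _), one_mul]
  have e2 : M.comp (.const K ⟨(1, 1), one_F1 Γ⟩) = .const K ⟨(u0, γ0), hz0⟩ := by
    ext1 x
    exact Subtype.ext (mul_one _)
  rw [e1, e2] at s2
  exact s2

theorem sp_props {ι : Type*} (w : ι → ℝ) (hf : (Function.support w).Finite) (h1 : ∑ᶠ i, w i = 1) :
    (∀ i ∈ sp w, w i ≠ 0) ∧ (sp w).Nonempty := by
  refine ⟨fun i hi => (mem_sp hf i).1 hi, ?_⟩
  by_contra h
  rw [Finset.not_nonempty_iff_eq_empty] at h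
  have : ∀ i, w i = 0 := fun i => by
    by_contra hi
    have := (mem_sp hf i).2 hi
    rw [h] at this; simp at this
  simp [this] at h1

theorem partA (Γ : R →ₐ[ℂ] S) (hΓ : Continuous Γ) (hC : HC Γ)
    (hii : ∀ v : S, IsUnit v → ∃ (u : R) (γ : C(I, S)), IsUnit u ∧ (∀ t, IsUnit (γ t)) ∧ γ 0 = Γ u ∧ γ 1 = v) :
    ∃ (h : {v : S // IsUnit v} → R) (H : I × {v : S // IsUnit v} → S), Continuous h ∧ Continuous H ∧
      (∀ v, IsUnit (h v)) ∧ (∀ q, IsUnit (H q)) ∧ (∀ v, H (0, v) = Γ (h v)) ∧ ∀ v, H (1, v) = v := by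
  have hO : IsOpen {x : S | IsUnit x} := Units.isOpen
  obtain ⟨φ, Cs, hφ, hlf, h0, h1, hm, hc, hD⟩ := cover (X := {v : S // IsUnit v}) hO Subtype.val continuous_subtype_val
    (fun x => x.2)
  haveI : Nonempty {v : S // IsUnit v} := ⟨⟨1, isUnit_one⟩⟩
  obtain ⟨c, hcc, hcm⟩ := nerve.{u} φ hφ hlf h0 h1 (fun ss => Zs1 Γ (Cs ss))
    (fun ss τ h z hz => ⟨hz.1, hm ss τ h hz.2⟩) (by
      rintro ss ⟨p, hp⟩ hne
      obtain ⟨hd1, hd2⟩ := hD p ss hp hne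
      obtain ⟨u0, γ0, a1, a2, a3, a4⟩ := hii p.1 p.2
      exact Zs1_null Γ hΓ hC _ (hc ss) (fun x hx => hd2 hx) u0 γ0 a1 a2 a3 (a4 ▸ hd1))
  have hsp : ∀ p, p.1 ∈ Cs (sp (φ p)) ∧ Cs (sp (φ p)) ⊆ {x : S | IsUnit x} := by
    intro p
    obtain ⟨b1, b2⟩ := sp_props (φ p) (hlf.point_finite p) (h1 p)
    exact hD p _ b1 b2
  have c1 : Continuous fun p => (c (φ p)).1 := continuous_fst.comp hcc
  have c2 : Continuous fun p => (c (φ p)).2 := continuous_snd.comp hcc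
  have c3 : Continuous fun p => (c (φ p)).2 1 := c2.eval continuous_const
  have u3 : ∀ p, IsUnit ((c (φ p)).2 1) := fun p => (hcm p).1.2.1 1
  refine ⟨fun p => (c (φ p)).1, fun q => (c (φ q.2)).2 q.1 * (Ring.inverse ((c (φ q.2)).2 1) *
    ((1 - (q.1 : ℝ)) • ((c (φ q.2)).2 1) + (q.1 : ℝ) • q.2.1)), c1, ?_, fun p => (hcm p).1.1, ?_, ?_, ?_⟩
  · refine Continuous.mul ((c2.comp continuous_snd).eval continuous_fst) (((cont_inv c3 u3).comp continuous_snd).mul ?_)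
    exact cont_seg (by fun_prop) (c3.comp continuous_snd) (by fun_prop)
  · rintro ⟨t, p⟩
    exact ((hcm p).1.2.1 _).mul ((inv_unit (u3 p)).mul ((hsp p).2 (seg_mem (hc _) (hcm p).2 (hsp p).1 t)))
  · intro p
    simp only [Set.Icc.coe_zero, sub_zero, one_smul, zero_smul, add_zero]
    rw [Ring.inverse_mul_cancel _ (u3 p), mul_one]
    exact (hcm p).1.2.2
  · intro p
    simp only [Set.Icc.coe_one, sub_self, one_smul, zero_smul, zero_add]
    rw [← mul_assoc, Ring.mul_inverse_cancel _ (u3 p), one_mul]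

end
end
end Dav

set_option linter.all false

namespace Dav
noncomputable section
open Set

section
universe u
variable {R S : Type u} [NormedRing R] [NormedAlgebra ℂ R] [CompleteSpace R]
  [NormedRing S] [NormedAlgebra ℂ S] [CompleteSpace S]

theorem seg0 {E : Type*} [AddCommGroup E] [Module ℝ E] (a b : E) :
    (1 - ((0 : unitInterval) : ℝ)) • a + ((0 : unitInterval) : ℝ) • b = a := by simp
theorem seg1 {E : Type*} [AddCommGroup E] [Module ℝ E] (a b : E) :
    (1 - ((1 : unitInterval) : ℝ)) • a + ((1 : unitInterval) : ℝ) • b = b := by simp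

theorem PP_unit {z : PP R S} : IsUnit z ↔ IsUnit z.1 ∧ ∀ t, IsUnit (z.2 t) := by
  rw [Prod.isUnit_iff, ContinuousMap.isUnit_iff_forall_isUnit]

theorem F1_seg (Γ : R →ₐ[ℂ] S) (hΓ : Continuous Γ) {C : Set (PP R S)} (hC : Convex ℝ C) (hCu : C ⊆ {z | IsUnit z})
    {a b : PP R S} (ha : a ∈ F1 Γ) (hb : b ∈ F1 Γ) (ha' : a ∈ C) (hb' : b ∈ C) (t : unitInterval) :
    (1 - (t : ℝ)) • a + (t : ℝ) • b ∈ F1 Γ ∧ (1 - (t : ℝ)) • a + (t : ℝ) • b ∈ C := by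
  have h := seg_mem hC ha' hb' t
  obtain ⟨h1, h2⟩ := PP_unit.1 (hCu h)
  refine ⟨⟨⟨h1, h2, ?_⟩, ?_⟩, h⟩
  · change (1 - (t : ℝ)) • a.2 0 + (t : ℝ) • b.2 0 = Γ ((1 - (t : ℝ)) • a.1 + (t : ℝ) • b.1)
    rw [map_add, map_real_smul Γ hΓ, map_real_smul Γ hΓ, ha.1.2.2, hb.1.2.2]
  · change (1 - (t : ℝ)) • a.2 1 + (t : ℝ) • b.2 1 = 1
    rw [ha.2, hb.2, ← add_smul]; simp

def Zs2 (Γ : R →ₐ[ℂ] S) {X : Type*} (Cs : Finset X → Set (PP R S)) (s : Finset (Option X)) : Set (PP R S) :=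
  {z | z ∈ F1 Γ ∧ (none ∈ s ∨ z ∈ Cs (Finset.eraseNone s))}

def psi {X : Type*} (φ : X → X → ℝ) (p : X × unitInterval) : Option X → ℝ
  | none => p.2
  | some i => φ p.1 i * (1 - (p.2 : ℝ))

theorem psi_lf {X : Type*} [TopologicalSpace X] (φ : X → X → ℝ) (hlf : LocallyFinite fun i => {p | φ p i ≠ 0}) :
    LocallyFinite fun i => {p | psi φ p i ≠ 0} := by
  rintro ⟨x, s⟩
  obtain ⟨N, hN, hf⟩ := hlf x
  refine ⟨Prod.fst ⁻¹' N, continuous_fst.continuousAt.preimage_mem_nhds hN, ((hf.image some).insert none).subset ?_⟩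
  rintro (_ | i) ⟨p, hp, hpN⟩
  · simp
  · refine Or.inr ⟨i, ⟨p.1, ?_, hpN⟩, rfl⟩
    exact left_ne_zero_of_mul hp

theorem psi_sum {X : Type*} (φ : X → X → ℝ) (p : X × unitInterval) (hf : (Function.support (φ p.1)).Finite)
    (h1 : ∑ᶠ i, φ p.1 i = 1) : ∑ᶠ i, psi φ p i = 1 := by
  classical
  rw [finsum_eq_sum_of_support_subset (s := Finset.insertNone hf.toFinset), Finset.sum_insertNone]
  · rw [finsum_eq_sum_of_support_subset (s := hf.toFinset) _ (by simp)] at h1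
    simp only [psi]
    rw [← Finset.sum_mul, h1]; ring
  · rintro (_ | i) hi
    · simp
    · have : φ p.1 i ≠ 0 := left_ne_zero_of_mul hi
      simpa using this

theorem F1_null_X (Γ : R →ₐ[ℂ] S) (hΓ : Continuous Γ) (hC : HC Γ) (X : Type u) [TopologicalSpace X] [NormalSpace X]
    [ParacompactSpace X] [Nonempty X] (D : C(X, F1 Γ)) : D.Homotopic (.const X ⟨(1, 1), one_F1 Γ⟩) := by
  have hO : IsOpen {z : PP R S | IsUnit z} := Units.isOpen
  obtain ⟨φ, Cs, hφ, hlf, h0, h1, hm, hc, hD⟩ := cover hO (fun x => (D x).1)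
    (continuous_subtype_val.comp D.continuous) (fun x => PP_unit.2 ⟨(D x).2.1.1, (D x).2.1.2.1⟩)
  have hψlf := psi_lf φ hlf
  have hψ1 : ∀ p, ∑ᶠ i, psi φ p i = 1 := fun p => psi_sum φ p (hlf.point_finite p.1) (h1 p.1)
  obtain ⟨c, hcc, hcm⟩ := nerve.{u} (psi φ) (by
      rintro (_ | i)
      · exact continuous_subtype_val.comp continuous_snd
      · exact ((hφ i).comp continuous_fst).mul (by fun_prop)) hψlf (by
      rintro p (_ | i)
      · exact p.2.2.1
      · exact mul_nonneg (h0 _ _) (sub_nonneg.2 p.2.2.2)) hψ1 (Zs2 Γ Cs) (by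
      intro s t hst z hz
      refine ⟨hz.1, hz.2.imp (fun h => hst h) fun h => hm _ _ ?_ h⟩
      exact Finset.eraseNone.monotone hst) (by
      rintro s ⟨p, hp⟩ hne K _ _ _ f
      by_cases hn : none ∈ s
      · let inc : C(F1 Γ, Zs2 Γ Cs s) := ⟨fun z => ⟨z.1, z.2, Or.inl hn⟩, continuous_subtype_val.subtype_mk _⟩
        let g : C(K, F1 Γ) := ⟨fun x => ⟨(f x).1, (f x).2.1⟩, (continuous_subtype_val.comp f.continuous).subtype_mk _⟩
        exact ⟨inc ⟨(1, 1), one_F1 Γ⟩, ContinuousMap.Homotopic.comp (ContinuousMap.Homotopic.refl inc) (F1_null Γ hΓ hC K g)⟩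
      · have g1 : ∀ i ∈ Finset.eraseNone s, φ p.1 i ≠ 0 := by
          intro i hi
          exact left_ne_zero_of_mul (hp (some i) (Finset.mem_eraseNone.1 hi))
        have g2 : (Finset.eraseNone s).Nonempty := by
          obtain ⟨_ | i, hi⟩ := hne
          · exact absurd hi hn
          · exact ⟨i, Finset.mem_eraseNone.2 hi⟩
        obtain ⟨d1, d2⟩ := hD p.1 _ g1 g2
        have hfC : ∀ x, (f x).1 ∈ Cs (Finset.eraseNone s) := fun x => (f x).2.2.resolve_left hn
        have hs := fun x t => F1_seg Γ hΓ (hc _) d2 (f x).2.1 (D p.1).2 (hfC x) d1 t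
        refine ⟨⟨(D p.1).1, (D p.1).2, Or.inr d1⟩, ⟨{
          toFun := fun q => ⟨_, (hs q.2 q.1).1, Or.inr (hs q.2 q.1).2⟩
          continuous_toFun := Continuous.subtype_mk (cont_seg (by fun_prop)
            (continuous_subtype_val.comp (f.continuous.comp continuous_snd)) continuous_const) _
          map_zero_left := fun x => Subtype.ext (seg0 (f x).1 (D p.1).1)
          map_one_left := fun x => Subtype.ext (seg1 (f x).1 (D p.1).1) }⟩⟩)
  have hns : ∀ x, none ∉ sp (psi φ (x, 0)) := by
    intro x h
    exact (mem_sp (hψlf.point_finite (x, 0)) _).1 h rfl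
  let c0 : C(X, F1 Γ) := ⟨fun x => ⟨c (psi φ (x, 0)), (hcm _).1⟩, (hcc.comp (by fun_prop)).subtype_mk _⟩
  have s1 : D.Homotopic c0 := by
    have hs : ∀ x (t : unitInterval), (1 - (t : ℝ)) • (D x).1 + (t : ℝ) • (c0 x).1 ∈ F1 Γ := by
      intro x t
      obtain ⟨b1, b2⟩ := sp_props _ (hψlf.point_finite (x, 0)) (hψ1 _)
      have g1 : ∀ i ∈ Finset.eraseNone (sp (psi φ (x, 0))), φ x i ≠ 0 := by
        intro i hi
        exact left_ne_zero_of_mul (b1 (some i) (Finset.mem_eraseNone.1 hi))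
      have g2 : (Finset.eraseNone (sp (psi φ (x, 0)))).Nonempty := by
        obtain ⟨_ | i, hi⟩ := b2
        · exact absurd hi (hns x)
        · exact ⟨i, Finset.mem_eraseNone.2 hi⟩
      obtain ⟨d1, d2⟩ := hD x _ g1 g2
      exact (F1_seg Γ hΓ (hc _) d2 (D x).2 (c0 x).2 d1 ((hcm (x, 0)).2.resolve_left (hns x)) t).1
    exact ⟨{
      toFun := fun q => ⟨_, hs q.2 q.1⟩
      continuous_toFun := Continuous.subtype_mk (cont_seg (by fun_prop)
            (continuous_subtype_val.comp (D.continuous.comp continuous_snd))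
            (continuous_subtype_val.comp (c0.continuous.comp continuous_snd))) _
      map_zero_left := fun x => Subtype.ext (seg0 (D x).1 (c0 x).1)
      map_one_left := fun x => Subtype.ext (seg1 (D x).1 (c0 x).1) }⟩
  have hc1 : ∀ x y, psi φ (x, 1) = psi φ (y, 1) := by
    intro x y
    funext i
    cases i with
    | none => rfl
    | some i => simp [psi]
  obtain ⟨x0⟩ := (inferInstance : Nonempty X)
  let z1 : F1 Γ := ⟨c (psi φ (x0, 1)), (hcm _).1⟩
  have s2 : c0.Homotopic (.const X z1) := ⟨{
      toFun := fun q => ⟨c (psi φ (q.2, q.1)), (hcm _).1⟩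
      continuous_toFun := (hcc.comp (by fun_prop)).subtype_mk _
      map_zero_left := fun x => rfl
      map_one_left := fun x => Subtype.ext (congrArg c (hc1 x x0)) }⟩
  have s3 := F1_null Γ hΓ hC PUnit.{u+1} (.const _ z1)
  have s4 := ContinuousMap.Homotopic.comp s3 (ContinuousMap.Homotopic.refl (ContinuousMap.const X PUnit.unit))
  exact s1.trans (s2.trans s4)

theorem partB (Γ : R →ₐ[ℂ] S) (hΓ : Continuous Γ) (hC : HC Γ)
    (h : {v : S // IsUnit v} → R) (H : unitInterval × {v : S // IsUnit v} → S) (hh : Continuous h) (hH : Continuous H)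
    (uh : ∀ v, IsUnit (h v)) (uH : ∀ q, IsUnit (H q)) (H0 : ∀ v, H (0, v) = Γ (h v)) (H1 : ∀ v, H (1, v) = v) :
    ∃ T : unitInterval × {u : R // IsUnit u} → R, Continuous T ∧ (∀ q, IsUnit (T q)) ∧
      (∀ u, T (0, u) = h ⟨Γ u.1, u.2.map Γ⟩) ∧ (∀ u, T (1, u) = u.1) := by
  haveI : Nonempty {u : R // IsUnit u} := ⟨⟨1, isUnit_one⟩⟩
  have hi : Continuous fun u : {u : R // IsUnit u} => Ring.inverse u.1 := cont_inv continuous_subtype_val fun u => u.2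
  let G : {u : R // IsUnit u} → {v : S // IsUnit v} := fun u => ⟨Γ u.1, u.2.map Γ⟩
  have hG : Continuous G := (hΓ.comp continuous_subtype_val).subtype_mk _
  let D : C({u : R // IsUnit u}, F1 Γ) := mkC (fun u => h (G u) * Ring.inverse u.1)
    (fun q => H (q.2, G q.1) * Γ (Ring.inverse q.1.1)) ((hh.comp hG).mul hi)
    ((hH.comp (by fun_prop)).mul (hΓ.comp (hi.comp continuous_fst)))
    (fun u z h1 h2 => mem_F1 Γ h1 h2 ((uh _).mul (inv_unit u.2)) (fun t => (uH _).mul ((inv_unit u.2).map Γ)) (by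
      change H (0, G u) * Γ (Ring.inverse u.1) = _
      rw [H0, map_mul]) (by
      change H (1, G u) * Γ (Ring.inverse u.1) = _
      rw [H1, ← map_mul, Ring.mul_inverse_cancel _ u.2, map_one]))
  obtain ⟨F⟩ := F1_null_X Γ hΓ hC _ D
  refine ⟨fun q => (F q).1.1 * q.2.1, ?_, fun q => (F q).2.1.1.mul q.2.2, fun u => ?_, fun u => ?_⟩
  · exact (continuous_fst.comp (continuous_subtype_val.comp F.continuous)).mul (by fun_prop)
  · simp only [F.apply_zero]
    change h (G u) * Ring.inverse u.1 * u.1 = h (G u)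
    rw [mul_assoc, Ring.inverse_mul_cancel _ u.2, mul_one]
  · simp only [F.apply_one]
    exact one_mul _

end
end
end Dav

set_option linter.all false

namespace Dav
noncomputable section
open WeakDual Set

section
universe u
variable {A : Type u} [NormedCommRing A] [NormedAlgebra ℂ A] [CompleteSpace A]

def selB {K Y : Type*} (a b : K → Y) (p : K × Bool) : Y := if p.2 then b p.1 else a p.1

theorem cont_selB {K Y : Type*} [TopologicalSpace K] [TopologicalSpace Y] {a b : K → Y} (ha : Continuous a)
    (hb : Continuous b) : Continuous (selB a b) := by
  rw [continuous_prod_of_discrete_right]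
  rintro (_ | _)
  · exact ha
  · exact hb

theorem HC_mp (n : ℕ) : HC (mp n (gelfandTransform ℂ A)) := by
  intro K _ _ _ v w0 w1 hv hw0 hw1 uv uw0 uw1 e0 e1
  let e : C(K × Bool, K × unitInterval) := ⟨selB (fun x => (x, 0)) (fun x => (x, 1)),
    cont_selB (by fun_prop) (by fun_prop)⟩
  obtain ⟨U, V, W, hU, hV, hW, uU, uV, uW, q1, q2, q3, q4, q5⟩ := conc (A := A) (n := n) e (by
    intro g
    refine ⟨⟨fun p => (1 - (p.2 : ℝ)) • g (p.1, false) + (p.2 : ℝ) • g (p.1, true),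
      cont_seg (by fun_prop) (by fun_prop) (by fun_prop)⟩, ?_⟩
    ext ⟨x, b⟩
    cases b
    · exact seg0 (g (x, false)) (g (x, true))
    · exact seg1 (g (x, false)) (g (x, true))) v hv uv (selB w0 w1) (cont_selB hw0 hw1) (by
    rintro ⟨x, _ | _⟩
    · exact uw0 x
    · exact uw1 x) (by
    rintro ⟨x, _ | _⟩
    · exact e0 x
    · exact e1 x)
  refine ⟨U, V, fun q => W (q.1, (q.2, false)), fun q => W (q.1, (q.2, true)), hU, hV, hW.comp (by fun_prop),
    hW.comp (by fun_prop), uU, uV, fun _ => uW _, fun _ => uW _, fun t x => q1 t (x, false), fun t x => q1 t (x, true),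
    q2, fun x => q3 (x, false), fun x => q3 (x, true), q4, fun x => q5 (x, false), fun x => q5 (x, true)⟩

theorem hii_mp (n : ℕ) (v : Mn n C(characterSpace ℂ A, ℂ)) (hv : IsUnit v) :
    ∃ (u : Mn n A) (γ : C(unitInterval, Mn n C(characterSpace ℂ A, ℂ))), IsUnit u ∧ (∀ t, IsUnit (γ t)) ∧
      γ 0 = mp n (gelfandTransform ℂ A) u ∧ γ 1 = v := by
  let e : C(PEmpty.{u+1}, PUnit.{u+1}) := ⟨fun x => x.elim, continuous_of_discreteTopology⟩
  obtain ⟨U, V, W, hU, hV, hW, uU, uV, uW, q1, q2, q3, q4, q5⟩ := conc (A := A) (n := n) e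
    (fun g => ⟨0, by ext x; exact x.elim⟩) (fun _ => v) continuous_const (fun _ => hv) (fun x => x.elim)
    continuous_of_discreteTopology (fun x => x.elim) (fun x => x.elim)
  refine ⟨U PUnit.unit, ⟨fun t => V (unitInterval.symm t, PUnit.unit), hV.comp (by fun_prop)⟩, uU _, fun t => uV _, ?_, ?_⟩
  · change V (unitInterval.symm 0, _) = _
    rw [unitInterval.symm_zero, q4]
  · change V (unitInterval.symm 1, _) = _
    rw [unitInterval.symm_one, q2]

theorem davie (n : ℕ) :
    let G : {u : Mn n A // IsUnit u} → {v : Mn n C(characterSpace ℂ A, ℂ) // IsUnit v} :=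
      fun u => ⟨mp n (gelfandTransform ℂ A) u.1, u.2.map _⟩
    ∃ (hG : Continuous G) (h : C({v : Mn n C(characterSpace ℂ A, ℂ) // IsUnit v}, {u : Mn n A // IsUnit u})),
      (h.comp ⟨G, hG⟩).Homotopic (ContinuousMap.id _) ∧
      ((⟨G, hG⟩ : C(_, _)).comp h).Homotopic (ContinuousMap.id _) := by
  intro G
  have hΓ : Continuous (mp n (gelfandTransform ℂ A)) := cont_mp cont_gelfand
  have hG : Continuous G := (hΓ.comp continuous_subtype_val).subtype_mk _
  obtain ⟨h, H, hh, hH, uh, uH, H0, H1⟩ := partA _ hΓ (HC_mp (A := A) n) (hii_mp n)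
  obtain ⟨T, hT, uT, T0, T1⟩ := partB _ hΓ (HC_mp (A := A) n) h H hh hH uh uH H0 H1
  refine ⟨hG, ⟨fun v => ⟨h v, uh v⟩, hh.subtype_mk _⟩, ?_, ?_⟩
  · exact ⟨{ toFun := fun q => ⟨T q, uT q⟩
             continuous_toFun := hT.subtype_mk _
             map_zero_left := fun u => Subtype.ext (T0 u)
             map_one_left := fun u => Subtype.ext (T1 u) }⟩
  · exact ⟨{ toFun := fun q => ⟨H q, uH q⟩
             continuous_toFun := hH.subtype_mk _
             map_zero_left := fun u => Subtype.ext (H0 u)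
             map_one_left := fun u => Subtype.ext (H1 u) }⟩

end
end
end Dav

open WeakDual

theorem stmt_9
    (A : Type*) [NormedCommRing A] [NormedAlgebra ℂ A] [CompleteSpace A] (n : ℕ) :
    -- the entrywise Gelfand transform on matrices
    let Γn : Matrix (Fin n) (Fin n) A →+*
        Matrix (Fin n) (Fin n) C(characterSpace ℂ A, ℂ) :=
      (WeakDual.gelfandTransform ℂ A).toRingHom.mapMatrix
    -- `GLₙ(A)` and `GLₙ(C(Max(A), ℂ))`
    let GLA : Type _ := {u : Matrix (Fin n) (Fin n) A // IsUnit u}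
    let GLC : Type _ := {v : Matrix (Fin n) (Fin n) C(characterSpace ℂ A, ℂ) // IsUnit v}
    -- the restriction of `Γₙ` to the invertible groups
    let G : GLA → GLC := fun u => ⟨Γn u.1, u.2.map Γn⟩
    -- `G` is continuous and a homotopy equivalence
    ∃ (hG : Continuous G) (h : C(GLC, GLA)),
      (h.comp ⟨G, hG⟩).Homotopic (ContinuousMap.id GLA) ∧
      ((⟨G, hG⟩ : C(GLA, GLC)).comp h).Homotopic (ContinuousMap.id GLC) := by
  exact Dav.davie (A := A) n
end
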